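/- arXiv:1412.2654 — 2 statements merged into one kernel-verified Lean document; each statement's English description precedes it below -/
import Mathlib

section
/- Let R be a Cohen-Macaulay commutative noetherian ring with a dualizing module D. If E and E' are injective R-modules, then Tor_i^R(Hom_R(D, E'), E) is an injective R-module for all i ≥ 0. -/
/-!
Common definitions: property t(p), injective hulls, (C-)Gorenstein injective modules,
(C-)Gorenstein injective / injective / flat dimensions, small support, torsion functor,
Tor and Ext modules, semidualizing and dualizing modules, depth, Cohen-Macaulay rings,
Serre's condition (S₁), Gorenstein local rings, minimal injective resolutions.
-/

universe u

open CategoryTheory Limits DirectSum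

noncomputable section

/-- An `R`-module `S` has property `t(p)`: multiplication by every `r ∉ p` is bijective on `S`,
and every element of `S` is annihilated by a power of `p`. -/
def PropT (R : Type u) [CommRing R] (p : Ideal R) (S : Type u) [AddCommGroup S]
    [Module R S] : Prop :=
  (∀ r : R, r ∉ p → Function.Bijective (fun s : S => r • s)) ∧
  (∀ x : S, ∃ m : ℕ, 0 < m ∧ ∀ a ∈ p ^ m, a • x = 0)

/-- `E` is an injective hull of `N` over `R`: `E` is injective and `N` embeds in `E` as an
essential submodule. -/
def IsInjectiveHull (R : Type u) [CommRing R] (N : Type u) [AddCommGroup N] [Module R N]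
    (E : Type u) [AddCommGroup E] [Module R E] : Prop :=
  Module.Injective R E ∧ ∃ ι : N →ₗ[R] E, Function.Injective ι ∧
    ∀ K : Submodule R E, K ≠ ⊥ → K ⊓ LinearMap.range ι ≠ ⊥

/-- A complete injective resolution: a doubly infinite exact sequence of injective modules
which stays exact after applying `Hom_R(-, I)` for every injective module `I`. -/
structure CompleteInjRes (R : Type u) [CommRing R] where
  E : ℤ → Type u
  [acg : ∀ i, AddCommGroup (E i)]
  [mod : ∀ i, Module R (E i)]
  d : ∀ i, E i →ₗ[R] E (i + 1)
  inj : ∀ i, Module.Injective R (E i)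
  exct : ∀ i, LinearMap.range (d i) = LinearMap.ker (d (i + 1))
  homExact : ∀ (I : Type u) [AddCommGroup I] [Module R I], Module.Injective R I →
    ∀ (i : ℤ) (g : E (i + 1) →ₗ[R] I), g ∘ₗ d i = 0 →
      ∃ h : E (i + 1 + 1) →ₗ[R] I, h ∘ₗ d (i + 1) = g

attribute [instance] CompleteInjRes.acg CompleteInjRes.mod

/-- `G` is a Gorenstein injective `R`-module: it is the image of some map in a complete
injective resolution. -/
def GorensteinInjective (R : Type u) [CommRing R] (G : Type u) [AddCommGroup G]
    [Module R G] : Prop :=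
  ∃ X : CompleteInjRes R, Nonempty (G ≃ₗ[R] LinearMap.range (X.d 0))

/-- A complete `I_C I`-resolution: an exact sequence
`⋯ → Hom(C,I₁) → Hom(C,I₀) → I⁰ → I¹ → ⋯` (terms in nonnegative degrees are injective,
terms in negative degrees are of the form `Hom_R(C, I)` with `I` injective) such that
`Hom_R(Hom_R(C,J), -)` leaves it exact for every injective `R`-module `J`. -/
structure CompleteICIRes (R : Type u) [CommRing R] (C : Type u) [AddCommGroup C]
    [Module R C] where
  X : ℤ → Type u
  [acg : ∀ i, AddCommGroup (X i)]
  [mod : ∀ i, Module R (X i)]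
  d : ∀ i, X i →ₗ[R] X (i + 1)
  exct : ∀ i, LinearMap.range (d i) = LinearMap.ker (d (i + 1))
  injPos : ∀ i : ℤ, 0 ≤ i → Module.Injective R (X i)
  homCInjNeg : ∀ i : ℤ, i < 0 → ∃ (I : Type u) (_ : AddCommGroup I) (_ : Module R I),
    Module.Injective R I ∧ Nonempty (X i ≃ₗ[R] (C →ₗ[R] I))
  homExact : ∀ (J : Type u) [AddCommGroup J] [Module R J], Module.Injective R J →
    ∀ (i : ℤ) (g : (C →ₗ[R] J) →ₗ[R] X (i + 1)), d (i + 1) ∘ₗ g = 0 →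
      ∃ h : (C →ₗ[R] J) →ₗ[R] X i, d i ∘ₗ h = g

attribute [instance] CompleteICIRes.acg CompleteICIRes.mod

/-- `G` is a `C`-Gorenstein injective `R`-module: it is the image of the map
`Hom_R(C, I₀) → I⁰` in some complete `I_C I`-resolution. -/
def CGorensteinInjective (R : Type u) [CommRing R] (C : Type u) [AddCommGroup C] [Module R C]
    (G : Type u) [AddCommGroup G] [Module R G] : Prop :=
  ∃ X : CompleteICIRes R C, Nonempty (G ≃ₗ[R] LinearMap.range (X.d (-1)))

/-- `M` has a `C`-Gorenstein injective coresolution `0 → M → G⁰ → ⋯ → Gⁿ → 0`,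
i.e. `C`-Gorenstein injective dimension at most `n`. -/
def CGidLE (R : Type u) [CommRing R] (C : Type u) [AddCommGroup C] [Module R C] :
    ℕ → ModuleCat.{u} R → Prop
  | 0, M => CGorensteinInjective R C M
  | n + 1, M => ∃ (G : ModuleCat.{u} R), CGorensteinInjective R C G ∧
      ∃ ι : M →ₗ[R] G, Function.Injective ι ∧
        CGidLE R C n (ModuleCat.of R (G ⧸ LinearMap.range ι))

/-- The `C`-Gorenstein injective dimension of `M` (equal to `⊤` if `M` admits no bounded
coresolution by `C`-Gorenstein injective modules). -/
def CGid (R : Type u) [CommRing R] (C : Type u) [AddCommGroup C] [Module R C]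
    (M : Type u) [AddCommGroup M] [Module R M] : ℕ∞ :=
  sInf {n : ℕ∞ | ∃ m : ℕ, (m : ℕ∞) = n ∧ CGidLE R C m (ModuleCat.of R M)}

/-- There exists an exact sequence `0 → N → Gₙ → ⋯ → G₁ → M → 0` in which each `Gᵢ` is
`C`-Gorenstein injective (and `N` is arbitrary). -/
def CGICoresApprox (R : Type u) [CommRing R] (C : Type u) [AddCommGroup C] [Module R C] :
    ℕ → ModuleCat.{u} R → Prop
  | 0, _ => True
  | n + 1, M => ∃ (G : ModuleCat.{u} R), CGorensteinInjective R C G ∧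
      ∃ π : G →ₗ[R] M, Function.Surjective π ∧
        CGICoresApprox R C n (ModuleCat.of R (LinearMap.ker π))

/-- The `a`-torsion submodule `Γ_a(N)` of `N`. -/
def torsionSubmodule (R : Type u) [CommRing R] (a : Ideal R) (N : Type u) [AddCommGroup N]
    [Module R N] : Submodule R N :=
  ⨆ m : ℕ, Submodule.torsionBySet R N ((a ^ m : Ideal R) : Set R)

/-- `Tor_i^R(M, N)`, as an object of `ModuleCat R`. -/
abbrev TorM (R : Type u) [CommRing R] (i : ℕ) (M N : Type u) [AddCommGroup M] [Module R M]
    [AddCommGroup N] [Module R N] : ModuleCat.{u} R :=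
  ((Tor (ModuleCat.{u} R) i).obj (ModuleCat.of R M)).obj (ModuleCat.of R N)

/-- `Ext_R^i(M, N)`, as an object of `ModuleCat R`. -/
abbrev ExtM (R : Type u) [CommRing R] (i : ℕ) (M N : Type u) [AddCommGroup M] [Module R M]
    [AddCommGroup N] [Module R N] : ModuleCat.{u} R :=
  ((Ext R (ModuleCat.{u} R) i).obj (Opposite.op (ModuleCat.of R M))).obj (ModuleCat.of R N)

/-- The small support of `M`: primes `p` such that `Tor_i^R(κ(p), M) ≠ 0` for some `i`,
where `κ(p)` is the residue field of `R_p`. -/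
def smallSupport (R : Type u) [CommRing R] (M : Type u) [AddCommGroup M] [Module R M] :
    Set (PrimeSpectrum R) :=
  {p | ∃ i : ℕ,
    Nontrivial (TorM R i (IsLocalRing.ResidueField (Localization.AtPrime p.asIdeal)) M)}

/-- `C` is a semidualizing `R`-module: finitely generated, the homothety map
`R → Hom_R(C,C)` is bijective, and `Ext_R^i(C,C) = 0` for `i ≥ 1`. -/
def IsSemidualizing (R : Type u) [CommRing R] (C : Type u) [AddCommGroup C] [Module R C] : Prop :=
  Module.Finite R C ∧
  Function.Bijective (fun r : R => (r • LinearMap.id : C →ₗ[R] C)) ∧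
  ∀ i : ℕ, 1 ≤ i → Subsingleton (ExtM R i C C)

/-- `M` has injective dimension at most `n`. -/
def InjDimLE (R : Type u) [CommRing R] : ℕ → ModuleCat.{u} R → Prop
  | 0, M => Module.Injective R M
  | n + 1, M => ∃ (I : ModuleCat.{u} R), Module.Injective R I ∧
      ∃ ι : M →ₗ[R] I, Function.Injective ι ∧
        InjDimLE R n (ModuleCat.of R (I ⧸ LinearMap.range ι))

/-- `M` has flat dimension at most `n`. -/
def FlatDimLE (R : Type u) [CommRing R] : ℕ → ModuleCat.{u} R → Prop
  | 0, M => Module.Flat R M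
  | n + 1, M => ∃ (F : ModuleCat.{u} R), Module.Flat R F ∧
      ∃ π : F →ₗ[R] M, Function.Surjective π ∧
        FlatDimLE R n (ModuleCat.of R (LinearMap.ker π))

/-- `D` is a dualizing `R`-module: semidualizing of finite injective dimension. -/
def IsDualizing (R : Type u) [CommRing R] (D : Type u) [AddCommGroup D] [Module R D] : Prop :=
  IsSemidualizing R D ∧ ∃ n : ℕ, InjDimLE R n (ModuleCat.of R D)

/-- The depth of a local ring: the supremum of lengths of regular sequences contained in
the maximal ideal. -/
def localRingDepth (A : Type u) [CommRing A] [IsLocalRing A] : ℕ∞ :=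
  sSup {n : ℕ∞ | ∃ rs : List A, (∀ r ∈ rs, r ∈ IsLocalRing.maximalIdeal A) ∧
    RingTheory.Sequence.IsRegular A rs ∧ (rs.length : ℕ∞) = n}

/-- `R` is a Cohen-Macaulay ring: for each prime `p`, `depth (R_p) = dim (R_p)`. -/
def IsCohenMacaulayRing (R : Type u) [CommRing R] : Prop :=
  ∀ (p : Ideal R) (_ : p.IsPrime),
    (localRingDepth (Localization.AtPrime p) : WithBot ℕ∞) =
      ringKrullDim (Localization.AtPrime p)

/-- Serre's condition `(S₁)`: `depth (R_p) ≥ min (ht p, 1)` for every prime `p`. -/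
def SerreS1 (R : Type u) [CommRing R] : Prop :=
  ∀ (p : Ideal R) (hp : p.IsPrime),
    min (Order.height (⟨p, hp⟩ : PrimeSpectrum R)) 1 ≤ localRingDepth (Localization.AtPrime p)

/-- A Gorenstein local ring: a noetherian local ring of finite self-injective dimension. -/
def IsGorensteinLocalRing (A : Type u) [CommRing A] : Prop :=
  IsLocalRing A ∧ IsNoetherianRing A ∧ ∃ n : ℕ, InjDimLE A n (ModuleCat.of A A)

/-- A minimal injective resolution `0 → D → J⁰ → J¹ → ⋯` of `D`: an exact sequence with all
`Jⁱ` injective, in which the kernel of each differential is an essential submodule. -/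
structure MinimalInjRes (R : Type u) [CommRing R] (D : Type u) [AddCommGroup D]
    [Module R D] where
  J : ℕ → Type u
  [acg : ∀ i, AddCommGroup (J i)]
  [mod : ∀ i, Module R (J i)]
  ε : D →ₗ[R] J 0
  d : ∀ i, J i →ₗ[R] J (i + 1)
  inj : ∀ i, Module.Injective R (J i)
  ε_inj : Function.Injective ε
  exct0 : LinearMap.range ε = LinearMap.ker (d 0)
  exct : ∀ i, LinearMap.range (d i) = LinearMap.ker (d (i + 1))
  minimal : ∀ i, ∀ K : Submodule R (J i), K ≠ ⊥ → K ⊓ LinearMap.ker (d i) ≠ ⊥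

attribute [instance] MinimalInjRes.acg MinimalInjRes.mod

end

theorem Module.Injective.of_family {R : Type u} [CommRing R] [IsNoetherianRing R]
    {T : Type u} [AddCommGroup T] [Module R T] {Λ : Type*} (S : Λ → Type u)
    [∀ l, AddCommGroup (S l)] [∀ l, Module R (S l)]
    (ι : ∀ l, S l →ₗ[R] T) (π : ∀ l, T →ₗ[R] S l)
    (h : ∀ t, ∃ F : Finset Λ, ∀ F' ⊇ F, ∑ l ∈ F', ι l (π l t) = t)
    (hinj : ∀ l, Module.Injective R (S l)) : Module.Injective R T := by
  classical
  rw [← Module.Baer.iff_injective]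
  intro I g
  obtain ⟨s, hs⟩ := (IsNoetherian.noetherian (⊤ : Submodule R I))
  choose F hF using h
  let F₀ : Finset Λ := s.biUnion fun x => F (g x)
  have key : ∀ x : I, ∑ l ∈ F₀, ι l (π l (g x)) = g x := by
    have : (∑ l ∈ F₀, ι l ∘ₗ π l ∘ₗ g) = g := by
      apply LinearMap.ext_on hs
      intro x hx
      simpa using hF (g x) F₀ (Finset.subset_biUnion_of_mem (fun x => F (g x)) hx)
    intro x
    conv_rhs => rw [← this]
    simp
  have hB := fun l => Module.Baer.of_injective (hinj l) I (π l ∘ₗ g)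
  choose g' hg' using hB
  refine ⟨∑ l ∈ F₀, ι l ∘ₗ g' l, fun x hx => ?_⟩
  rw [← key]
  simp [hg' _ x hx]

theorem Module.Injective.of_retract {R : Type u} [CommRing R]
    {T S : Type u} [AddCommGroup T] [Module R T] [AddCommGroup S] [Module R S]
    (ι : S →ₗ[R] T) (π : T →ₗ[R] S) (h : ∀ x, π (ι x) = x)
    (hT : Module.Injective R T) : Module.Injective R S where
  out _ _ _ _ _ _ f hf g := by
    obtain ⟨k, hk⟩ := hT.out f hf (ι ∘ₗ g)
    exact ⟨π ∘ₗ k, fun x => by simp [hk, h]⟩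

theorem Module.Injective.of_linearEquiv {R : Type u} [CommRing R]
    {T S : Type u} [AddCommGroup T] [Module R T] [AddCommGroup S] [Module R S]
    (e : T ≃ₗ[R] S) (hT : Module.Injective R T) : Module.Injective R S :=
  .of_retract e.symm.toLinearMap e.toLinearMap (by simp) hT

theorem Module.Injective.of_subsingleton {R : Type u} [CommRing R]
    {T : Type u} [AddCommGroup T] [Module R T] [Subsingleton T] : Module.Injective R T where
  out _ _ _ _ _ _ _ _ _ := ⟨0, fun _ => Subsingleton.elim _ _⟩

theorem Module.Injective.exists_retraction {R : Type u} [CommRing R]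
    {T S : Type u} [AddCommGroup T] [Module R T] [AddCommGroup S] [Module R S]
    (hS : Module.Injective R S) (ι : S →ₗ[R] T) (hι : Function.Injective ι) :
    ∃ π : T →ₗ[R] S, ∀ x, π (ι x) = x :=
  hS.out ι hι LinearMap.id

/-- If `0 → T → V → K → 0` is exact with `V` injective and every map from a finitely generated
module to `K` lifts to `V`, then `T` is injective. -/
theorem Module.Injective.of_exact_of_lift {R : Type u} [CommRing R]
    {T V K : Type u} [AddCommGroup T] [Module R T] [AddCommGroup V] [Module R V]
    [AddCommGroup K] [Module R K] (f : T →ₗ[R] V) (g : V →ₗ[R] K)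
    (hf : Function.Injective f) (hfg : Function.Exact f g)
    (hV : Module.Injective R V)
    (h : ∀ (X : Type u) [AddCommGroup X] [Module R X] [Module.Finite R X] (k : X →ₗ[R] K),
      ∃ v : X →ₗ[R] V, g ∘ₗ v = k) : Module.Injective R T := by
  rw [← Module.Baer.iff_injective]
  intro I t
  obtain ⟨v, hv⟩ := Module.Baer.of_injective hV I (f ∘ₗ t)
  have hI : I ≤ LinearMap.ker (g ∘ₗ v) := fun x hx => by
    simpa [hv x hx] using hfg.apply_apply_eq_zero _
  obtain ⟨w, hw⟩ := h (R ⧸ I) (I.liftQ (g ∘ₗ v) hI)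
  have hr : ∀ r, g ((v - w ∘ₗ I.mkQ) r) = 0 := fun r => by
    have : g (w (I.mkQ r)) = g (v r) := LinearMap.congr_fun hw (I.mkQ r)
    simp only [LinearMap.sub_apply, LinearMap.comp_apply, map_sub, this, sub_self]
  obtain ⟨y, hy⟩ := (hfg _).1 (hr 1)
  refine ⟨LinearMap.toSpanSingleton R T y, fun x hx => hf ?_⟩
  have h0 : w (I.mkQ x) = 0 := by
    rw [show I.mkQ x = 0 by simpa [Ideal.Quotient.eq_zero_iff_mem] using hx, map_zero]
  have hx1 : (v - w ∘ₗ I.mkQ) x = x • (v - w ∘ₗ I.mkQ) 1 := by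
    rw [← map_smul, smul_eq_mul, mul_one]
  rw [LinearMap.toSpanSingleton_apply, map_smul, hy, ← hx1, LinearMap.sub_apply,
    LinearMap.comp_apply, h0, sub_zero, hv x hx, LinearMap.comp_apply]

/-- The cokernel of an injective map of injective modules is injective. -/
theorem Module.Injective.of_exact {R : Type u} [CommRing R]
    {T V K : Type u} [AddCommGroup T] [Module R T] [AddCommGroup V] [Module R V]
    [AddCommGroup K] [Module R K] (f : T →ₗ[R] V) (g : V →ₗ[R] K)
    (hf : Function.Injective f) (hfg : Function.Exact f g) (hg : Function.Surjective g)
    (hT : Module.Injective R T) (hV : Module.Injective R V) : Module.Injective R K := by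
  obtain ⟨r, hr⟩ := hT.exists_retraction f hf
  have hk : LinearMap.ker g ≤ LinearMap.ker (LinearMap.id - f ∘ₗ r) := by
    intro x hx
    obtain ⟨y, rfl⟩ := (hfg x).1 hx
    simp [hr]
  let e := g.quotKerEquivOfSurjective hg
  refine .of_retract ((LinearMap.ker g).liftQ _ hk ∘ₗ e.symm.toLinearMap) g (fun x => ?_) hV
  obtain ⟨v, rfl⟩ := hg x
  have : e.symm (g v) = (LinearMap.ker g).mkQ v := by
    rw [LinearEquiv.symm_apply_eq]; rfl
  simp [this, hfg.apply_apply_eq_zero]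

section
variable {R : Type u} [CommRing R]

theorem DirectSum.exists_finset_sum_lof_component {Λ : Type*} [DecidableEq Λ] (S : Λ → Type u)
    [∀ l, AddCommGroup (S l)] [∀ l, Module R (S l)] (t : ⨁ l, S l) :
    ∃ F : Finset Λ, ∀ F' ⊇ F,
      ∑ l ∈ F', DirectSum.lof R Λ S l (DirectSum.component R Λ S l t) = t := by
  classical
  refine ⟨DFinsupp.support t, fun F' h => ?_⟩
  rw [← Finset.sum_subset h]
  · exact DirectSum.sum_support_of t
  · intro l _ hl
    have : t l = 0 := by simpa using hl
    rw [show DirectSum.component R Λ S l t = t l from rfl, this, map_zero]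

theorem Module.Injective.directSum [IsNoetherianRing R] {Λ : Type u} (S : Λ → Type u)
    [∀ l, AddCommGroup (S l)] [∀ l, Module R (S l)] (h : ∀ l, Module.Injective R (S l)) :
    Module.Injective R (⨁ l, S l) := by
  classical
  exact .of_family S (fun l => DirectSum.lof R Λ S l) (fun l => DirectSum.component R Λ S l)
    (DirectSum.exists_finset_sum_lof_component S) h

variable {M : Type u} [AddCommGroup M] [Module R M]

theorem Module.Injective.iSup_of_iSupIndep [IsNoetherianRing R] {Λ : Type u}
    (A : Λ → Submodule R M) (hA : iSupIndep A) (h : ∀ l, Module.Injective R (A l)) :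
    Module.Injective R (iSup A : Submodule R M) := by
  classical
  have e := LinearEquiv.ofInjective (DFinsupp.lsum ℕ fun l => (A l).subtype)
    hA.dfinsupp_lsum_injective
  rw [← Submodule.iSup_eq_range_dfinsupp_lsum] at e
  exact .of_linearEquiv e (Module.Injective.directSum (fun l => A l) h)

theorem sSupIndep_insert_of_disjoint {α : Type*} [CompleteLattice α] [IsModularLattice α]
    {s : Set α} (hs : sSupIndep s) {a : α} (ha : Disjoint a (sSup s)) : sSupIndep (insert a s) := by
  intro x hx
  by_cases xa : x = a
  · subst xa
    exact ha.mono_right (sSup_le_sSup (by simp))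
  · have hxs : x ∈ s := hx.resolve_left xa
    have h : insert a s \ {x} = s \ {x} ∪ {a} := by
      rw [Set.insert_sdiff_of_notMem _ (by simpa using Ne.symm xa), Set.union_singleton]
    rw [h, sSup_union, sSup_singleton]
    apply (hs hxs).disjoint_sup_right_of_disjoint_sup_left
    rw [← sSup_insert, Set.insert_sdiff_singleton, Set.insert_eq_of_mem hxs]
    exact ha.symm

theorem mem_torsionSubmodule {p : Ideal R} {x : M} :
    x ∈ torsionSubmodule R p M ↔ ∃ m : ℕ, ∀ a ∈ p ^ m, a • x = 0 := by
  unfold torsionSubmodule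
  rw [Submodule.mem_iSup_of_directed]
  · simp [Submodule.mem_torsionBySet_iff]
  · refine Monotone.directed_le fun m n h => ?_
    exact Submodule.torsionBySet_le_torsionBySet_of_subset (Ideal.pow_le_pow_right h)

theorem exists_pow_smul_eq_zero_of_fg {p : Ideal R} {N : Submodule R M} (hN : N.FG)
    (h : ∀ x ∈ N, ∃ m : ℕ, ∀ a ∈ p ^ m, a • x = 0) :
    ∃ m : ℕ, ∀ x ∈ N, ∀ a ∈ p ^ m, a • x = 0 := by
  classical
  obtain ⟨s, rfl⟩ := hN
  choose! f hf using h
  refine ⟨s.sup f, fun x hx a ha => ?_⟩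
  have : Submodule.span R (s : Set M) ≤ Submodule.torsionBy R M a := by
    rw [Submodule.span_le]
    intro y hy
    exact hf y (Submodule.subset_span hy) a (Ideal.pow_le_pow_right (Finset.le_sup hy) ha)
  exact this hx

theorem Module.Injective.torsionSubmodule [IsNoetherianRing R] (p : Ideal R)
    (h : Module.Injective R M) : Module.Injective R (torsionSubmodule R p M) := by
  rw [← Module.Baer.iff_injective]
  intro I g
  obtain ⟨m, hm⟩ := exists_pow_smul_eq_zero_of_fg (p := p)
    ((IsNoetherian.noetherian (⊤ : Submodule R I)).map ((_root_.torsionSubmodule R p M).subtype ∘ₗ g))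
    (by
      rintro _ ⟨x, -, rfl⟩
      exact mem_torsionSubmodule.1 (g x).2)
  obtain ⟨k, hk⟩ := p.exists_pow_inf_eq_pow_smul (M := R) I
  have hle : p ^ (k + m) ⊓ I ≤ p ^ m * I := by
    have := hk (k + m) (by omega)
    simp only [Ideal.smul_top_eq_map, Algebra.algebraMap_self, Ideal.map_id,
      Submodule.restrictScalars_self, Nat.add_sub_cancel_left] at this
    rw [this]
    exact Ideal.mul_mono_right inf_le_right
  have hz : ∀ x : I, (x : R) ∈ p ^ (k + m) → g x = 0 := by
    intro x hx
    have h1 : (x : R) ∈ p ^ m * I := hle ⟨hx, x.2⟩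
    have h2 : ∀ y ∈ p ^ m * I, ∃ hy : y ∈ I, g ⟨y, hy⟩ = 0 := by
      intro y hy'
      refine Submodule.mul_induction_on hy' (fun a ha b hb => ?_) (fun a b ha hb => ?_)
      · have := hm _ ⟨⟨b, hb⟩, trivial, rfl⟩ a ha
        rw [← map_smul] at this
        exact ⟨I.mul_mem_left a hb, Subtype.ext this⟩
      · obtain ⟨ha, ha'⟩ := ha
        obtain ⟨hb, hb'⟩ := hb
        refine ⟨I.add_mem ha hb, ?_⟩
        rw [← AddMemClass.mk_add_mk I a b ha hb, map_add, ha', hb', add_zero]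
    exact (h2 x h1).2
  let q : Ideal R := p ^ (k + m)
  let J : Submodule R I := Submodule.comap I.subtype q
  let ι : (I ⧸ J) →ₗ[R] R ⧸ q := J.mapQ q I.subtype le_rfl
  have hι : Function.Injective ι := by
    rw [← LinearMap.ker_eq_bot, Submodule.ker_mapQ]
    exact Submodule.mkQ_map_self J
  obtain ⟨f, hf⟩ := h.out ι hι (J.liftQ ((_root_.torsionSubmodule R p M).subtype ∘ₗ g)
    (fun x hx => by simp [hz x hx]))
  refine ⟨LinearMap.toSpanSingleton R _ ⟨f (q.mkQ 1), mem_torsionSubmodule.2 ⟨k + m, fun a ha => ?_⟩⟩,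
    fun x hx => Subtype.ext ?_⟩
  · rw [← map_smul, ← map_smul, smul_eq_mul, mul_one,
      show q.mkQ a = 0 by simpa [Ideal.Quotient.eq_zero_iff_mem] using ha, map_zero]
  · have := hf (J.mkQ ⟨x, hx⟩)
    simp only [LinearMap.toSpanSingleton_apply, Submodule.coe_smul]
    rw [← map_smul, ← map_smul, smul_eq_mul, mul_one]
    exact this

theorem PropT.torsionSubmodule [IsNoetherianRing R] {p : Ideal R}
    (h : Module.Injective R M) (hmax : ∀ q ∈ associatedPrimes R M, p ≤ q → q = p) :
    PropT R p (torsionSubmodule R p M) := by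
  have hinj : ∀ r : R, r ∉ p → Function.Injective (fun s : _root_.torsionSubmodule R p M => r • s) := by
    intro r hr
    let f : _root_.torsionSubmodule R p M →ₗ[R] _root_.torsionSubmodule R p M :=
      LinearMap.lsmul R _ r
    suffices LinearMap.ker f = ⊥ from LinearMap.ker_eq_bot.1 this
    by_contra hne
    have : Nontrivial (LinearMap.ker f) := Submodule.nontrivial_iff_ne_bot.2 hne
    obtain ⟨q, hq⟩ := associatedPrimes.nonempty R (LinearMap.ker f)
    have hqM : q ∈ associatedPrimes R M := hq.map_of_injective
      ((_root_.torsionSubmodule R p M).subtype ∘ₗ (LinearMap.ker f).subtype)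
      (Subtype.val_injective.comp Subtype.val_injective)
    obtain ⟨hqp, x, hx⟩ := isAssociatedPrime_iff.1 hq
    have hmem : ∀ a : R, a ∈ q ↔ a • x = 0 := fun a => by
      rw [hx, Submodule.mem_colon_singleton, Submodule.mem_bot]
    obtain ⟨m, hm⟩ := mem_torsionSubmodule.1 x.1.2
    have hpq : p ≤ q := by
      intro a ha
      refine hqp.mem_of_pow_mem m ((hmem _).2 (Subtype.ext (Subtype.ext ?_)))
      exact hm _ (Ideal.pow_mem_pow ha m)
    refine hr ((hmax q hqM hpq) ▸ (hmem r).2 (Subtype.ext ?_))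
    exact x.2
  refine ⟨fun r hr => ⟨hinj r hr, ?_⟩, fun x => ?_⟩
  · let f : _root_.torsionSubmodule R p M →ₗ[R] _root_.torsionSubmodule R p M :=
      LinearMap.lsmul R _ r
    obtain ⟨π, hπ⟩ := (h.torsionSubmodule p).exists_retraction f (hinj r hr)
    exact fun x => ⟨π x, by simpa [f] using hπ x⟩
  · obtain ⟨m, hm⟩ := mem_torsionSubmodule.1 x.2
    exact ⟨m + 1, Nat.succ_pos _, fun a ha =>
      Subtype.ext (hm a (Ideal.pow_le_pow_right (Nat.le_succ m) ha))⟩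

/-- An injective module over a noetherian ring is the internal direct sum of injective submodules,
each with property `t(p)` for some prime `p`. -/
theorem Module.Injective.exists_decomposition [IsNoetherianRing R] (h : Module.Injective R M) :
    ∃ (Λ : Type u) (A : Λ → Submodule R M) (p : Λ → Ideal R) (π : ∀ l, M →ₗ[R] A l),
      (∀ t, ∃ F : Finset Λ, ∀ F' ⊇ F, ∑ l ∈ F', (A l).subtype (π l t) = t) ∧
      ∀ l, (p l).IsPrime ∧ Module.Injective R (A l) ∧ PropT R (p l) (A l) := by
  classical
  let good : Submodule R M → Prop := fun N =>
    N ≠ ⊥ ∧ ∃ p : Ideal R, p.IsPrime ∧ Module.Injective R N ∧ PropT R p N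
  obtain ⟨s, hs⟩ := zorn_subset {s : Set (Submodule R M) | sSupIndep s ∧ ∀ N ∈ s, good N}
    fun c hc1 hc2 => ⟨⋃₀ c, ⟨iSupIndep_sUnion_of_directed hc2.directedOn fun s hs => (hc1 hs).1,
      fun a ⟨s, sc, as⟩ => (hc1 sc).2 a as⟩, fun _ => Set.subset_sUnion_of_mem⟩
  have hs1 := hs.prop.1
  have hs2 := hs.prop.2
  have hind : iSupIndep fun N : s => (N : Submodule R M) := sSupIndep_iff _ |>.1 hs1
  have hinj : Module.Injective R (sSup s : Submodule R M) := by
    rw [sSup_eq_iSup']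
    exact Module.Injective.iSup_of_iSupIndep _ hind fun l => (hs2 l l.2).2.choose_spec.2.1
  have htop : sSup s = ⊤ := by
    obtain ⟨π, hπ⟩ := hinj.exists_retraction (sSup s).subtype Subtype.val_injective
    have hC := LinearMap.isCompl_of_proj hπ
    set C := LinearMap.ker π
    have hCinj : Module.Injective R C := by
      refine .of_retract C.subtype
        (LinearMap.codRestrict C (LinearMap.id - (sSup s).subtype ∘ₗ π) fun x => ?_) (fun x => ?_) h
      · simp only [C, LinearMap.mem_ker, map_sub, LinearMap.sub_apply, LinearMap.comp_apply, hπ,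
          LinearMap.id_apply, sub_self]
      · have : π x = 0 := x.2
        ext
        simp [this]
    by_contra hne
    have hC0 : C ≠ ⊥ := fun h0 => hne (by simpa [h0] using hC.sup_eq_top)
    have := Submodule.nontrivial_iff_ne_bot.2 hC0
    obtain ⟨p, hp, hpmax⟩ := set_has_maximal_iff_noetherian.2 (inferInstanceAs (IsNoetherian R R))
      (associatedPrimes R C) (associatedPrimes.nonempty R C)
    have hT := PropT.torsionSubmodule (M := C) hCinj fun q hq hpq =>
      (hpq.eq_of_not_lt (hpmax q hq)).symm
    have e := Submodule.equivSubtypeMap C (_root_.torsionSubmodule R p C)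
    set G := Submodule.map C.subtype (_root_.torsionSubmodule R p C)
    have hG : good G := by
      refine ⟨?_, p, hp.isPrime, .of_linearEquiv e (hCinj.torsionSubmodule p), ?_, ?_⟩
      · obtain ⟨hpp, x, hx⟩ := isAssociatedPrime_iff.1 hp
        intro h0
        have hxG : C.subtype x ∈ G := ⟨x, mem_torsionSubmodule.2 ⟨1, fun a ha => by
          rw [pow_one, hx, Submodule.mem_colon_singleton, Submodule.mem_bot] at ha
          exact ha⟩, rfl⟩
        have : x = 0 := by simpa [h0] using hxG
        apply hpp.ne_top
        rw [hx, this]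
        exact (Ideal.eq_top_iff_one _).2 (by simp [Submodule.mem_colon_singleton])
      · intro r hr
        have := (e.toEquiv.bijective.comp (hT.1 r hr)).comp e.symm.toEquiv.bijective
        convert this using 1
        ext x
        simp
      · intro x
        obtain ⟨m, hm, h'⟩ := hT.2 (e.symm x)
        exact ⟨m, hm, fun a ha => by
          have := h' a ha
          rwa [← map_smul, LinearEquiv.map_eq_zero_iff] at this⟩
    have hGC : G ≤ C := Submodule.map_subtype_le _ _
    have hdis : Disjoint G (sSup s) := hC.symm.disjoint.mono_left hGC
    have hGs : G ∈ s := hs.mem_of_prop_insert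
      ⟨sSupIndep_insert_of_disjoint hs1 hdis, fun N hN => hN.elim (fun h => h ▸ hG) (hs2 N)⟩
    exact hG.1 (hdis.eq_bot_of_le (le_sSup hGs))
  have hI := DirectSum.isInternal_submodule_of_iSupIndep_of_iSup_eq_top hind
    (by rwa [← sSup_eq_iSup'])
  let e := LinearEquiv.ofBijective (DirectSum.coeLinearMap fun N : s => (N : Submodule R M)) hI
  refine ⟨s, fun N => N, fun N => (hs2 N N.2).2.choose,
    fun l => DirectSum.component R s _ l ∘ₗ e.symm.toLinearMap, fun t => ?_,
    fun l => (hs2 l l.2).2.choose_spec⟩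
  obtain ⟨F, hF⟩ := DirectSum.exists_finset_sum_lof_component (R := R)
    (fun N : s => (N : Submodule R M)) (e.symm t)
  refine ⟨F, fun F' hF' => ?_⟩
  have := congrArg e (hF F' hF')
  rw [map_sum, LinearEquiv.apply_symm_apply] at this
  conv_rhs => rw [← this]
  refine Finset.sum_congr rfl fun l _ => ?_
  exact (DirectSum.coeLinearMap_lof (fun N : s => (N : Submodule R M)) l
    (DirectSum.component R s _ l (e.symm t))).symm
end

section
open TensorProduct
variable {R : Type u} [CommRing R]

theorem Module.exists_presentation (R X : Type u) [CommRing R] [IsNoetherianRing R] [AddCommGroup X] [Module R X]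
    [Module.Finite R X] : ∃ (m n : ℕ) (g : (Fin m → R) →ₗ[R] (Fin n → R))
      (f : (Fin n → R) →ₗ[R] X), Function.Exact g f ∧ Function.Surjective f := by
  obtain ⟨n, f, hf⟩ := Module.Finite.exists_fin' R X
  obtain ⟨m, g, hg⟩ := Module.Finite.exists_fin' R (LinearMap.ker f)
  refine ⟨m, n, (LinearMap.ker f).subtype ∘ₗ g, f, ?_, hf⟩
  rw [LinearMap.exact_iff, LinearMap.range_comp, LinearMap.range_eq_top.2 hg]
  simp

theorem Module.Injective.exact_lcomp {A B C E : Type u} [AddCommGroup A] [AddCommGroup B]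
    [AddCommGroup C] [AddCommGroup E] [Module R A] [Module R B] [Module R C] [Module R E]
    (hE : Module.Injective R E) {f : A →ₗ[R] B} {g : B →ₗ[R] C} (h : Function.Exact f g) :
    Function.Exact (LinearMap.lcomp R E g) (LinearMap.lcomp R E f) := by
  intro φ
  constructor
  · intro hφ
    have hk : LinearMap.ker g ≤ LinearMap.ker φ := by
      intro x hx
      obtain ⟨y, rfl⟩ := (h x).1 hx
      exact LinearMap.congr_fun hφ y
    obtain ⟨ψ, hψ⟩ := hE.out ((LinearMap.ker g).liftQ g le_rfl)
      (LinearMap.ker_eq_bot.1 (Submodule.ker_liftQ_eq_bot _ _ _ le_rfl))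
      ((LinearMap.ker g).liftQ φ hk)
    exact ⟨ψ, LinearMap.ext fun x => hψ ((LinearMap.ker g).mkQ x)⟩
  · rintro ⟨ψ, rfl⟩
    ext x
    simp [h.apply_apply_eq_zero]

theorem Module.Injective.lcomp_surjective {B C E : Type u} [AddCommGroup B]
    [AddCommGroup C] [AddCommGroup E] [Module R B] [Module R C] [Module R E]
    (hE : Module.Injective R E) {g : B →ₗ[R] C} (h : Function.Injective g) :
    Function.Surjective (LinearMap.lcomp R E g) := fun φ =>
  (hE.out g h φ).imp fun _ hψ => LinearMap.ext hψ

section homTensorEval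
variable (J E X : Type u) [AddCommGroup J] [Module R J] [AddCommGroup E] [Module R E]
  [AddCommGroup X] [Module R X]

/-- The Hom-evaluation map `Hom(J, E) ⊗ X → Hom(Hom(X, J), E)`. -/
def homTensorEval : (J →ₗ[R] E) ⊗[R] X →ₗ[R] ((X →ₗ[R] J) →ₗ[R] E) :=
  TensorProduct.lift (LinearMap.mk₂ R (fun φ x => φ ∘ₗ LinearMap.applyₗ x)
    (fun _ _ _ => by ext; simp) (fun _ _ _ => by ext; simp) (fun _ _ _ => by ext; simp)
    (fun _ _ _ => by ext; simp))

@[simp]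
theorem homTensorEval_tmul (φ : J →ₗ[R] E) (x : X) (f : X →ₗ[R] J) :
    homTensorEval J E X (φ ⊗ₜ x) f = φ (f x) := rfl

variable {J E X}

theorem homTensorEval_rTensor {J' : Type u} [AddCommGroup J'] [Module R J'] (h : J' →ₗ[R] J)
    (z : (J →ₗ[R] E) ⊗[R] X) (f : X →ₗ[R] J') :
    homTensorEval J' E X ((LinearMap.lcomp R E h).rTensor X z) f =
      homTensorEval J E X z (h ∘ₗ f) := by
  induction z with
  | zero => simp
  | tmul φ x => simp
  | add a b ha hb => simp [ha, hb]

theorem homTensorEval_bijective_pi (n : ℕ) :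
    Function.Bijective (homTensorEval (R := R) J E (Fin n → R)) := by
  classical
  let e₁ := TensorProduct.piScalarRight R R (J →ₗ[R] E) (Fin n)
  let e₂ : (Fin n → (J →ₗ[R] E)) ≃ₗ[R] ((Fin n → J) →ₗ[R] E) := LinearMap.lsum R (fun _ => J) R
  let e₃ : ((Fin n → J) →ₗ[R] E) ≃ₗ[R] (((Fin n → R) →ₗ[R] J) →ₗ[R] E) :=
    (((Pi.basisFun R (Fin n)).constr R).arrowCongr (LinearEquiv.refl R E))
  have : homTensorEval (R := R) J E (Fin n → R) = (e₁ ≪≫ₗ e₂ ≪≫ₗ e₃).toLinearMap := by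
    ext φ i f
    suffices φ (f (Pi.single i 1)) = ∑ c, (if c = i then φ else 0) (f (Pi.single c 1)) by
      simpa [e₁, e₂, e₃, LinearEquiv.arrowCongr_apply, Module.Basis.constr, Pi.single_apply]
    rw [Finset.sum_eq_single i (fun c _ hc => by simp [hc]) (by simp), if_pos rfl]
  rw [this]
  exact LinearEquiv.bijective _

theorem homTensorEval_bijective [IsNoetherianRing R] (hE : Module.Injective R E)
    [Module.Finite R X] : Function.Bijective (homTensorEval (R := R) J E X) := by
  obtain ⟨m, n, g, f, hgf, hf⟩ := Module.exists_presentation R X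
  refine LinearMap.bijective_of_surjective_of_bijective_of_right_exact
    (g.lTensor (J →ₗ[R] E)) (f.lTensor (J →ₗ[R] E))
    (LinearMap.lcomp R E (LinearMap.lcomp R J g)) (LinearMap.lcomp R E (LinearMap.lcomp R J f))
    (homTensorEval J E _) (homTensorEval J E _) _ ?_ ?_ (lTensor_exact _ hgf hf)
    (hE.exact_lcomp (LinearMap.exact_lcomp_of_exact_of_surjective J hgf hf))
    (homTensorEval_bijective_pi m).2 (homTensorEval_bijective_pi n)
    (LinearMap.lTensor_surjective _ hf)
    (hE.lcomp_surjective (LinearMap.lcomp_injective_of_surjective f hf))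
  · ext; simp
  · ext; simp

theorem Module.Flat.of_injective_hom [IsNoetherianRing R] (hE : Module.Injective R E)
    (hJ : Module.Injective R J) : Module.Flat R (J →ₗ[R] E) := by
  rw [Module.Flat.iff_lTensor_injective]
  intro I _
  have h1 := LinearMap.lcomp_injective_of_surjective (S := R) (N := E) _
    (hJ.lcomp_surjective (g := I.subtype) Subtype.val_injective)
  have h2 : homTensorEval J E R ∘ₗ I.subtype.lTensor (J →ₗ[R] E) =
      LinearMap.lcomp R E (LinearMap.lcomp R J I.subtype) ∘ₗ homTensorEval J E I := by
    ext; simp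
  have h3 := h1.comp (homTensorEval_bijective (J := J) (X := I) hE).1
  rw [← LinearMap.coe_comp, ← h2, LinearMap.coe_comp] at h3
  exact h3.of_comp
end homTensorEval

section tensorHomMap
variable (F E X : Type u) [AddCommGroup F] [Module R F] [AddCommGroup E] [Module R E]
  [AddCommGroup X] [Module R X]

/-- The tensor evaluation map `F ⊗ Hom(X, E) → Hom(X, F ⊗ E)`. -/
def tensorHomMap : F ⊗[R] (X →ₗ[R] E) →ₗ[R] (X →ₗ[R] F ⊗[R] E) :=
  TensorProduct.lift (LinearMap.llcomp R X E (F ⊗[R] E) ∘ₗ TensorProduct.mk R F E)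

@[simp]
theorem tensorHomMap_tmul (a : F) (f : X →ₗ[R] E) (x : X) :
    tensorHomMap F E X (a ⊗ₜ f) x = a ⊗ₜ f x := rfl

variable {F E X}

theorem tensorHomMap_rTensor {F' : Type u} [AddCommGroup F'] [Module R F'] (h : F →ₗ[R] F')
    (z : F ⊗[R] (X →ₗ[R] E)) :
    tensorHomMap F' E X (h.rTensor _ z) = h.rTensor E ∘ₗ tensorHomMap F E X z := by
  induction z with
  | zero => simp
  | tmul φ x => ext; simp
  | add a b ha hb => simp [ha, hb, LinearMap.comp_add]

theorem tensorHomMap_bijective_pi (n : ℕ) :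
    Function.Bijective (tensorHomMap (R := R) F E (Fin n → R)) := by
  classical
  let e₁ : ((Fin n → R) →ₗ[R] E) ≃ₗ[R] (Fin n → E) := ((Pi.basisFun R (Fin n)).constr R).symm
  let e₂ := TensorProduct.piRight R R F (fun _ : Fin n => E)
  let e₃ : (Fin n → F ⊗[R] E) ≃ₗ[R] ((Fin n → R) →ₗ[R] F ⊗[R] E) :=
    (Pi.basisFun R (Fin n)).constr R
  have : tensorHomMap (R := R) F E (Fin n → R) =
      (LinearEquiv.lTensor F e₁ ≪≫ₗ e₂ ≪≫ₗ e₃).toLinearMap := by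
    refine TensorProduct.ext' fun a f => (Pi.basisFun R (Fin n)).ext fun i => ?_
    simp only [LinearEquiv.coe_coe, LinearEquiv.trans_apply, e₃, Module.Basis.constr_basis]
    simp [e₁, e₂]
  rw [this]
  exact LinearEquiv.bijective _

theorem tensorHomMap_bijective [IsNoetherianRing R] [Module.Flat R F]
    [Module.Finite R X] : Function.Bijective (tensorHomMap (R := R) F E X) := by
  obtain ⟨m, n, g, f, hgf, hf⟩ := Module.exists_presentation R X
  refine LinearMap.bijective_of_bijective_of_injective_of_left_exact
    ((LinearMap.lcomp R E f).lTensor F) ((LinearMap.lcomp R E g).lTensor F)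
    (LinearMap.lcomp R (F ⊗[R] E) f) (LinearMap.lcomp R (F ⊗[R] E) g)
    (tensorHomMap F E _) (tensorHomMap F E _) (tensorHomMap F E _) ?_ ?_
    (Module.Flat.lTensor_exact _ (LinearMap.exact_lcomp_of_exact_of_surjective E hgf hf))
    (LinearMap.exact_lcomp_of_exact_of_surjective _ hgf hf)
    (tensorHomMap_bijective_pi n) (tensorHomMap_bijective_pi m).1
    (Module.Flat.lTensor_preserves_injective_linearMap _
      (LinearMap.lcomp_injective_of_surjective f hf))
    (LinearMap.lcomp_injective_of_surjective f hf)
  · ext; simp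
  · ext; simp

theorem Module.Injective.tensorProduct_of_flat [IsNoetherianRing R] [Module.Flat R F]
    (hE : Module.Injective R E) : Module.Injective R (F ⊗[R] E) := by
  rw [← Module.Baer.iff_injective]
  intro I g
  obtain ⟨z, rfl⟩ := (tensorHomMap_bijective (F := F) (E := E) (X := I)).2 g
  obtain ⟨w, rfl⟩ := LinearMap.lTensor_surjective F
    (hE.lcomp_surjective (g := I.subtype) Subtype.val_injective) z
  refine ⟨tensorHomMap F E R w, fun x hx => ?_⟩
  induction w with
  | zero => simp
  | tmul φ x => simp
  | add a b ha hb => simp [ha, hb]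
end tensorHomMap
end

section
variable {R : Type u} [CommRing R]

/-- The derived category version of `Ext`, for unbundled modules. -/
abbrev ModExt (R : Type u) [CommRing R] (j : ℕ) (X Y : Type u) [AddCommGroup X] [Module R X]
    [AddCommGroup Y] [Module R Y] : Type u :=
  Abelian.Ext.{u} (ModuleCat.of R X) (ModuleCat.of R Y) j

namespace ModExt

variable {A B C X Y : Type u} [AddCommGroup A] [AddCommGroup B] [AddCommGroup C]
  [AddCommGroup X] [AddCommGroup Y] [Module R A] [Module R B] [Module R C] [Module R X]
  [Module R Y]

/-- Covariant functoriality of `ModExt`. -/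
noncomputable def post (j : ℕ) (X : Type u) [AddCommGroup X] [Module R X] (f : A →ₗ[R] B) :
    ModExt R j X A →ₗ[R] ModExt R j X B :=
  (Abelian.Ext.mk₀ (ModuleCat.ofHom f)).postcompOfLinear R (ModuleCat.of R X) (add_zero j)

/-- Contravariant functoriality of `ModExt`. -/
noncomputable def pre (j : ℕ) (Y : Type u) [AddCommGroup Y] [Module R Y] (f : A →ₗ[R] B) :
    ModExt R j B Y →ₗ[R] ModExt R j A Y :=
  (Abelian.Ext.mk₀ (ModuleCat.ofHom f)).precompOfLinear R (ModuleCat.of R Y) (zero_add j)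

theorem post_comp (j : ℕ) (f : A →ₗ[R] B) (g : B →ₗ[R] C) :
    post j X (g ∘ₗ f) = post j X g ∘ₗ post j X f := by
  ext x
  simp [post]

theorem pre_comp (j : ℕ) (f : A →ₗ[R] B) (g : B →ₗ[R] C) :
    pre j Y (g ∘ₗ f) = pre j Y f ∘ₗ pre j Y g := by
  ext x
  simp [pre]

theorem post_smul_id (j : ℕ) (r : R) :
    post j X (r • LinearMap.id : A →ₗ[R] A) = r • LinearMap.id := by
  ext x
  have : ModuleCat.ofHom (r • LinearMap.id : A →ₗ[R] A) = r • 𝟙 (ModuleCat.of R A) := rfl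
  simp [post, this, Abelian.Ext.smul_eq_comp_mk₀]

theorem pre_smul_id (j : ℕ) (r : R) :
    pre j Y (r • LinearMap.id : A →ₗ[R] A) = r • LinearMap.id := by
  ext x
  have : ModuleCat.ofHom (r • LinearMap.id : A →ₗ[R] A) = r • 𝟙 (ModuleCat.of R A) := rfl
  simp [pre, this, Abelian.Ext.mk₀_smul]

theorem post_zero (j : ℕ) : post j X (0 : A →ₗ[R] B) = 0 := by
  simpa using (show post j X ((0 : A →ₗ[R] B) ∘ₗ ((0 : R) • LinearMap.id)) = _ by
    rw [post_comp, post_smul_id, zero_smul, LinearMap.comp_zero])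

theorem pre_zero (j : ℕ) : pre j Y (0 : A →ₗ[R] B) = 0 := by
  simpa using (show pre j Y ((0 : A →ₗ[R] B) ∘ₗ ((0 : R) • LinearMap.id)) = _ by
    rw [pre_comp, pre_smul_id, zero_smul, LinearMap.zero_comp])

instance finite [IsNoetherianRing R] [Module.Finite R X] [Module.Finite R Y] (j : ℕ) :
    Module.Finite R (ModExt R j X Y) :=
  ModuleCat.finite_ext R (ModuleCat.of R X) (ModuleCat.of R Y) j

theorem subsingleton_of_injective (h : Module.Injective R Y) (j : ℕ) :
    Subsingleton (ModExt R (j + 1) X Y) := by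
  have : Injective (ModuleCat.of R Y) := Module.injective_object_of_injective_module R Y
  exact subsingleton_of_forall_eq 0 fun x => Abelian.Ext.eq_zero_of_injective x

theorem subsingleton_of_projective [Module.Projective R X] (j : ℕ) :
    Subsingleton (ModExt R (j + 1) X Y) := by
  have : Projective (ModuleCat.of R X) := by
    rw [← IsProjective.iff_projective]; infer_instance
  exact subsingleton_of_forall_eq 0 fun x => Abelian.Ext.eq_zero_of_projective x

/-- `Ext` in degree zero is `Hom`. -/
noncomputable def homEquiv (X Y : Type u) [AddCommGroup X] [Module R X]
    [AddCommGroup Y] [Module R Y] : (X →ₗ[R] Y) ≃ₗ[R] ModExt R 0 X Y :=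
  (Abelian.Ext.linearEquiv₀.trans ModuleCat.homLinearEquiv).symm

theorem homEquiv_apply (f : X →ₗ[R] Y) : homEquiv X Y f = Abelian.Ext.mk₀ (ModuleCat.ofHom f) :=
  rfl

theorem post_homEquiv (f : A →ₗ[R] B) (x : X →ₗ[R] A) :
    post 0 X f (homEquiv X A x) = homEquiv X B (f ∘ₗ x) := by
  simp [post, homEquiv_apply]

variable {f : A →ₗ[R] B} {g : B →ₗ[R] C}

theorem shortExact (hf : Function.Injective f) (hfg : Function.Exact f g)
    (hg : Function.Surjective g) :
    (ModuleCat.shortComplexOfCompEqZero f g hfg.linearMap_comp_eq_zero).ShortExact :=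
  ModuleCat.shortComplex_shortExact _ hfg hf hg

theorem exact_pre (hf : Function.Injective f) (hfg : Function.Exact f g)
    (hg : Function.Surjective g) (j : ℕ) (Y : Type u) [AddCommGroup Y] [Module R Y] :
    Function.Exact (pre j Y g) (pre j Y f) := by
  rw [LinearMap.exact_iff]
  apply le_antisymm
  · intro x hx
    exact Abelian.Ext.contravariant_sequence_exact₂ (shortExact hf hfg hg) (ModuleCat.of R Y) x hx
  · rw [LinearMap.range_le_ker_iff, ← pre_comp, hfg.linearMap_comp_eq_zero, pre_zero]

/-- The covariant connecting homomorphism. -/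
noncomputable def postδ (hf : Function.Injective f) (hfg : Function.Exact f g)
    (hg : Function.Surjective g) (j : ℕ) (X : Type u) [AddCommGroup X] [Module R X] :
    ModExt R j X C →ₗ[R] ModExt R (j + 1) X A :=
  (shortExact hf hfg hg).extClass.postcompOfLinear R (ModuleCat.of R X) rfl

/-- The contravariant connecting homomorphism. -/
noncomputable def preδ (hf : Function.Injective f) (hfg : Function.Exact f g)
    (hg : Function.Surjective g) (j : ℕ) (Y : Type u) [AddCommGroup Y] [Module R Y] :
    ModExt R j A Y →ₗ[R] ModExt R (j + 1) C Y :=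
  (shortExact hf hfg hg).extClass.precompOfLinear R (ModuleCat.of R Y) (add_comm 1 j)

theorem exact_postδ (hf : Function.Injective f) (hfg : Function.Exact f g)
    (hg : Function.Surjective g) (j : ℕ) (X : Type u) [AddCommGroup X] [Module R X] :
    Function.Exact (post j X g) (postδ hf hfg hg j X) := by
  rw [LinearMap.exact_iff]
  apply le_antisymm
  · intro x hx
    exact Abelian.Ext.covariant_sequence_exact₃ (ModuleCat.of R X) (shortExact hf hfg hg) x rfl hx
  · rintro _ ⟨x, rfl⟩
    exact (Abelian.Ext.comp_assoc_of_second_deg_zero _ _ _ rfl).trans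
      (by rw [(shortExact hf hfg hg).comp_extClass, Abelian.Ext.comp_zero])

theorem postδ_exact (hf : Function.Injective f) (hfg : Function.Exact f g)
    (hg : Function.Surjective g) (j : ℕ) (X : Type u) [AddCommGroup X] [Module R X] :
    Function.Exact (postδ hf hfg hg j X) (post (j + 1) X f) := by
  rw [LinearMap.exact_iff]
  apply le_antisymm
  · intro x hx
    exact Abelian.Ext.covariant_sequence_exact₁ (ModuleCat.of R X) (shortExact hf hfg hg) x hx rfl
  · rintro _ ⟨x, rfl⟩
    exact (Abelian.Ext.comp_assoc_of_third_deg_zero _ _ _ rfl).trans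
      (by rw [(shortExact hf hfg hg).extClass_comp, Abelian.Ext.comp_zero])

theorem exact_preδ (hf : Function.Injective f) (hfg : Function.Exact f g)
    (hg : Function.Surjective g) (j : ℕ) (Y : Type u) [AddCommGroup Y] [Module R Y] :
    Function.Exact (pre j Y f) (preδ hf hfg hg j Y) := by
  rw [LinearMap.exact_iff]
  apply le_antisymm
  · intro x hx
    exact Abelian.Ext.contravariant_sequence_exact₁ (shortExact hf hfg hg) (ModuleCat.of R Y) x
      (add_comm 1 j) hx
  · rintro _ ⟨x, rfl⟩
    exact (shortExact hf hfg hg).extClass_comp_assoc _ (h := add_comm 1 j)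

theorem preδ_exact (hf : Function.Injective f) (hfg : Function.Exact f g)
    (hg : Function.Surjective g) (j : ℕ) (Y : Type u) [AddCommGroup Y] [Module R Y] :
    Function.Exact (preδ hf hfg hg j Y) (pre (j + 1) Y g) := by
  rw [LinearMap.exact_iff]
  apply le_antisymm
  · intro x hx
    exact Abelian.Ext.contravariant_sequence_exact₃ (shortExact hf hfg hg) (ModuleCat.of R Y) x
      hx (add_comm 1 j)
  · rintro _ ⟨x, rfl⟩
    exact (shortExact hf hfg hg).comp_extClass_assoc _ (add_comm 1 j)

end ModExt
end

section
variable {R : Type u} [CommRing R]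

/-- Every element of `W` is killed by some element outside `p`, i.e. `W` vanishes at `p`. -/
def LocZero (p : Ideal R) (W : Type u) [AddCommGroup W] [Module R W] : Prop :=
  ∀ w : W, ∃ s ∉ p, s • w = 0

/-- `A` and `B` become isomorphic at `p`, in the strong sense that there are maps in both
directions composing to multiplication by an element outside `p`. -/
def LocIso (p : Ideal R) (A B : Type u) [AddCommGroup A] [Module R A]
    [AddCommGroup B] [Module R B] : Prop :=
  ∃ s ∉ p, ∃ (f : A →ₗ[R] B) (g : B →ₗ[R] A),
    f ∘ₗ g = s • LinearMap.id ∧ g ∘ₗ f = s • LinearMap.id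

variable {p : Ideal R} {A B C X Y : Type u} [AddCommGroup A] [AddCommGroup B] [AddCommGroup C]
  [AddCommGroup X] [AddCommGroup Y] [Module R A] [Module R B] [Module R C] [Module R X]
  [Module R Y]

namespace LocZero

theorem of_smul_eq_zero {s : R} (hs : s ∉ p) (h : ∀ w : A, s • w = 0) : LocZero p A :=
  fun w => ⟨s, hs, h w⟩

theorem of_exact [hp : p.IsPrime] {f : A →ₗ[R] B} {g : B →ₗ[R] C} (h : Function.Exact f g)
    (hA : LocZero p A) (hC : LocZero p C) : LocZero p B := by
  intro b
  obtain ⟨s, hs, hsb⟩ := hC (g b)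
  obtain ⟨a, ha⟩ := (h (s • b)).1 (by rw [map_smul, hsb])
  obtain ⟨t, ht, hta⟩ := hA a
  exact ⟨t * s, fun h' => (hp.mem_or_mem h').elim ht hs, by rw [mul_smul, ← ha, ← map_smul, hta, map_zero]⟩

theorem of_injective (hB : LocZero p B) (f : A →ₗ[R] B) (hf : Function.Injective f) :
    LocZero p A := by
  intro a
  obtain ⟨s, hs, h⟩ := hB (f a)
  exact ⟨s, hs, hf (by rw [map_smul, h, map_zero])⟩

theorem of_surjective (hA : LocZero p A) (f : A →ₗ[R] B) (hf : Function.Surjective f) :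
    LocZero p B := by
  intro b
  obtain ⟨a, rfl⟩ := hf b
  obtain ⟨s, hs, h⟩ := hA a
  exact ⟨s, hs, by rw [← map_smul, h, map_zero]⟩

theorem of_subsingleton [hp : p.IsPrime] [Subsingleton A] : LocZero p A :=
  fun _ => ⟨1, hp.one_notMem, Subsingleton.elim _ _⟩

theorem exists_smul_eq_zero [hp : p.IsPrime] [Module.Finite R A] (h : LocZero p A) :
    ∃ s ∉ p, ∀ w : A, s • w = 0 := by
  obtain ⟨S, hS⟩ := Module.Finite.fg_top (R := R) (M := A)
  choose s hs hsw using h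
  refine ⟨∏ w ∈ S, s w, fun h' => ?_, fun w => ?_⟩
  · obtain ⟨w, -, hw⟩ := hp.prod_mem_iff.1 h'
    exact hs w hw
  · have : w ∈ Submodule.span R (S : Set A) := hS ▸ Submodule.mem_top
    induction this using Submodule.span_induction with
    | mem x hx =>
      obtain ⟨c, hc⟩ := Finset.dvd_prod_of_mem s hx
      rw [hc, mul_comm, mul_smul, hsw, smul_zero]
    | zero => exact smul_zero _
    | add x y _ _ hx hy => rw [smul_add, hx, hy, add_zero]
    | smul r x _ hx => rw [smul_comm, hx, smul_zero]

theorem ext_left [p.IsPrime] [Module.Finite R X] (h : LocZero p X) (j : ℕ) :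
    LocZero p (ModExt R j X Y) := by
  obtain ⟨s, hs, hsX⟩ := h.exists_smul_eq_zero
  refine of_smul_eq_zero hs fun w => ?_
  have h0 : (s • LinearMap.id : X →ₗ[R] X) = 0 := LinearMap.ext hsX
  have := LinearMap.congr_fun (ModExt.pre_smul_id (A := X) (Y := Y) j s) w
  rw [h0, ModExt.pre_zero] at this
  exact this.symm

end LocZero

namespace LocIso

theorem symm (h : LocIso p A B) : LocIso p B A := by
  obtain ⟨s, hs, f, g, h₁, h₂⟩ := h
  exact ⟨s, hs, g, f, h₂, h₁⟩

theorem locZero [hp : p.IsPrime] (h : LocIso p A B) (hA : LocZero p A) : LocZero p B := by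
  obtain ⟨s, hs, f, g, h₁, h₂⟩ := h
  intro b
  obtain ⟨t, ht, h⟩ := hA (g b)
  refine ⟨t * s, fun h' => (hp.mem_or_mem h').elim ht hs, ?_⟩
  have := LinearMap.congr_fun h₁ b
  simp only [LinearMap.comp_apply, LinearMap.smul_apply, LinearMap.id_apply] at this
  rw [mul_smul, ← this, ← map_smul, h, map_zero]

theorem ext_right (h : LocIso p A B) (j : ℕ) : LocIso p (ModExt R j X A) (ModExt R j X B) := by
  obtain ⟨s, hs, f, g, h₁, h₂⟩ := h
  refine ⟨s, hs, ModExt.post j X f, ModExt.post j X g, ?_, ?_⟩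
  · rw [← ModExt.post_comp, h₁, ModExt.post_smul_id]
  · rw [← ModExt.post_comp, h₂, ModExt.post_smul_id]

theorem ext_left (h : LocIso p A B) (j : ℕ) : LocIso p (ModExt R j A Y) (ModExt R j B Y) := by
  obtain ⟨s, hs, f, g, h₁, h₂⟩ := h
  refine ⟨s, hs, ModExt.pre j Y g, ModExt.pre j Y f, ?_, ?_⟩
  · rw [← ModExt.pre_comp, h₁, ModExt.pre_smul_id]
  · rw [← ModExt.pre_comp, h₂, ModExt.pre_smul_id]

theorem hom (h : LocIso p A B) (X : Type u) [AddCommGroup X] [Module R X] :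
    LocIso p (X →ₗ[R] A) (X →ₗ[R] B) := by
  obtain ⟨s, hs, f, g, h₁, h₂⟩ := h
  refine ⟨s, hs, LinearMap.llcomp R X A B f, LinearMap.llcomp R X B A g, ?_, ?_⟩
  · ext φ x
    simpa using LinearMap.congr_fun h₁ (φ x)
  · ext φ x
    simpa using LinearMap.congr_fun h₂ (φ x)

theorem of_linearEquiv [hp : p.IsPrime] (e : A ≃ₗ[R] B) : LocIso p A B :=
  ⟨1, hp.one_notMem, e.toLinearMap, e.symm.toLinearMap, by ext; simp, by ext; simp⟩

theorem of_injective [hp : p.IsPrime] [Module.Finite R B] (f : A →ₗ[R] B)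
    (hf : Function.Injective f) (h : ∀ b, ∃ s ∉ p, ∃ a, f a = s • b) : LocIso p A B := by
  have : LocZero p (B ⧸ LinearMap.range f) := by
    intro w
    obtain ⟨b, rfl⟩ := Submodule.Quotient.mk_surjective _ w
    obtain ⟨s, hs, a, ha⟩ := h b
    exact ⟨s, hs, (Submodule.Quotient.mk_eq_zero _).2 ⟨a, ha⟩⟩
  obtain ⟨s, hs, hsb⟩ := this.exists_smul_eq_zero
  let e := LinearEquiv.ofInjective f hf
  let m : B →ₗ[R] LinearMap.range f := (s • LinearMap.id : B →ₗ[R] B).codRestrict _ fun b =>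
    by
    rw [← Submodule.Quotient.mk_eq_zero, LinearMap.smul_apply, Submodule.Quotient.mk_smul]
    exact hsb _
  have he : ∀ x, f (e.symm x) = x := fun x => congrArg Subtype.val (e.apply_symm_apply x)
  refine ⟨s, hs, f, e.symm.toLinearMap ∘ₗ m, ?_, ?_⟩
  · ext b
    exact he (m b)
  · ext a
    apply hf
    exact (he _).trans (map_smul f s a).symm

theorem quotient [p.IsPrime] (K : Submodule R B) [Module.Finite R K] (hK : LocZero p K) :
    LocIso p B (B ⧸ K) := by
  obtain ⟨s, hs, h⟩ := hK.exists_smul_eq_zero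
  refine ⟨s, hs, K.mkQ, K.liftQ (s • LinearMap.id) fun k hk => by
    simpa using congrArg Subtype.val (h ⟨k, hk⟩),
    ?_, ?_⟩
  · ext b
    simp
  · ext b
    simp

end LocIso
end

section
set_option linter.unusedSectionVars false
open scoped Pointwise
variable {R : Type u} [CommRing R] [IsNoetherianRing R]

/-- Multiplication by `s ∉ p` landing in `y • W` with `y ∈ p` forces `W` to vanish at `p`. -/
theorem LocZero.of_exists_smul_eq_smul {p : Ideal R} [hp : p.IsPrime] {W : Type u} [AddCommGroup W]
    [Module R W] [Module.Finite R W] {y : R} (hy : y ∈ p)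
    (h : ∀ w : W, ∃ s ∉ p, ∃ w', y • w' = s • w) : LocZero p W := by
  have hQ : LocZero p (W ⧸ LinearMap.range (y • LinearMap.id : W →ₗ[R] W)) := by
    intro q
    obtain ⟨w, rfl⟩ := Submodule.Quotient.mk_surjective _ q
    obtain ⟨s, hs, w', hw'⟩ := h w
    exact ⟨s, hs, (Submodule.Quotient.mk_eq_zero _).2 ⟨w', hw'⟩⟩
  obtain ⟨s, hs, hsw⟩ := hQ.exists_smul_eq_zero
  obtain ⟨P, hmon, -, hcoeff, hP⟩ :=
    LinearMap.exists_monic_and_natDegree_eq_and_coeff_mem_pow_and_aeval_eq_zero R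
      (s • LinearMap.id : W →ₗ[R] W) p (by
        rintro _ ⟨w, rfl⟩
        obtain ⟨w', hw'⟩ := (Submodule.Quotient.mk_eq_zero _).1
          (show (LinearMap.range (y • LinearMap.id : W →ₗ[R] W)).mkQ (s • w) = 0 by
            rw [map_smul]; exact hsw _)
        rw [LinearMap.smul_apply, LinearMap.id_apply, ← hw']
        exact Submodule.smul_mem_smul hy Submodule.mem_top)
  have hPs : ∀ w : W, P.eval s • w = 0 := by
    intro w
    have h1 : (s • LinearMap.id : W →ₗ[R] W) = algebraMap R (Module.End R W) s := rfl
    rw [h1, Polynomial.aeval_algebraMap_apply] at hP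
    exact LinearMap.congr_fun hP w
  refine LocZero.of_smul_eq_zero (s := P.eval s) (fun hmem => hs ?_) hPs
  rw [Polynomial.eval_eq_sum_range, Finset.sum_range_succ, hmon.coeff_natDegree, one_mul] at hmem
  refine hp.mem_of_pow_mem _ ((p.add_mem_iff_right ?_).1 hmem)
  refine p.sum_mem fun k hk => p.mul_mem_right _ ?_
  have hk' := Finset.mem_range.1 hk
  exact Ideal.pow_le_self (by omega) (hcoeff k)

section
variable {p : Ideal R} {B D : Type u} [AddCommGroup B] [Module R B]
  [AddCommGroup D] [Module R D] [Module.Finite R B] [Module.Finite R D]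

variable (p B) in
/-- The kernel of localization at `p`. -/
def locKer [hp : p.IsPrime] : Submodule R B where
  carrier := {b | ∃ s ∉ p, s • b = 0}
  zero_mem' := ⟨1, hp.one_notMem, smul_zero _⟩
  add_mem' := by
    rintro a b ⟨s, hs, h⟩ ⟨t, ht, h'⟩
    exact ⟨s * t, fun h => (hp.mem_or_mem h).elim hs ht,
      by rw [smul_add, mul_smul, mul_smul, h', smul_comm, h]; simp⟩
  smul_mem' := by
    rintro r b ⟨s, hs, h⟩
    exact ⟨s, hs, by rw [smul_comm, h, smul_zero]⟩

theorem locIso_quotient_locKer [p.IsPrime] : LocIso p B (B ⧸ locKer p B) := by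
  refine LocIso.quotient _ ?_
  rintro ⟨b, s, hs, h⟩
  exact ⟨s, hs, Subtype.ext h⟩

theorem eq_zero_of_smul_eq_zero_quotient_locKer [hp : p.IsPrime] {s : R} (hs : s ∉ p)
    (b : B ⧸ locKer p B) (h : s • b = 0) : b = 0 := by
  obtain ⟨b, rfl⟩ := Submodule.Quotient.mk_surjective _ b
  rw [← Submodule.Quotient.mk_smul, Submodule.Quotient.mk_eq_zero] at h
  obtain ⟨t, ht, h⟩ := h
  rw [Submodule.Quotient.mk_eq_zero]
  exact ⟨t * s, fun h => (hp.mem_or_mem h).elim ht hs, by rw [mul_smul, h]⟩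

/-- An element of `B` whose annihilator is exactly `p` gives an embedding of `R ⧸ p`. -/
theorem injective_of_forall_smul_ne_zero (φ : (R ⧸ p) →ₗ[R] B)
    (h : ∀ s ∉ p, s • φ ≠ 0) : Function.Injective φ := by
  rw [injective_iff_map_eq_zero]
  intro a ha
  obtain ⟨r, rfl⟩ := Ideal.Quotient.mk_surjective a
  rw [Ideal.Quotient.eq_zero_iff_mem]
  by_contra hr
  refine h r hr (LinearMap.ext fun b => ?_)
  obtain ⟨t, rfl⟩ := Ideal.Quotient.mk_surjective b
  have : r • Ideal.Quotient.mk p t = t • Ideal.Quotient.mk p r := by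
    simp only [← Ideal.Quotient.mk_eq_mk, ← Submodule.Quotient.mk_smul, smul_eq_mul, mul_comm]
  rw [LinearMap.smul_apply, ← map_smul, this, map_smul, ha, smul_zero, LinearMap.zero_apply]

/-- If `Hom (R ⧸ p, B)` vanishes at `p`, there is a `B`-regular element in `p`, provided all
elements outside of `p` act injectively. -/
theorem exists_isSMulRegular_of_locZero_hom [p.IsPrime]
    (hB : ∀ s ∉ p, ∀ b : B, s • b = 0 → b = 0)
    (h : LocZero p ((R ⧸ p) →ₗ[R] B)) : ∃ y ∈ p, IsSMulRegular B y := by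
  by_contra! hcon
  have hsub : (p : Set R) ⊆ ⋃ q ∈ associatedPrimes R B, (q : Set R) := by
    rw [biUnion_associatedPrimes_eq_zero_divisors]
    intro y hy
    have := hcon y hy
    rw [isSMulRegular_iff_right_eq_zero_of_smul] at this
    push Not at this
    obtain ⟨b, hb, hb0⟩ := this
    exact ⟨b, hb0, hb⟩
  obtain ⟨q, hq, hpq⟩ := (Ideal.subset_union_prime_finite (associatedPrimes.finite R B)
    (f := id) 0 0 fun _ h _ _ => h.isPrime).1 hsub
  obtain ⟨hqp, b, hb⟩ := (isAssociatedPrime_iff ..).1 hq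
  have hmem : ∀ r, r ∈ q ↔ r • b = 0 := by
    intro r
    rw [hb, Submodule.mem_colon_singleton, Submodule.mem_bot]
  have hb0 : b ≠ 0 := fun h0 => hqp.one_notMem ((hmem 1).2 (by rw [h0, smul_zero]))
  let φ : (R ⧸ p) →ₗ[R] B := p.liftQ (LinearMap.toSpanSingleton R B b) fun r hr =>
    (hmem r).1 (hpq hr)
  obtain ⟨s, hs, hsφ⟩ := h φ
  refine hb0 (hB s hs b ?_)
  have := LinearMap.congr_fun hsφ (Ideal.Quotient.mk p 1)
  have h1 : φ (Ideal.Quotient.mk p 1) = b :=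
    (Submodule.liftQ_apply _ _ _).trans (LinearMap.toSpanSingleton_apply_one R B b)
  rwa [LinearMap.smul_apply, h1] at this

theorem exact_smul_mkQ_quotSMulTop (y : R) : Function.Exact (y • LinearMap.id : B →ₗ[R] B)
    (Submodule.mkQ (y • (⊤ : Submodule R B))) := by
  intro b
  rw [Submodule.mkQ_apply, Submodule.Quotient.mk_eq_zero, Submodule.mem_smul_pointwise_iff_exists]
  simp

theorem IsSMulRegular.injective_smul_id {y : R} (hy : IsSMulRegular B y) :
    Function.Injective (y • LinearMap.id : B →ₗ[R] B) := hy

theorem LocZero.ext_quotSMulTop_right [p.IsPrime] {X : Type u} [AddCommGroup X] [Module R X]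
    {y : R} (hy : IsSMulRegular B y) {j : ℕ} (h : LocZero p (ModExt R j X B))
    (h' : LocZero p (ModExt R (j + 1) X B)) : LocZero p (ModExt R j X (QuotSMulTop y B)) :=
  LocZero.of_exact (ModExt.exact_postδ hy.injective_smul_id (exact_smul_mkQ_quotSMulTop y)
    (Submodule.mkQ_surjective _) j X) h h'

theorem LocZero.ext_succ_of_quotSMulTop [p.IsPrime] {y : R} (hy : IsSMulRegular B y)
    (hyp : y ∈ p) {k : ℕ} (h : LocZero p (ModExt R k (R ⧸ p) (QuotSMulTop y B))) :
    LocZero p (ModExt R (k + 1) (R ⧸ p) B) := by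
  have hex := ModExt.postδ_exact hy.injective_smul_id (exact_smul_mkQ_quotSMulTop y)
    (Submodule.mkQ_surjective _) k (R ⧸ p)
  refine h.of_surjective _ fun x => (hex x).1 ?_
  have h0 : (y • LinearMap.id : (R ⧸ p) →ₗ[R] R ⧸ p) = 0 := by
    ext
    exact (Submodule.Quotient.mk_eq_zero p).2 (p.mul_mem_right _ hyp)
  rw [ModExt.post_smul_id, ← ModExt.pre_smul_id, h0, ModExt.pre_zero, LinearMap.zero_apply]

theorem locZero_ext_hom_quotSMulTop [p.IsPrime] {y : R} (hy : IsSMulRegular B y)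
    (h : LocZero p (ModExt R 1 D B)) {a : ℕ}
    (h2 : ∀ j > a, LocZero p (ModExt R j (D →ₗ[R] B) D)) :
    ∀ j > a + 1, LocZero p (ModExt R j (D →ₗ[R] QuotSMulTop y B) D) := by
  intro j hj
  obtain ⟨j, rfl⟩ : ∃ i, j = i + 1 := ⟨j - 1, by omega⟩
  have hyG : IsSMulRegular (D →ₗ[R] B) y := fun φ ψ h => LinearMap.ext fun d =>
    hy (LinearMap.congr_fun h d)
  have hq : LocZero p (ModExt R (j + 1) (QuotSMulTop y (D →ₗ[R] B)) D) :=
    LocZero.of_exact (ModExt.preδ_exact hyG.injective_smul_id (exact_smul_mkQ_quotSMulTop y)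
      (Submodule.mkQ_surjective _) j D) (h2 j (by omega)) (h2 (j + 1) (by omega))
  have hπ := exact_smul_mkQ_quotSMulTop (B := B) y
  let f : QuotSMulTop y (D →ₗ[R] B) →ₗ[R] (D →ₗ[R] QuotSMulTop y B) :=
    Submodule.liftQ _ (LinearMap.llcomp R D B _ (Submodule.mkQ (y • (⊤ : Submodule R B)))) (by
      intro φ hφ
      rw [Submodule.mem_smul_pointwise_iff_exists] at hφ
      obtain ⟨ψ, -, rfl⟩ := hφ
      ext d
      exact (hπ (y • ψ d)).2 ⟨ψ d, rfl⟩)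
  have hf : ∀ φ, f (Submodule.Quotient.mk φ) = Submodule.mkQ (y • (⊤ : Submodule R B)) ∘ₗ φ :=
    fun φ => rfl
  have hinj : Function.Injective f := by
    rw [injective_iff_map_eq_zero]
    intro q hq
    obtain ⟨φ, rfl⟩ := Submodule.Quotient.mk_surjective _ q
    rw [Submodule.Quotient.mk_eq_zero, Submodule.mem_smul_pointwise_iff_exists]
    have hφ : ∀ d, ∃ b, y • b = φ d := fun d => (hπ (φ d)).1 (LinearMap.congr_fun hq d)
    choose ψ hψ using hφ
    exact ⟨{ toFun := ψ
             map_add' := fun d e => hy (by simp only [smul_add, hψ, map_add])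
             map_smul' := fun r d => hy (by
               simp only [RingHom.id_apply]; rw [smul_comm y r, hψ, hψ, map_smul]) },
      Submodule.mem_top, LinearMap.ext hψ⟩
  refine ((LocIso.of_injective f hinj fun χ => ?_).ext_left (j + 1)).locZero hq
  have hinj' : Function.Injective (y • LinearMap.id : B →ₗ[R] B) := hy
  have hsurj := Submodule.mkQ_surjective (y • (⊤ : Submodule R B))
  obtain ⟨s, hs, hsχ⟩ := h (ModExt.postδ hinj' hπ hsurj 0 D (ModExt.homEquiv D _ χ))
  rw [← map_smul, ← map_smul] at hsχ
  obtain ⟨w, hw⟩ := (ModExt.exact_postδ hinj' hπ hsurj 0 D _).1 hsχ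
  obtain ⟨φ, rfl⟩ := (ModExt.homEquiv D B).surjective w
  rw [ModExt.post_homEquiv] at hw
  exact ⟨s, hs, Submodule.Quotient.mk φ, (ModExt.homEquiv D _).injective hw⟩

theorem exists_injective_of_locZero_ext [hp : p.IsPrime] (hann : ∀ r : R, (∀ d : D, r • d = 0) → r = 0)
    (k : ℕ) : ∀ (a : ℕ) (B : Type u) [AddCommGroup B] [Module R B] [Module.Finite R B],
    (∀ j, LocZero p (ModExt R (j + 1) D B)) →
    (∀ j > a, LocZero p (ModExt R j (D →ₗ[R] B) D)) →
    (∀ j < k, LocZero p (ModExt R j (R ⧸ p) B)) →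
    (¬ LocZero p (ModExt R k (R ⧸ p) B)) →
    ∃ (G : Type u) (_ : AddCommGroup G) (_ : Module R G) (_ : Module.Finite R G)
      (ι : (R ⧸ p) →ₗ[R] G), Function.Injective ι ∧ ∀ j > a + k, LocZero p (ModExt R j G D) := by
  induction k with
  | zero =>
    intro a B _ _ _ _ h2 _ h3
    rw [LocZero] at h3
    push Not at h3
    obtain ⟨w, hw⟩ := h3
    obtain ⟨φ, rfl⟩ := (ModExt.homEquiv (R ⧸ p) B).surjective w
    have hφ : Function.Injective φ := injective_of_forall_smul_ne_zero φ fun s hs h0 =>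
      hw s hs (by rw [← map_smul, h0, map_zero])
    have hψ : ∃ ψ : D →ₗ[R] R ⧸ p, ψ ≠ 0 := by
      by_contra! h
      have : Subsingleton (D →ₗ[R] R ⧸ p) := subsingleton_of_forall_eq 0 h
      obtain ⟨r, hr, hreg⟩ := IsSMulRegular.subsingleton_linearMap_iff.1 this
      obtain rfl : r = 0 := hann r fun d => Module.mem_annihilator.1 hr d
      have : (1 : R ⧸ p) = 0 := hreg (by simp)
      exact one_ne_zero this
    obtain ⟨ψ, hψ⟩ := hψ
    have hψ' : ∃ d, ψ d ≠ 0 := by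
      by_contra! h
      exact hψ (LinearMap.ext h)
    obtain ⟨d, hd⟩ := hψ'
    refine ⟨D →ₗ[R] B, inferInstance, inferInstance, inferInstance,
      p.liftQ (LinearMap.toSpanSingleton R _ (φ ∘ₗ ψ)) ?_, ?_, h2⟩
    · intro r hr
      ext d
      obtain ⟨t, ht⟩ := Ideal.Quotient.mk_surjective (ψ d)
      have : r • ψ d = 0 := by
        rw [← ht, ← Ideal.Quotient.mk_eq_mk, ← Submodule.Quotient.mk_smul,
          Submodule.Quotient.mk_eq_zero]
        exact p.mul_mem_right _ hr
      simp [← map_smul φ, this]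
    · rw [injective_iff_map_eq_zero]
      intro x hx
      obtain ⟨r, rfl⟩ := Ideal.Quotient.mk_surjective x
      have h1 : r • φ (ψ d) = 0 := LinearMap.congr_fun hx d
      rw [← map_smul] at h1
      have h2 : r • ψ d = 0 := hφ (by rw [h1, map_zero])
      have h3 : r • ψ d = Ideal.Quotient.mk p r * ψ d := Algebra.smul_def _ _
      rw [h3] at h2
      exact (mul_eq_zero.1 h2).resolve_right hd
  | succ k ih =>
    intro a B _ _ _ h1 h2 h3 h4
    have hiso : LocIso p B (B ⧸ locKer p B) := locIso_quotient_locKer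
    have hreg := fun s hs b hb => eq_zero_of_smul_eq_zero_quotient_locKer (p := p) (B := B) (s := s) hs b hb
    replace h1 := fun j => (hiso.ext_right (j + 1)).locZero (h1 j)
    replace h2 := fun j hj => ((hiso.hom D).ext_left j).locZero (h2 j hj)
    replace h3 := fun j hj => (hiso.ext_right j).locZero (h3 j hj)
    replace h4 := fun h => h4 ((hiso.ext_right (k + 1)).symm.locZero h)
    obtain ⟨y, hy, hyreg⟩ := exists_isSMulRegular_of_locZero_hom hreg
      ((h3 0 k.succ_pos).of_injective (ModExt.homEquiv _ _).toLinearMap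
        (ModExt.homEquiv _ _).injective)
    obtain ⟨G, _, _, _, ι, hι, hG⟩ := ih (a + 1) (QuotSMulTop y (B ⧸ locKer p B))
      (fun j => (h1 j).ext_quotSMulTop_right hyreg (h1 (j + 1)))
      (locZero_ext_hom_quotSMulTop hyreg (h1 0) h2)
      (fun j hj => (h3 j (by omega)).ext_quotSMulTop_right hyreg (h3 (j + 1) (by omega)))
      (fun h => h4 (h.ext_succ_of_quotSMulTop hyreg hy))
    exact ⟨G, inferInstance, inferInstance, inferInstance, ι, hι, fun j hj => hG j (by omega)⟩
end
end

section
set_option linter.unusedSectionVars false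
variable {R : Type u} [CommRing R] [IsNoetherianRing R] {p : Ideal R} {D : Type u}
  [AddCommGroup D] [Module R D] [Module.Finite R D]

/-- Vanishing at `p` of `Ext j (X, D)` propagates from higher degrees and from `R ⧸ p`. -/
theorem locZero_ext_of_locZero_ext_quotient [hp : p.IsPrime] {j : ℕ}
    (hsucc : ∀ (X : Type u) [AddCommGroup X] [Module R X] [Module.Finite R X],
      LocZero p (ModExt R (j + 1) X D)) (h : LocZero p (ModExt R j (R ⧸ p) D))
    (X : Type u) [AddCommGroup X] [Module R X] [hX : Module.Finite R X] :
    LocZero p (ModExt R j X D) := by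
  induction hX using IsNoetherianRing.induction_on_isQuotientEquivQuotientPrime R with
  | subsingleton N => exact LocZero.of_subsingleton.ext_left j
  | exact N₁ N₂ N₃ f g hf hg hfg h₁ h₃ =>
    exact LocZero.of_exact (ModExt.exact_pre hf hfg hg j D) h₃ h₁
  | quotient N q e =>
    refine ((LocIso.of_linearEquiv e.symm).ext_left j).locZero ?_
    obtain ⟨q, hq⟩ := q
    dsimp only
    by_cases hqp : q ≤ p
    · obtain rfl | hlt := hqp.eq_or_lt
      · exact h
      obtain ⟨y, hyp, hyq⟩ := SetLike.exists_of_lt hlt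
      have hy : IsSMulRegular (R ⧸ q) y := by
        rw [isSMulRegular_iff_right_eq_zero_of_smul]
        intro x hx
        rw [Algebra.smul_def] at hx
        refine (mul_eq_zero.1 hx).resolve_left fun h => hyq ?_
        exact Ideal.Quotient.eq_zero_iff_mem.1 h
      have hex := ModExt.exact_preδ hy.injective_smul_id (exact_smul_mkQ_quotSMulTop y)
        (Submodule.mkQ_surjective _) j D
      refine LocZero.of_exists_smul_eq_smul hyp fun w => ?_
      obtain ⟨s, hs, hsw⟩ := hsucc (QuotSMulTop y (R ⧸ q)) (ModExt.preδ hy.injective_smul_id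
        (exact_smul_mkQ_quotSMulTop y) (Submodule.mkQ_surjective _) j D w)
      obtain ⟨w', hw'⟩ := (hex (s • w)).1 (by rw [map_smul, hsw])
      rw [ModExt.pre_smul_id] at hw'
      exact ⟨s, hs, w', hw'⟩
    · obtain ⟨s, hsq, hsp⟩ := SetLike.not_le_iff_exists.1 hqp
      refine LocZero.ext_left (LocZero.of_smul_eq_zero hsp fun x => ?_) j
      obtain ⟨r, rfl⟩ := Ideal.Quotient.mk_surjective x
      exact (Submodule.Quotient.mk_eq_zero q).2 (q.mul_mem_right _ hsq)

/-- For `p`-power torsion modules, vanishing of `Ext j (-, D)` at `p` can be tested on `R ⧸ p`. -/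
theorem locZero_ext_of_torsion [hp : p.IsPrime] {j : ℕ} (h : LocZero p (ModExt R j (R ⧸ p) D))
    (X : Type u) [AddCommGroup X] [Module R X] [hX : Module.Finite R X]
    (ht : ∀ x : X, ∃ m : ℕ, ∀ a ∈ p ^ m, a • x = 0) : LocZero p (ModExt R j X D) := by
  revert ht
  induction hX using IsNoetherianRing.induction_on_isQuotientEquivQuotientPrime R with
  | subsingleton N => exact fun _ => LocZero.of_subsingleton.ext_left j
  | exact N₁ N₂ N₃ f g hf hg hfg h₁ h₃ =>
    intro ht
    refine LocZero.of_exact (ModExt.exact_pre hf hfg hg j D) (h₃ fun x => ?_) (h₁ fun x => ?_)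
    · obtain ⟨x, rfl⟩ := hg x
      obtain ⟨m, hm⟩ := ht x
      exact ⟨m, fun a ha => by rw [← map_smul, hm a ha, map_zero]⟩
    · obtain ⟨m, hm⟩ := ht (f x)
      exact ⟨m, fun a ha => hf (by rw [map_smul, hm a ha, map_zero])⟩
  | quotient N q e =>
    intro ht
    refine ((LocIso.of_linearEquiv e.symm).ext_left j).locZero ?_
    obtain ⟨q, hq⟩ := q
    dsimp only at e ⊢
    have hpq : p ≤ q := by
      obtain ⟨m, hm⟩ := ht (e.symm (Ideal.Quotient.mk q 1))
      refine hq.le_of_pow_le (n := m) fun a ha => ?_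
      have h1 := hm a ha
      rw [← map_smul, LinearEquiv.map_eq_zero_iff] at h1
      have h2 := (Submodule.Quotient.mk_eq_zero q (x := a • (1 : R))).1 h1
      simpa using h2
    obtain rfl | hlt := hpq.eq_or_lt
    · exact h
    obtain ⟨s, hsq, hsp⟩ := SetLike.exists_of_lt hlt
    refine LocZero.ext_left (LocZero.of_smul_eq_zero hsp fun x => ?_) j
    obtain ⟨r, rfl⟩ := Ideal.Quotient.mk_surjective x
    exact (Submodule.Quotient.mk_eq_zero q).2 (q.mul_mem_right _ hsq)

/-- The Cohen–Macaulay property of a dualizing module: at each prime `p`, there is a single degree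
in which `Ext (X, D)` can fail to vanish at `p`, for `X` finitely generated and `p`-torsion. -/
theorem exists_forall_locZero_ext [hp : p.IsPrime]
    (hhom : Function.Bijective (fun r : R => (r • LinearMap.id : D →ₗ[R] D)))
    (hext : ∀ j, Subsingleton (ModExt R (j + 1) D D))
    {n : ℕ} (hn : ∀ (X : Type u) [AddCommGroup X] [Module R X], ∀ j > n,
      Subsingleton (ModExt R j X D)) :
    ∃ i, (∀ (X : Type u) [AddCommGroup X] [Module R X] [Module.Finite R X], ∀ j > i,
        LocZero p (ModExt R j X D)) ∧
      (∀ (X : Type u) [AddCommGroup X] [Module R X] [Module.Finite R X],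
        (∀ x : X, ∃ m : ℕ, ∀ a ∈ p ^ m, a • x = 0) → ∀ j < i, LocZero p (ModExt R j X D)) := by
  have descend (P : ℕ → Prop) (i : ℕ) (h0 : ∀ j > n, P j) (h : ∀ j > i, P (j + 1) → P j) :
      ∀ j > i, P j := by
    have : ∀ d j, j > i → n < j + d → P j := by
      intro d
      induction d with
      | zero => exact fun j _ hj => h0 j hj
      | succ d ih => exact fun j hi hj => h j hi (ih _ (by omega) (by omega))
    exact fun j hj => this (n + 1) j hj (by omega)
  have h0 : ∀ j > n, ∀ (X : Type u) [AddCommGroup X] [Module R X] [Module.Finite R X],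
      LocZero p (ModExt R j X D) := by
    intro j hj X _ _ _
    have := hn X j hj
    exact LocZero.of_subsingleton
  by_cases hex : ∃ j, ¬ LocZero p (ModExt R j (R ⧸ p) D)
  · classical
    have hlt : ∀ j < Nat.find hex, LocZero p (ModExt R j (R ⧸ p) D) :=
      fun j hj => not_not.1 (Nat.find_min hex hj)
    obtain ⟨G, _, _, _, ι, hι, hG⟩ := exists_injective_of_locZero_ext (p := p) (D := D)
      (fun r hr => hhom.1 (by ext d; simp [hr d])) (Nat.find hex) 0 D
      (fun j => by
        have := hext j
        exact LocZero.of_subsingleton)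
      (fun j hj => by
        obtain ⟨j, rfl⟩ : ∃ i, j = i + 1 := ⟨j - 1, by omega⟩
        have : Subsingleton (ModExt R (j + 1) R D) := ModExt.subsingleton_of_projective j
        exact ((LocIso.of_linearEquiv (LinearEquiv.ofBijective
          (LinearMap.lsmul R D) hhom)).ext_left (j + 1)).locZero LocZero.of_subsingleton)
      hlt (Nat.find_spec hex)
    rw [zero_add] at hG
    refine ⟨Nat.find hex, fun X _ _ _ j hj => descend (fun j => ∀ (X : Type u) [AddCommGroup X]
      [Module R X] [Module.Finite R X], LocZero p (ModExt R j X D)) _ h0 (fun j hj hP => ?_) j hj X,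
      fun X _ _ _ hX j hj => locZero_ext_of_torsion (hlt j hj) X hX⟩
    exact locZero_ext_of_locZero_ext_quotient hP (LocZero.of_exact (ModExt.exact_preδ hι
      (LinearMap.exact_map_mkQ_range ι) (Submodule.mkQ_surjective _) j D) (hG j hj) (hP _))
  · push Not at hex
    have hP := descend (fun j => ∀ (X : Type u) [AddCommGroup X] [Module R X] [Module.Finite R X],
      LocZero p (ModExt R j X D)) 0 h0
      fun j _ hP => locZero_ext_of_locZero_ext_quotient hP (hex j)
    exact ⟨0, fun X _ _ _ j hj => hP j hj X, fun _ _ _ _ _ j hj => absurd hj (by omega)⟩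
end

section
variable {R : Type u} [CommRing R]

theorem ModExt.subsingleton_of_injDimLE {n : ℕ} : ∀ {Y : ModuleCat.{u} R}, InjDimLE R n Y →
    ∀ (X : Type u) [AddCommGroup X] [Module R X], ∀ j > n, Subsingleton (ModExt R j X Y) := by
  induction n with
  | zero =>
    intro Y hY X _ _ j hj
    obtain ⟨j, rfl⟩ : ∃ i, j = i + 1 := ⟨j - 1, by omega⟩
    exact ModExt.subsingleton_of_injective hY j
  | succ n ih =>
    intro Y hY X _ _ j hj
    obtain ⟨j, rfl⟩ : ∃ i, j = i + 1 := ⟨j - 1, by omega⟩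
    obtain ⟨I, hI, ι, hι, hQ⟩ := hY
    have h1 := ih hQ X j (by omega)
    have h2 : Subsingleton (ModExt R (j + 1) X I) := ModExt.subsingleton_of_injective hI j
    refine subsingleton_of_forall_eq 0 fun x => ?_
    obtain ⟨w, rfl⟩ := (ModExt.postδ_exact hι (LinearMap.exact_map_mkQ_range ι)
      (Submodule.mkQ_surjective _) j X x).1 (h2.elim _ _)
    rw [h1.elim w 0, map_zero]

theorem ModExt.subsingleton_of_subsingleton_extM {X Y : Type u} [AddCommGroup X] [AddCommGroup Y]
    [Module R X] [Module R Y] (j : ℕ) (h : Subsingleton (ExtM R (j + 1) X Y)) :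
    Subsingleton (ModExt R (j + 1) X Y) := by
  let P := projectiveResolution (ModuleCat.of R X)
  have h1 : IsZero ((P.complex.linearYonedaObj R (ModuleCat.of R Y)).homology (j + 1)) :=
    (ModuleCat.isZero_of_subsingleton (ExtM R (j + 1) X Y)).of_iso
      (P.isoExt (R := R) (j + 1) (ModuleCat.of R Y)).symm
  rw [← HomologicalComplex.exactAt_iff_isZero_homology,
    HomologicalComplex.exactAt_iff' _ j (j + 1) (j + 2) (by simp) (by simp),
    ShortComplex.ShortExact.moduleCat_exact_iff_function_exact] at h1
  refine subsingleton_of_forall_eq 0 fun x => ?_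
  obtain ⟨f, hf, rfl⟩ := P.extMk_surjective x (j + 2) rfl
  rw [P.extMk_eq_zero_iff f (j + 2) rfl hf j rfl]
  exact (h1 f).1 hf
end

section TorShift

open MonoidalCategory TensorProduct

variable {R : Type u} [CommRing R]

/-- The complex `X ⊗ P` for a projective resolution `P` of `Y`. -/
noncomputable abbrev tensorResolution (X : ModuleCat.{u} R) {Y : ModuleCat.{u} R}
    (P : ProjectiveResolution Y) : ChainComplex (ModuleCat.{u} R) ℕ :=
  (((tensoringLeft (ModuleCat.{u} R)).obj X).mapHomologicalComplex (ComplexShape.down ℕ)).obj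
    P.complex

/-- The map of complexes `X ⊗ P ⟶ X' ⊗ P` induced by `X ⟶ X'`. -/
noncomputable abbrev tensorResolutionMap {X X' : ModuleCat.{u} R} (α : X ⟶ X')
    {Y : ModuleCat.{u} R} (P : ProjectiveResolution Y) :
    tensorResolution X P ⟶ tensorResolution X' P :=
  (NatTrans.mapHomologicalComplex ((tensoringLeft (ModuleCat.{u} R)).map α)
    (ComplexShape.down ℕ)).app P.complex

/-- The zeroth homology of `X ⊗ P` is `X ⊗ Y`. -/
noncomputable def tensorResolutionZeroIso (X : ModuleCat.{u} R) {Y : ModuleCat.{u} R}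
    (P : ProjectiveResolution Y) : (tensorResolution X P).homology 0 ≅ X ⊗ Y :=
  (ChainComplex.isoHomologyι₀ (tensorResolution X P)) ≪≫
    asIso (P.fromLeftDerivedZero' ((tensoringLeft (ModuleCat.{u} R)).obj X))

lemma tensorResolutionZeroIso_naturality {X X' : ModuleCat.{u} R} (α : X ⟶ X')
    {Y : ModuleCat.{u} R} (P : ProjectiveResolution Y) :
    HomologicalComplex.homologyMap (tensorResolutionMap α P) 0 ≫
      (tensorResolutionZeroIso X' P).hom = (tensorResolutionZeroIso X P).hom ≫ (α ▷ Y) := by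
  simp only [tensorResolutionZeroIso, Iso.trans_hom, asIso_hom, Category.assoc]
  have h : HomologicalComplex.opcyclesMap (tensorResolutionMap α P) 0 ≫
      P.fromLeftDerivedZero' ((tensoringLeft (ModuleCat.{u} R)).obj X') =
      P.fromLeftDerivedZero' ((tensoringLeft (ModuleCat.{u} R)).obj X) ≫ (α ▷ Y) := by
    rw [← cancel_epi (HomologicalComplex.pOpcycles _ _),
      HomologicalComplex.p_opcyclesMap_assoc]
    erw [ProjectiveResolution.pOpcycles_comp_fromLeftDerivedZero']
    erw [ProjectiveResolution.pOpcycles_comp_fromLeftDerivedZero'_assoc]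
    exact (((tensoringLeft (ModuleCat.{u} R)).map α).naturality (P.π.f 0)).symm
  rw [← h]
  exact HomologicalComplex.homologyι_naturality_assoc _ _ _

lemma tensorResolution_isZero_homology (X : ModuleCat.{u} R) [Module.Flat R X]
    {Y : ModuleCat.{u} R} (P : ProjectiveResolution Y) (j : ℕ) :
    IsZero ((tensorResolution X P).homology (j + 1)) := by
  rw [← HomologicalComplex.exactAt_iff_isZero_homology,
    HomologicalComplex.exactAt_iff' _ (j + 2) (j + 1) j (by simp) (by simp)]
  have h := P.complex_exactAt_succ j
  rw [HomologicalComplex.exactAt_iff' _ (j + 2) (j + 1) j (by simp) (by simp)] at h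
  rw [ShortComplex.ShortExact.moduleCat_exact_iff_function_exact] at h ⊢
  exact Module.Flat.lTensor_exact X h

variable {M' F M : Type u} [AddCommGroup M'] [Module R M'] [AddCommGroup F] [Module R F]
  [AddCommGroup M] [Module R M] {f : M' →ₗ[R] F} {g : F →ₗ[R] M}

lemma tensorResolution_shortExact (hf : Function.Injective f) (hfg : Function.Exact f g)
    (hg : Function.Surjective g) {Y : ModuleCat.{u} R} (P : ProjectiveResolution Y) :
    ∃ w, (ShortComplex.mk (tensorResolutionMap (ModuleCat.ofHom f) P)
      (tensorResolutionMap (ModuleCat.ofHom g) P) w).ShortExact := by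
  have key : ∀ n, (Function.Injective (f.rTensor (P.complex.X n)) ∧
      Function.Exact (f.rTensor (P.complex.X n)) (g.rTensor (P.complex.X n))) ∧
      Function.Surjective (g.rTensor (P.complex.X n)) := by
    intro n
    have : Module.Projective R (P.complex.X n) := by
      rw [IsProjective.iff_projective]
      exact P.projective n
    exact ⟨⟨Module.Flat.rTensor_preserves_injective_linearMap f hf,
      rTensor_exact _ hfg hg⟩, LinearMap.rTensor_surjective _ hg⟩
  refine ⟨?_, ?_⟩
  · refine HomologicalComplex.hom_ext _ _ fun n => ?_
    exact ModuleCat.hom_ext (key n).1.2.linearMap_comp_eq_zero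
  · refine HomologicalComplex.shortExact_of_degreewise_shortExact _ fun n =>
      { exact := ?_, mono_f := ?_, epi_g := ?_ }
    · rw [ShortComplex.ShortExact.moduleCat_exact_iff_function_exact]
      exact (key n).1.2
    · exact (ModuleCat.mono_iff_injective _).2 (key n).1.1
    · exact (ModuleCat.epi_iff_surjective _).2 (key n).2

variable (M) in
theorem TorM.nonempty_zero_equiv (N : Type u) [AddCommGroup N] [Module R N] :
    Nonempty (TorM R 0 M N ≃ₗ[R] TensorProduct R M N) :=
  ⟨(((projectiveResolution (ModuleCat.of R N)).isoLeftDerivedObj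
      ((tensoringLeft (ModuleCat.{u} R)).obj (ModuleCat.of R M)) 0) ≪≫
    tensorResolutionZeroIso (ModuleCat.of R M) _).toLinearEquiv⟩

theorem TorM.nonempty_succ_equiv (hf : Function.Injective f) (hfg : Function.Exact f g)
    (hg : Function.Surjective g) [Module.Flat R F] (N : Type u) [AddCommGroup N] [Module R N]
    (j : ℕ) : Nonempty (TorM R (j + 2) M N ≃ₗ[R] TorM R (j + 1) M' N) := by
  obtain ⟨w, hS⟩ := tensorResolution_shortExact hf hfg hg
    (projectiveResolution (ModuleCat.of R N))
  have : Module.Flat R (ModuleCat.of R F) := ‹Module.Flat R F›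
  exact ⟨(((projectiveResolution (ModuleCat.of R N)).isoLeftDerivedObj _ _) ≪≫
    hS.δIso (j + 2) (j + 1) (by simp)
      (tensorResolution_isZero_homology (ModuleCat.of R F) _ _)
      (tensorResolution_isZero_homology (ModuleCat.of R F) _ _) ≪≫
    ((projectiveResolution (ModuleCat.of R N)).isoLeftDerivedObj _ _).symm).toLinearEquiv⟩

theorem TorM.nonempty_one_equiv (hf : Function.Injective f) (hfg : Function.Exact f g)
    (hg : Function.Surjective g) [Module.Flat R F] (N : Type u) [AddCommGroup N] [Module R N] :
    Nonempty (TorM R 1 M N ≃ₗ[R] LinearMap.ker (f.rTensor N)) := by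
  let P := projectiveResolution (ModuleCat.of R N)
  obtain ⟨w, hS⟩ := tensorResolution_shortExact hf hfg hg P
  have : Module.Flat R (ModuleCat.of R F) := ‹Module.Flat R F›
  have hmono := hS.mono_δ 1 0 (by simp)
      (tensorResolution_isZero_homology (ModuleCat.of R F) P 0)
  have hex := hS.homology_exact₁ 1 0 (by simp)
  rw [ShortComplex.ShortExact.moduleCat_exact_iff_function_exact] at hex
  let e := (tensorResolutionZeroIso (ModuleCat.of R M') P).toLinearEquiv
  let e' := (tensorResolutionZeroIso (ModuleCat.of R F) P).toLinearEquiv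
  let δ := (hS.δ 1 0 (by simp)).hom
  have hδ : Function.Injective δ := (ModuleCat.mono_iff_injective _).1 hmono
  have hnat : ∀ x, e' ((HomologicalComplex.homologyMap
      (tensorResolutionMap (ModuleCat.ofHom f) P) 0).hom x) = f.rTensor N (e x) := fun x =>
    congrArg (fun φ => φ.hom x)
      (tensorResolutionZeroIso_naturality (ModuleCat.ofHom f) P)
  let φ := e.toLinearMap ∘ₗ δ
  have hr : LinearMap.range φ = LinearMap.ker (f.rTensor N) := by
    ext x
    obtain ⟨y, rfl⟩ := e.surjective x
    rw [LinearMap.mem_ker, ← hnat, LinearEquiv.map_eq_zero_iff]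
    refine Iff.trans ?_ (hex y).symm
    constructor
    · rintro ⟨z, hz⟩
      exact ⟨z, e.injective hz⟩
    · rintro ⟨z, hz⟩
      exact ⟨z, congrArg e hz⟩
  have h1 := LinearEquiv.ofInjective φ (e.injective.comp hδ)
  exact ⟨(P.isoLeftDerivedObj _ _).toLinearEquiv ≪≫ₗ h1 ≪≫ₗ LinearEquiv.ofEq _ _ hr⟩

end TorShift

section Cosyzygy

variable {R : Type u} [CommRing R]

/-- The modules of cosyzygies in an injective coresolution of `Y`. -/
noncomputable def cosyzygy (Y : ModuleCat.{u} R) : ℕ → ModuleCat.{u} R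
  | 0 => Y
  | a + 1 => ModuleCat.of R
      ((Injective.under (cosyzygy Y a) : ModuleCat.{u} R) ⧸
        LinearMap.range (Injective.ι (cosyzygy Y a)).hom)

namespace cosyzygy

variable (Y : ModuleCat.{u} R)

/-- The terms of an injective coresolution of `Y`. -/
noncomputable def hull (a : ℕ) : ModuleCat.{u} R := Injective.under (cosyzygy Y a)

/-- The inclusion of a cosyzygy in the next injective module. -/
noncomputable def ι (a : ℕ) : cosyzygy Y a →ₗ[R] hull Y a := (Injective.ι (cosyzygy Y a)).hom

/-- The projection of an injective module onto the next cosyzygy. -/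
noncomputable def π (a : ℕ) : hull Y a →ₗ[R] cosyzygy Y (a + 1) :=
  (LinearMap.range (Injective.ι (cosyzygy Y a)).hom).mkQ

theorem injective_hull (a : ℕ) : Module.Injective R (hull Y a) :=
  (Module.injective_iff_injective_object _ _).2
    (inferInstanceAs (Injective (Injective.under (cosyzygy Y a))))

theorem ι_injective (a : ℕ) : Function.Injective (ι Y a) :=
  (ModuleCat.mono_iff_injective _).1 (inferInstanceAs (Mono (Injective.ι (cosyzygy Y a))))

theorem exact_ι_π (a : ℕ) : Function.Exact (ι Y a) (π Y a) :=
  LinearMap.exact_map_mkQ_range (Injective.ι (cosyzygy Y a)).hom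

theorem π_surjective (a : ℕ) : Function.Surjective (π Y a) :=
  Submodule.mkQ_surjective (LinearMap.range (Injective.ι (cosyzygy Y a)).hom)

theorem postδ_bijective (X : Type u) [AddCommGroup X] [Module R X] (a b : ℕ) :
    Function.Bijective (ModExt.postδ (ι_injective Y a) (exact_ι_π Y a) (π_surjective Y a)
      (b + 1) X) := by
  have h1 : Subsingleton (ModExt R (b + 1) X (hull Y a)) :=
    ModExt.subsingleton_of_injective (injective_hull Y a) b
  have h2 : Subsingleton (ModExt R (b + 1 + 1) X (hull Y a)) :=
    ModExt.subsingleton_of_injective (injective_hull Y a) (b + 1)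
  refine ⟨(injective_iff_map_eq_zero _).2 fun x hx => ?_, fun x => ?_⟩
  · obtain ⟨w, rfl⟩ := (ModExt.exact_postδ (ι_injective Y a) (exact_ι_π Y a)
      (π_surjective Y a) (b + 1) X x).1 hx
    rw [h1.elim w 0, map_zero]
  · exact (ModExt.postδ_exact (ι_injective Y a) (exact_ι_π Y a)
      (π_surjective Y a) (b + 1) X x).1 (h2.elim _ _)

theorem nonempty_ext_equiv (X : Type u) [AddCommGroup X] [Module R X] (a : ℕ) :
    ∀ b m : ℕ, m = a + b + 1 →
      Nonempty (ModExt R (b + 1) X (cosyzygy Y a) ≃ₗ[R] ModExt R m X Y) := by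
  induction a with
  | zero =>
    rintro b m rfl
    rw [Nat.zero_add]
    exact ⟨LinearEquiv.refl R _⟩
  | succ a ih =>
    intro b m hm
    obtain ⟨e⟩ := ih (b + 1) m (by omega)
    exact ⟨LinearEquiv.ofBijective _ (postδ_bijective Y X a b) ≪≫ₗ e⟩

/-- `Ext^(a+1)(X, Y)` is the cokernel of `Hom(X, hull Y a) → Hom(X, cosyzygy Y (a + 1))`. -/
theorem exists_hom_to_ext (X : Type u) [AddCommGroup X] [Module R X] (a : ℕ) :
    ∃ Θ : (X →ₗ[R] cosyzygy Y (a + 1)) →ₗ[R] ModExt R (a + 1) X Y,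
      ∀ k, Θ k = 0 → ∃ h, π Y a ∘ₗ h = k := by
  obtain ⟨e⟩ := nonempty_ext_equiv Y X a 0 (a + 1) rfl
  refine ⟨e.toLinearMap ∘ₗ ModExt.postδ (ι_injective Y a) (exact_ι_π Y a) (π_surjective Y a)
    0 X ∘ₗ (ModExt.homEquiv X (cosyzygy Y (a + 1))).toLinearMap, fun k hk => ?_⟩
  obtain ⟨w, hw⟩ := (ModExt.exact_postδ (ι_injective Y a) (exact_ι_π Y a)
    (π_surjective Y a) 0 X _).1 (e.map_eq_zero_iff.1 hk)
  obtain ⟨h, rfl⟩ := (ModExt.homEquiv X (hull Y a)).surjective w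
  rw [ModExt.post_homEquiv] at hw
  exact ⟨h, (ModExt.homEquiv X (cosyzygy Y (a + 1))).injective hw⟩

theorem injective_of_subsingleton_ext {n : ℕ} (hn : ∀ (X : Type u) [AddCommGroup X] [Module R X],
    ∀ j > n, Subsingleton (ModExt R j X Y)) {a : ℕ} (ha : n ≤ a) :
    Module.Injective R (cosyzygy Y a) := by
  refine Module.Injective.of_exact_of_lift (ι Y a) (π Y a) (ι_injective Y a) (exact_ι_π Y a)
    (injective_hull Y a) fun X _ _ _ k => ?_
  have h := hn X (a + 1) (by omega)
  obtain ⟨Θ, hΘ⟩ := exists_hom_to_ext Y X a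
  exact hΘ k (h.elim _ _)

end cosyzygy

end Cosyzygy

section Assembly

open TensorProduct

variable {R : Type u} [CommRing R]

theorem PropT.hom {p : Ideal R} {N X : Type u} [AddCommGroup N] [Module R N]
    [AddCommGroup X] [Module R X] [Module.Finite R X] (h : PropT R p N) :
    PropT R p (X →ₗ[R] N) := by
  refine ⟨fun r hr => ?_, fun φ => ?_⟩
  · let e : N ≃ₗ[R] N := LinearEquiv.ofBijective (LinearMap.lsmul R N r) (h.1 r hr)
    exact (LinearEquiv.congrRight (M := X) e).bijective
  · obtain ⟨S, hS⟩ := Module.Finite.fg_top (R := R) (M := X)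
    choose m hm0 hm using h.2
    refine ⟨S.sup (fun x => m (φ x)) + 1, Nat.succ_pos _, fun a ha => ?_⟩
    refine LinearMap.ext_on hS fun x hx => ?_
    exact hm (φ x) a (Ideal.pow_le_pow_right
      ((Finset.le_sup (f := fun x => m (φ x)) hx).trans (Nat.le_succ _)) ha)

theorem PropT.eq_zero_of_smul_eq_zero {p : Ideal R} {N M : Type u} [AddCommGroup N] [Module R N]
    [AddCommGroup M] [Module R M] (h : PropT R p N) {s : R} (hs : s ∉ p) {z : M ⊗[R] N}
    (hz : s • z = 0) : z = 0 := by
  let e : N ≃ₗ[R] N := LinearEquiv.ofBijective (LinearMap.lsmul R N s) (h.1 s hs)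
  have he : ∀ z : M ⊗[R] N, e.lTensor M z = s • z := fun z => by
    induction z with
    | zero => simp
    | tmul x y => exact TensorProduct.tmul_smul s x y
    | add x y hx hy => simp [hx, hy]
  exact (e.lTensor M).injective (by rw [he, hz, map_zero])

/-- If `N` is `p`-local and `p`-torsion and every map from a finitely generated `p`-torsion module
to `D'` lifts to `J` after multiplication by a single element outside `p`, then
`Hom(D', E) ⊗ N → Hom(J, E) ⊗ N` is injective. -/
theorem PropT.rTensor_lcomp_injective [IsNoetherianRing R] {p : Ideal R} {N E J D' : Type u}
    [AddCommGroup N] [Module R N]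
    [AddCommGroup E] [Module R E] [AddCommGroup J] [Module R J] [AddCommGroup D'] [Module R D']
    (hN : PropT R p N) (hE : Module.Injective R E) (hJ : Module.Injective R J) (π : J →ₗ[R] D')
    (h : ∀ (X : Type u) [AddCommGroup X] [Module R X] [Module.Finite R X],
      (∀ x : X, ∃ m : ℕ, ∀ a ∈ p ^ m, a • x = 0) →
      ∃ s ∉ p, ∀ k : X →ₗ[R] D', ∃ l : X →ₗ[R] J, π ∘ₗ l = s • k) :
    Function.Injective ((LinearMap.lcomp R E π).rTensor N) := by
  have hflat := Module.Flat.of_injective_hom hE hJ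
  refine (injective_iff_map_eq_zero _).2 fun z hz => ?_
  obtain ⟨N₀, hfin, hzN⟩ :=
    TensorProduct.exists_finite_submodule_right_of_setFinite {z} (Set.finite_singleton z)
  obtain ⟨z₀, rfl⟩ := hzN rfl
  have hz₀ : (LinearMap.lcomp R E π).rTensor N₀ z₀ = 0 := by
    refine Module.Flat.lTensor_preserves_injective_linearMap N₀.subtype
      N₀.injective_subtype (M := J →ₗ[R] E) ?_
    rw [map_zero, ← hz, ← LinearMap.comp_apply, ← LinearMap.comp_apply,
      LinearMap.lTensor_comp_rTensor, LinearMap.rTensor_comp_lTensor]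
  obtain ⟨s, hs, hsl⟩ := h N₀ fun x => by
    obtain ⟨m, -, hm⟩ := hN.2 x
    exact ⟨m, fun a ha => Subtype.ext (hm a ha)⟩
  refine hN.eq_zero_of_smul_eq_zero hs ?_
  rw [← map_smul]
  have : s • z₀ = 0 := by
    refine (homTensorEval_bijective (J := D') (X := N₀) hE).1 (LinearMap.ext fun k => ?_)
    obtain ⟨l, hl⟩ := hsl k
    rw [map_smul, LinearMap.smul_apply, ← map_smul, ← hl, ← homTensorEval_rTensor, hz₀]
    simp
  rw [this, map_zero]

/-- Injectivity of `ker (M ⊗ E → F ⊗ E)` may be checked on the indecomposable pieces of `E`. -/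
theorem Module.Injective.ker_rTensor_of_propT [IsNoetherianRing R] {M F E : Type u}
    [AddCommGroup M] [Module R M] [AddCommGroup F] [Module R F] [AddCommGroup E] [Module R E]
    (hE : Module.Injective R E) (f : M →ₗ[R] F)
    (h : ∀ (p : Ideal R) (N : Type u) [AddCommGroup N] [Module R N], p.IsPrime →
      Module.Injective R N → PropT R p N → Module.Injective R (LinearMap.ker (f.rTensor N))) :
    Module.Injective R (LinearMap.ker (f.rTensor E)) := by
  classical
  obtain ⟨Λ, A, p, π, hπ, hA⟩ := Module.Injective.exists_decomposition hE
  have hres {N N' : Type u} [AddCommGroup N] [Module R N] [AddCommGroup N'] [Module R N']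
      (g : N →ₗ[R] N') : ∀ z ∈ LinearMap.ker (f.rTensor N),
      g.lTensor M z ∈ LinearMap.ker (f.rTensor N') := fun z hz => by
    rw [LinearMap.mem_ker] at hz ⊢
    rw [← LinearMap.comp_apply, LinearMap.rTensor_comp_lTensor, ← LinearMap.lTensor_comp_rTensor,
      LinearMap.comp_apply, hz, map_zero]
  refine Module.Injective.of_family (fun l => LinearMap.ker (f.rTensor (A l)))
    (fun l => ((A l).subtype.lTensor M).restrict (hres _))
    (fun l => ((π l).lTensor M).restrict (hres _)) ?_
    (fun l => h (p l) (A l) (hA l).1 (hA l).2.1 (hA l).2.2)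
  have key : ∀ z : M ⊗[R] E, ∃ s : Finset Λ, ∀ s' ⊇ s,
      ∑ l ∈ s', (A l).subtype.lTensor M ((π l).lTensor M z) = z := fun z => by
    induction z with
    | zero => exact ⟨∅, by simp⟩
    | tmul x y =>
      obtain ⟨s, hs⟩ := hπ y
      refine ⟨s, fun s' hs' => ?_⟩
      conv_rhs => rw [← hs s' hs', TensorProduct.tmul_sum]
      rfl
    | add x y hx hy =>
      obtain ⟨s, hs⟩ := hx
      obtain ⟨t, ht⟩ := hy
      refine ⟨s ∪ t, fun s' hs' => ?_⟩
      simp only [map_add, Finset.sum_add_distrib]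
      rw [hs s' (Finset.union_subset_left hs'), ht s' (Finset.union_subset_right hs')]
  rintro ⟨z, hz⟩
  obtain ⟨s, hs⟩ := key z
  refine ⟨s, fun s' hs' => Subtype.ext ?_⟩
  rw [AddSubmonoidClass.coe_finsetSum]
  exact hs s' hs'

end Assembly

section Main

open TensorProduct

variable {R : Type u} [CommRing R] [IsNoetherianRing R]

namespace cosyzygy

variable (Y : ModuleCat.{u} R) {E : Type u} [AddCommGroup E] [Module R E]

theorem nonempty_tor_equiv (hE : Module.Injective R E) (N : Type u) [AddCommGroup N]
    [Module R N] (a : ℕ) : Nonempty (TorM R (a + 1) (Y →ₗ[R] E) N ≃ₗ[R]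
      LinearMap.ker ((LinearMap.lcomp R E (π Y a)).rTensor N)) := by
  have hflat (a : ℕ) := Module.Flat.of_injective_hom hE (injective_hull Y a)
  have h (a : ℕ) : ∀ j m, m = j + a + 1 → Nonempty (TorM R m (Y →ₗ[R] E) N ≃ₗ[R]
      TorM R (j + 1) (cosyzygy Y a →ₗ[R] E) N) := by
    induction a with
    | zero =>
      rintro j m rfl
      exact ⟨LinearEquiv.refl R _⟩
    | succ a ih =>
      intro j m hm
      obtain ⟨e⟩ := ih (j + 1) m (by omega)
      obtain ⟨e'⟩ := TorM.nonempty_succ_equiv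
        (LinearMap.lcomp_injective_of_surjective (S := R) (N := E) _ (π_surjective Y a))
        (hE.exact_lcomp (exact_ι_π Y a)) (hE.lcomp_surjective (ι_injective Y a)) N j
      exact ⟨e ≪≫ₗ e'⟩
  obtain ⟨e⟩ := h a 0 (a + 1) (by omega)
  obtain ⟨e'⟩ := TorM.nonempty_one_equiv
    (LinearMap.lcomp_injective_of_surjective (S := R) (N := E) _ (π_surjective Y a))
    (hE.exact_lcomp (exact_ι_π Y a)) (hE.lcomp_surjective (ι_injective Y a)) N
  exact ⟨e ≪≫ₗ e'⟩

variable {Y}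

/-- If the maps `Hom(cosyzygy Y (a + 1), E) ⊗ N → Hom(hull Y a, E) ⊗ N` are injective for
`a ≥ i`, and the cosyzygies of `Y` are eventually injective, then
`Hom(cosyzygy Y a, E) ⊗ N` is injective for `a ≥ i`. -/
theorem injective_tensorProduct (hE : Module.Injective R E) {n : ℕ}
    (hn : ∀ a, n ≤ a → Module.Injective R (cosyzygy Y a))
    {N : Type u} [AddCommGroup N] [Module R N] (hN : Module.Injective R N) {i : ℕ}
    (h : ∀ a, i ≤ a → Function.Injective ((LinearMap.lcomp R E (π Y a)).rTensor N)) {a : ℕ}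
    (ha : i ≤ a) : Module.Injective R ((cosyzygy Y a →ₗ[R] E) ⊗[R] N) := by
  have key : ∀ k a, i ≤ a → n ≤ a + k →
      Module.Injective R ((cosyzygy Y a →ₗ[R] E) ⊗[R] N) := by
    intro k
    induction k with
    | zero =>
      intro a _ han
      have := Module.Flat.of_injective_hom hE (hn a han)
      exact Module.Injective.tensorProduct_of_flat hN
    | succ k ih =>
      intro a ha han
      have := Module.Flat.of_injective_hom hE (injective_hull Y a)
      exact Module.Injective.of_exact _ ((LinearMap.lcomp R E (ι Y a)).rTensor N) (h a ha)
        (rTensor_exact N (hE.exact_lcomp (exact_ι_π Y a)) (hE.lcomp_surjective (ι_injective Y a)))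
        (LinearMap.rTensor_surjective N (hE.lcomp_surjective (ι_injective Y a)))
        (ih (a + 1) (by omega) (by omega)) (Module.Injective.tensorProduct_of_flat hN)
  exact key n a ha (by omega)

theorem tensorHomMap_injective (hE : Module.Injective R E)
    {p : Ideal R} {N : Type u} [AddCommGroup N] [Module R N] (hN : PropT R p N) {i : ℕ}
    (h0 : ∀ (N : Type u) [AddCommGroup N] [Module R N], PropT R p N →
      Subsingleton ((Y →ₗ[R] E) ⊗[R] N))
    (h : ∀ (N : Type u) [AddCommGroup N] [Module R N], PropT R p N → ∀ a < i,
      Function.Injective ((LinearMap.lcomp R E (π Y a)).rTensor N))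
    (X : Type u) [AddCommGroup X] [Module R X] [Module.Finite R X] (a : ℕ) (ha : a ≤ i) :
    Function.Injective (tensorHomMap (R := R) (cosyzygy Y a →ₗ[R] E) N X) := by
  induction a with
  | zero =>
    have : Subsingleton ((cosyzygy Y 0 →ₗ[R] E) ⊗[R] (X →ₗ[R] N)) := h0 _ hN.hom
    exact Function.injective_of_subsingleton _
  | succ a ih =>
    have := Module.Flat.of_injective_hom hE (injective_hull Y a)
    intro x y hxy
    refine h _ hN.hom a ha ((tensorHomMap_bijective (F := hull Y a →ₗ[R] E)).1 ?_)
    rw [tensorHomMap_rTensor, hxy, tensorHomMap_rTensor]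

theorem injective_ker (hE : Module.Injective R E)
    {p : Ideal R} {N : Type u} [AddCommGroup N] [Module R N] (hN : PropT R p N)
    {i : ℕ}
    (h0 : ∀ (N : Type u) [AddCommGroup N] [Module R N], PropT R p N →
      Subsingleton ((Y →ₗ[R] E) ⊗[R] N))
    (h : ∀ (N : Type u) [AddCommGroup N] [Module R N], PropT R p N → ∀ a < i,
      Function.Injective ((LinearMap.lcomp R E (π Y a)).rTensor N))
    (hV : Module.Injective R ((cosyzygy Y (i + 1) →ₗ[R] E) ⊗[R] N)) :
    Module.Injective R (LinearMap.ker ((LinearMap.lcomp R E (π Y i)).rTensor N)) := by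
  have hflat := Module.Flat.of_injective_hom hE (injective_hull Y i)
  have hex (N : Type u) [AddCommGroup N] [Module R N] :=
    rTensor_exact N (hE.exact_lcomp (exact_ι_π Y i)) (hE.lcomp_surjective (ι_injective Y i))
  refine Module.Injective.of_exact_of_lift
    (K := LinearMap.range ((LinearMap.lcomp R E (π Y i)).rTensor N)) (LinearMap.ker _).subtype
    ((LinearMap.lcomp R E (π Y i)).rTensor N).rangeRestrict (Submodule.injective_subtype _)
    ?_ hV fun X _ _ _ k => ?_
  · rw [LinearMap.exact_iff, LinearMap.ker_rangeRestrict, Submodule.range_subtype]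
  · obtain ⟨w, hw⟩ := (tensorHomMap_bijective (F := hull Y i →ₗ[R] E) (E := N) (X := X)).2
      ((LinearMap.range _).subtype ∘ₗ k)
    have hw0 : (LinearMap.lcomp R E (ι Y i)).rTensor _ w = 0 := by
      refine tensorHomMap_injective hE hN h0 h X i le_rfl ?_
      rw [tensorHomMap_rTensor, hw, map_zero]
      exact LinearMap.ext fun x => (hex N _).2 (k x).2
    obtain ⟨v, rfl⟩ := (hex _ w).1 hw0
    refine ⟨tensorHomMap _ N X v, LinearMap.ext fun x => Subtype.ext ?_⟩
    rw [tensorHomMap_rTensor] at hw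
    exact LinearMap.congr_fun hw x

end cosyzygy

end Main

/-- Over a Cohen-Macaulay noetherian ring with dualizing module `D`, if `E`
and `E'` are injective modules then `Tor_i^R(Hom_R(D, E'), E)` is injective for all `i ≥ 0`. -/
theorem statement10 (R : Type u) [CommRing R] [IsNoetherianRing R]
    (hCM : IsCohenMacaulayRing R)
    (D : Type u) [AddCommGroup D] [Module R D] (hD : IsDualizing R D)
    (E : Type u) [AddCommGroup E] [Module R E] (hE : Module.Injective R E)
    (E' : Type u) [AddCommGroup E'] [Module R E'] (hE' : Module.Injective R E') :
    ∀ i : ℕ, Module.Injective R (TorM R i (D →ₗ[R] E') E) := by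
  obtain ⟨⟨hfin, hhom, hext⟩, n, hid⟩ := hD
  have hn := fun (X : Type u) [AddCommGroup X] [Module R X] =>
    ModExt.subsingleton_of_injDimLE hid X
  let Y := ModuleCat.of R D
  have hinj : ∀ a, n ≤ a → Module.Injective R (cosyzygy Y a) := fun a ha =>
    cosyzygy.injective_of_subsingleton_ext Y hn ha
  have key (p : Ideal R) [p.IsPrime] : ∃ i : ℕ,
      (0 < i → ∀ (N : Type u) [AddCommGroup N] [Module R N], PropT R p N →
        Subsingleton (TensorProduct R (D →ₗ[R] E') N)) ∧
      ∀ (N : Type u) [AddCommGroup N] [Module R N], PropT R p N → ∀ a, a + 1 ≠ i →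
        Function.Injective ((LinearMap.lcomp R E' (cosyzygy.π Y a)).rTensor N) := by
    obtain ⟨i, hgt, hlt⟩ := exists_forall_locZero_ext (p := p) hhom
      (fun j => ModExt.subsingleton_of_subsingleton_extM j (hext (j + 1) (by omega))) hn
    refine ⟨i, fun hi N _ _ hN => ?_, fun N _ _ hN a ha => ?_⟩
    · have := hN.rTensor_lcomp_injective hE' (J := PUnit) .of_subsingleton
        (0 : PUnit.{u + 1} →ₗ[R] D)
        fun X _ _ _ hX => by
          obtain ⟨s, hs, h⟩ := (hlt X hX 0 hi).exists_smul_eq_zero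
          refine ⟨s, hs, fun k => ⟨0, ?_⟩⟩
          refine (ModExt.homEquiv X D).injective ?_
          rw [map_smul, h, LinearMap.comp_zero, map_zero]
      have h0 : LinearMap.lcomp R E' (0 : PUnit.{u + 1} →ₗ[R] D) = 0 := by
        ext; simp
      exact subsingleton_of_forall_eq 0 fun z => this (by rw [h0]; simp)
    · refine hN.rTensor_lcomp_injective hE' (cosyzygy.injective_hull Y a) _ fun X _ _ _ hX => ?_
      have hz : LocZero p (ModExt R (a + 1) X D) := by
        rcases lt_or_gt_of_ne ha with h | h
        exacts [hlt X hX _ h, hgt X _ h]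
      obtain ⟨s, hs, h⟩ := hz.exists_smul_eq_zero
      obtain ⟨Θ, hΘ⟩ := cosyzygy.exists_hom_to_ext Y X a
      exact ⟨s, hs, fun k => hΘ _ (by rw [map_smul]; exact h _)⟩
  intro j
  cases j with
  | zero =>
    obtain ⟨e⟩ := TorM.nonempty_zero_equiv (R := R) (D →ₗ[R] E') E
    refine .of_linearEquiv e.symm ?_
    have htop (N : Type u) [AddCommGroup N] [Module R N] :
        LinearMap.ker ((0 : (D →ₗ[R] E') →ₗ[R] (D →ₗ[R] E')).rTensor N) = ⊤ := by
      rw [LinearMap.rTensor_zero, LinearMap.ker_zero]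
    refine .of_linearEquiv (LinearEquiv.ofTop _ (htop E))
      (hE.ker_rTensor_of_propT _ fun p N _ _ hp hNinj hN => ?_)
    refine .of_linearEquiv (LinearEquiv.ofTop _ (htop N)).symm ?_
    obtain ⟨i, h0, h⟩ := key p
    rcases i.eq_zero_or_pos with rfl | hi
    · exact cosyzygy.injective_tensorProduct (Y := Y) (a := 0) hE' hinj hNinj
        (fun a _ => h N hN a (by omega)) le_rfl
    · have := h0 hi N hN
      exact .of_subsingleton
  | succ a =>
    obtain ⟨e⟩ := cosyzygy.nonempty_tor_equiv Y hE' E a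
    refine .of_linearEquiv e.symm (hE.ker_rTensor_of_propT _ fun p N _ _ hp hNinj hN => ?_)
    obtain ⟨i, h0, h⟩ := key p
    rcases eq_or_ne (a + 1) i with rfl | hi
    · exact cosyzygy.injective_ker hE' hN (h0 (by omega))
        (fun N _ _ hN b hb => h N hN b (by omega))
        (cosyzygy.injective_tensorProduct hE' hinj hNinj
          (fun b hb => h N hN b (by omega)) le_rfl)
    · have : Subsingleton (LinearMap.ker ((LinearMap.lcomp R E' (cosyzygy.π Y a)).rTensor N)) := by
        rw [LinearMap.ker_eq_bot.2 (h N hN a hi)]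
        infer_instance
      exact .of_subsingleton
end

section
/- Let R be a Cohen-Macaulay commutative noetherian ring with a dualizing module D, and let p ∈ Spec(R). Then for any Gorenstein injective R-module G one has Tor_k^R(Hom_R(D, E_R(R/p)), G) = 0 for all k ≠ ht(p). -/
/-!
Common definitions: property t(p), injective hulls, (C-)Gorenstein injective modules,
(C-)Gorenstein injective / injective / flat dimensions, small support, torsion functor,
Tor and Ext modules, semidualizing and dualizing modules, depth, Cohen-Macaulay rings,
Serre's condition (S₁), Gorenstein local rings, minimal injective resolutions.
-/

universe u

open CategoryTheory Limits DirectSum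

/-- The vanishing of `Ext_R^n(M, Y)`. -/
def ExtVanishes (R : Type u) [CommRing R] (n : ℕ) (M Y : Type u) [AddCommGroup M] [Module R M]
    [AddCommGroup Y] [Module R Y] : Prop :=
  Subsingleton (Abelian.Ext (ModuleCat.of R M) (ModuleCat.of R Y) n)

namespace ExtVanishes

variable {R : Type u} [CommRing R] {A B C M M' Y : Type u}
  [AddCommGroup A] [Module R A] [AddCommGroup B] [Module R B] [AddCommGroup C] [Module R C]
  [AddCommGroup M] [Module R M] [AddCommGroup M'] [Module R M'] [AddCommGroup Y] [Module R Y]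

theorem iff_forall_eq_zero {n : ℕ} : ExtVanishes R n M Y ↔
    ∀ e : Abelian.Ext (ModuleCat.of R M) (ModuleCat.of R Y) n, e = 0 :=
  ⟨fun h e ↦ @Subsingleton.elim _ h e 0, fun h ↦ ⟨fun a b ↦ (h a).trans (h b).symm⟩⟩

section sequences

theorem exists_shortExact {f : A →ₗ[R] B} {g : B →ₗ[R] C} (hf : Function.Injective f)
    (hg : Function.Surjective g) (h : Function.Exact f g) :
    ∃ w, (ShortComplex.mk (ModuleCat.ofHom f) (ModuleCat.ofHom g) w).ShortExact :=
  ⟨_, ModuleCat.shortComplex_shortExact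
    (ModuleCat.shortComplexOfCompEqZero f g h.linearMap_comp_eq_zero) h hf hg⟩

theorem middle {f : A →ₗ[R] B} {g : B →ₗ[R] C} (hf : Function.Injective f)
    (hg : Function.Surjective g) (h : Function.Exact f g) {n : ℕ}
    (hA : ExtVanishes R n A Y) (hC : ExtVanishes R n C Y) : ExtVanishes R n B Y := by
  obtain ⟨w, S⟩ := exists_shortExact hf hg h
  rw [iff_forall_eq_zero] at *
  intro e
  obtain ⟨x, rfl⟩ := Abelian.Ext.contravariant_sequence_exact₂ S _ e (hA _)
  simp [hC x]

theorem left {f : A →ₗ[R] B} {g : B →ₗ[R] C} (hf : Function.Injective f)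
    (hg : Function.Surjective g) (h : Function.Exact f g) {n : ℕ}
    (hB : ExtVanishes R n B Y) (hC : ExtVanishes R (n + 1) C Y) : ExtVanishes R n A Y := by
  obtain ⟨w, S⟩ := exists_shortExact hf hg h
  rw [iff_forall_eq_zero] at *
  intro e
  obtain ⟨x, rfl⟩ := Abelian.Ext.contravariant_sequence_exact₁ S _ e (add_comm 1 n) (hC _)
  simp [hB x]

theorem right {f : A →ₗ[R] B} {g : B →ₗ[R] C} (hf : Function.Injective f)
    (hg : Function.Surjective g) (h : Function.Exact f g) {n : ℕ}
    (hA : ExtVanishes R n A Y) (hB : ExtVanishes R (n + 1) B Y) : ExtVanishes R (n + 1) C Y := by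
  obtain ⟨w, S⟩ := exists_shortExact hf hg h
  rw [iff_forall_eq_zero] at *
  intro e
  obtain ⟨x, rfl⟩ := Abelian.Ext.contravariant_sequence_exact₃ S _ e (hB _) (add_comm 1 n)
  simp [hA x]

theorem zero_of_surjective {g : B →ₗ[R] C} (hg : Function.Surjective g)
    (hB : ExtVanishes R 0 B Y) : ExtVanishes R 0 C Y := by
  rw [iff_forall_eq_zero] at *
  have : Epi (ModuleCat.ofHom g) := (ModuleCat.epi_iff_surjective _).2 hg
  intro e
  exact Abelian.Ext.precomp_mk₀_injective_of_epi _ (ModuleCat.ofHom g)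
    ((hB _).trans (map_zero _).symm)

end sequences

theorem smul_bijective {n : ℕ} {s : R} (hs : Function.Bijective fun y : Y ↦ s • y) :
    Function.Bijective
      fun e : Abelian.Ext (ModuleCat.of R M) (ModuleCat.of R Y) n ↦ s • e := by
  let σ : Y ≃ₗ[R] Y := LinearEquiv.ofBijective (LinearMap.lsmul R Y s) hs
  have h1 : s • 𝟙 (ModuleCat.of R Y) = ModuleCat.ofHom (σ : Y →ₗ[R] Y) := by
    ext x; rfl
  refine Function.bijective_iff_has_inverse.2
    ⟨fun e ↦ e.comp (Abelian.Ext.mk₀ (ModuleCat.ofHom (σ.symm : Y →ₗ[R] Y))) (add_zero _), ?_, ?_⟩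
  · intro e
    simp only [Abelian.Ext.smul_eq_comp_mk₀, h1]
    rw [Abelian.Ext.comp_assoc_of_third_deg_zero, Abelian.Ext.mk₀_comp_mk₀, ← ModuleCat.ofHom_comp]
    simp
  · intro e
    simp only [Abelian.Ext.smul_eq_comp_mk₀, h1]
    rw [Abelian.Ext.comp_assoc_of_third_deg_zero, Abelian.Ext.mk₀_comp_mk₀, ← ModuleCat.ofHom_comp]
    simp

theorem mk₀_lsmul_comp {n : ℕ} (s : R)
    (e : Abelian.Ext (ModuleCat.of R M) (ModuleCat.of R Y) n) :
    (Abelian.Ext.mk₀ (ModuleCat.ofHom (LinearMap.lsmul R M s))).comp e (zero_add _) = s • e := by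
  have h1 : ModuleCat.ofHom (LinearMap.lsmul R M s) = s • 𝟙 (ModuleCat.of R M) := by
    ext x; rfl
  rw [h1, Abelian.Ext.mk₀_smul, Abelian.Ext.smul_comp, Abelian.Ext.mk₀_id_comp]

theorem of_comp_eq_smul {n : ℕ} {s : R} (hs : Function.Bijective fun y : Y ↦ s • y)
    (f : M →ₗ[R] M') (g : M' →ₗ[R] M) (hgf : ∀ x, g (f x) = s • x)
    (h : ExtVanishes R n M' Y) : ExtVanishes R n M Y := by
  rw [iff_forall_eq_zero] at *
  intro e
  refine (smul_bijective hs).1 (?_ : s • e = s • 0)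
  have h1 : LinearMap.lsmul R M s = g ∘ₗ f := by ext x; simp [hgf]
  rw [← mk₀_lsmul_comp, h1, ModuleCat.ofHom_comp, ← Abelian.Ext.mk₀_comp_mk₀,
    Abelian.Ext.comp_assoc_of_second_deg_zero, h ((Abelian.Ext.mk₀ (ModuleCat.ofHom g)).comp e _)]
  simp

theorem of_subsingleton [Subsingleton M] {n : ℕ} : ExtVanishes R n M Y := by
  rw [iff_forall_eq_zero]
  intro e
  rw [← Abelian.Ext.mk₀_id_comp e, (ModuleCat.isZero_of_subsingleton (ModuleCat.of R M)).eq_of_src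
    (𝟙 (ModuleCat.of R M)) 0]
  simp

theorem of_smul_eq_zero {n : ℕ} {s : R} (hs : Function.Bijective fun y : Y ↦ s • y)
    (h : ∀ x : M, s • x = 0) : ExtVanishes R n M Y :=
  of_comp_eq_smul (M' := PUnit.{u + 1}) hs 0 0 (by simp [h]) of_subsingleton

theorem congr {n : ℕ} (e : M ≃ₗ[R] M') (h : ExtVanishes R n M' Y) : ExtVanishes R n M Y :=
  of_comp_eq_smul (s := 1) (by simpa using! Function.bijective_id)
    (e : M →ₗ[R] M') (e.symm : M' →ₗ[R] M) (by simp) h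

theorem of_projective [Module.Projective R M] {n : ℕ} : ExtVanishes R (n + 1) M Y := by
  rw [iff_forall_eq_zero]
  have : Projective (ModuleCat.of R M) := (IsProjective.iff_projective M).1 inferInstance
  exact fun e ↦ Abelian.Ext.eq_zero_of_projective e

theorem of_injective [Module.Injective R Y] {n : ℕ} : ExtVanishes R (n + 1) M Y := by
  rw [iff_forall_eq_zero]
  have : CategoryTheory.Injective (ModuleCat.of R Y) :=
    (Module.injective_iff_injective_object R Y).1 inferInstance
  exact fun e ↦ Abelian.Ext.eq_zero_of_injective e

theorem zero_iff : ExtVanishes R 0 M Y ↔ Subsingleton (M →ₗ[R] Y) :=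
  Equiv.subsingleton_congr (Abelian.Ext.addEquiv₀.toEquiv.trans
    (ModuleCat.homEquiv (M := ModuleCat.of R M) (N := ModuleCat.of R Y)))

theorem cosyzygy {f : A →ₗ[R] B} {g : B →ₗ[R] C} (hf : Function.Injective f)
    (hg : Function.Surjective g) (h : Function.Exact f g) [Module.Injective R B] {n : ℕ} :
    ExtVanishes R (n + 2) M A ↔ ExtVanishes R (n + 1) M C := by
  obtain ⟨w, S⟩ := exists_shortExact hf hg h
  constructor
  · intro hA
    rw [iff_forall_eq_zero] at *
    intro e
    obtain ⟨x, rfl⟩ := Abelian.Ext.covariant_sequence_exact₃ _ S e rfl (hA _)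
    rw [iff_forall_eq_zero.1 (of_injective (M := M) (Y := B)) x]
    simp
  · intro hC
    rw [iff_forall_eq_zero] at *
    intro e
    obtain ⟨x, rfl⟩ := Abelian.Ext.covariant_sequence_exact₁ _ S e
      (iff_forall_eq_zero.1 (of_injective (M := M) (Y := B)) _) rfl
    simp [hC x]

theorem exists_extension {f : A →ₗ[R] B} {g : B →ₗ[R] C} (hf : Function.Injective f)
    (hg : Function.Surjective g) (h : Function.Exact f g) (hC : ExtVanishes R 1 C Y)
    (φ : A →ₗ[R] Y) : ∃ ψ : B →ₗ[R] Y, ψ ∘ₗ f = φ := by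
  obtain ⟨w, S⟩ := exists_shortExact hf hg h
  rw [iff_forall_eq_zero] at hC
  obtain ⟨x, hx⟩ := Abelian.Ext.contravariant_sequence_exact₁ S _
    (Abelian.Ext.mk₀ (ModuleCat.ofHom φ)) (add_comm 1 0) (hC _)
  obtain ⟨ψ, rfl⟩ := Abelian.Ext.addEquiv₀.symm.surjective x
  refine ⟨ψ.hom, ?_⟩
  simp only [Abelian.Ext.addEquiv₀_symm_apply, Abelian.Ext.mk₀_comp_mk₀] at hx
  have := Abelian.Ext.addEquiv₀.symm.injective hx
  simpa using congrArg ModuleCat.Hom.hom this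

theorem of_ideal {n : ℕ} (h : ∀ I : Ideal R, ExtVanishes R (n + 1) (R ⧸ I) Y) :
    ExtVanishes R (n + 1) M Y := by
  induction n generalizing Y with
  | zero =>
    have : Module.Injective R Y := Module.Baer.injective fun I φ ↦ by
      obtain ⟨ψ, hψ⟩ := exists_extension I.injective_subtype I.mkQ_surjective
        (LinearMap.exact_subtype_mkQ I) (h I) φ
      exact ⟨ψ, fun x mem ↦ congrArg (fun l ↦ l ⟨x, mem⟩) hψ⟩
    exact of_injective
  | succ n ih =>
    let ⟨I, _, f, _⟩ := EnoughInjectives.presentation (ModuleCat.of R Y)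
    have : Module.Injective R I := Module.injective_module_of_injective_object R I
    have hf : Function.Injective f.hom := (ModuleCat.mono_iff_injective f).mp ‹_›
    have key (N : Type u) [AddCommGroup N] [Module R N] :=
      cosyzygy (M := N) (n := n) hf (Submodule.mkQ_surjective _) f.hom.exact_map_mkQ_range
    exact (key M).2 (ih fun J ↦ (key _).1 (h J))

theorem of_prime [IsNoetherianRing R] {n : ℕ}
    (h : ∀ q : Ideal R, q.IsPrime → ExtVanishes R (n + 1) (R ⧸ q) Y) :
    ExtVanishes R (n + 1) M Y := by
  refine of_ideal fun I ↦ ?_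
  refine IsNoetherianRing.induction_on_isQuotientEquivQuotientPrime R
    (motive := fun N _ _ _ ↦ ExtVanishes R (n + 1) N Y) inferInstance ?_ ?_ ?_
  · intros; exact of_subsingleton
  · intro N _ _ _ q e
    exact congr e (h q.1 q.2)
  · intro N₁ _ _ _ N₂ _ _ _ N₃ _ _ _ f g hf hg hfg h₁ h₃
    exact middle hf hg hfg h₁ h₃

end ExtVanishes

section
open TensorProduct

variable {R : Type u} [CommRing R] {T M : Type u}
  [AddCommGroup T] [Module R T] [AddCommGroup M] [Module R M]

theorem subsingleton_torM_succ_iff (P : ProjectiveResolution (ModuleCat.of R M)) (k : ℕ) :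
    Subsingleton (TorM R (k + 1) T M) ↔
      Function.Exact ((P.complex.d (k + 2) (k + 1)).hom.lTensor T)
        ((P.complex.d (k + 1) k).hom.lTensor T) := by
  let F := (MonoidalCategory.tensoringLeft (ModuleCat.{u} R)).obj (ModuleCat.of R T)
  rw [← ModuleCat.isZero_iff_subsingleton]
  refine Iff.trans (P.isoLeftDerivedObj F (k + 1)).isZero_iff ?_
  change IsZero (((F.mapHomologicalComplex _).obj P.complex).homology (k + 1)) ↔ _
  rw [← HomologicalComplex.exactAt_iff_isZero_homology,
    HomologicalComplex.exactAt_iff' _ (k + 2) (k + 1) k (by simp) (by simp),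
    ShortComplex.ShortExact.moduleCat_exact_iff_function_exact]
  rfl

theorem subsingleton_torM_zero_iff :
    Subsingleton (TorM R 0 T M) ↔ Subsingleton (T ⊗[R] M) := by
  let F := (MonoidalCategory.tensoringLeft (ModuleCat.{u} R)).obj (ModuleCat.of R T)
  exact Equiv.subsingleton_congr
    (Iso.toLinearEquiv (F.leftDerivedZeroIsoSelf.app (ModuleCat.of R M))).toEquiv

theorem extVanishes_succ_iff {Y : Type u} [AddCommGroup Y] [Module R Y]
    (P : ProjectiveResolution (ModuleCat.of R M)) (k : ℕ) :
    ExtVanishes R (k + 1) M Y ↔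
      Function.Exact ((P.complex.d (k + 1) k).hom.lcomp R Y)
        ((P.complex.d (k + 2) (k + 1)).hom.lcomp R Y) := by
  rw [ExtVanishes.iff_forall_eq_zero]
  constructor
  · intro h f
    constructor
    · intro hf
      have hf' : P.complex.d (k + 2) (k + 1) ≫ ModuleCat.ofHom (X := P.complex.X (k + 1)) f = 0 := by
        ext1; exact hf
      obtain ⟨g, hg⟩ :=
        (P.extMk_eq_zero_iff (Y := ModuleCat.of R Y) _ (k + 2) rfl hf' k rfl).1 (h _)
      exact ⟨g.hom, congrArg ModuleCat.Hom.hom hg⟩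
    · rintro ⟨g, rfl⟩
      have := congrArg ModuleCat.Hom.hom (P.complex.d_comp_d (k + 2) (k + 1) k)
      ext x
      exact (congrArg g (LinearMap.congr_fun this x)).trans (map_zero g)
  · intro h e
    obtain ⟨f, hf, rfl⟩ := P.extMk_surjective e (k + 2) rfl
    refine (P.extMk_eq_zero_iff f (k + 2) rfl hf k rfl).2 ?_
    obtain ⟨g, hg⟩ := (h f.hom).1 (congrArg ModuleCat.Hom.hom hf)
    exact ⟨ModuleCat.ofHom g, by ext1; exact hg⟩

theorem CharacterModule.dual_exact_iff_exact {A B C : Type*} [AddCommGroup A] [Module R A]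
    [AddCommGroup B] [Module R B] [AddCommGroup C] [Module R C]
    {f : A →ₗ[R] B} {g : B →ₗ[R] C} :
    Function.Exact (CharacterModule.dual g) (CharacterModule.dual f) ↔ Function.Exact f g := by
  constructor
  · intro h x
    constructor
    · intro hx
      refine (Submodule.Quotient.mk_eq_zero (LinearMap.range f)).1 ?_
      refine CharacterModule.eq_zero_of_character_apply fun c ↦ ?_
      obtain ⟨c', hc'⟩ := (h (CharacterModule.dual (LinearMap.range f).mkQ c)).1 (by
        rw [← LinearMap.comp_apply, ← CharacterModule.dual_comp, LinearMap.range_mkQ_comp,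
          CharacterModule.dual_zero, LinearMap.zero_apply])
      have := DFunLike.congr_fun hc' x
      refine this.symm.trans ?_
      change c' (g x) = 0
      rw [hx, map_zero]
    · rintro ⟨y, rfl⟩
      refine CharacterModule.eq_zero_of_character_apply fun c ↦ ?_
      exact DFunLike.congr_fun ((h _).2 ⟨c, rfl⟩) y
  · intro h c
    constructor
    · intro hc
      let c₁ : (B ⧸ LinearMap.range f) →+ AddCircle (1 : ℚ) :=
        QuotientAddGroup.lift (LinearMap.range f).toAddSubgroup c (by
          rintro _ ⟨y, rfl⟩
          exact DFunLike.congr_fun hc y)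
      obtain ⟨c', hc'⟩ := CharacterModule.dual_surjective_of_injective
        ((LinearMap.range f).liftQ g (by rintro _ ⟨y, rfl⟩; exact h.apply_apply_eq_zero y))
        (LinearMap.ker_eq_bot.1 (Submodule.ker_liftQ_eq_bot _ _ _ fun x hx ↦ (h x).1 hx)) c₁
      refine ⟨c', ?_⟩
      ext x
      exact DFunLike.congr_fun hc' (Submodule.Quotient.mk x)
    · rintro ⟨c', rfl⟩
      ext y
      change c' (g (f y)) = 0
      rw [h.apply_apply_eq_zero, map_zero]

theorem subsingleton_characterModule_iff {A : Type*} [AddCommGroup A] :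
    Subsingleton (CharacterModule A) ↔ Subsingleton A :=
  ⟨fun h ↦ subsingleton_of_forall_eq 0 fun _ ↦ CharacterModule.eq_zero_of_character_apply fun c ↦ by
    rw [Subsingleton.elim c 0]; rfl,
  fun h ↦ ⟨fun c c' ↦ by ext x; rw [Subsingleton.elim x 0, map_zero, map_zero]⟩⟩

/-- `Tor_k(T, M)` vanishes if and only if its character module `Ext^k(M, T⋆)` does. -/
theorem subsingleton_torM_iff_extVanishes (k : ℕ) :
    Subsingleton (TorM R k T M) ↔ ExtVanishes R k M (CharacterModule T) := by
  cases k with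
  | zero =>
    rw [subsingleton_torM_zero_iff, ExtVanishes.zero_iff,
      (TensorProduct.comm R T M).toEquiv.subsingleton_congr,
      (CharacterModule.homEquiv (R := R) (A := M) (B := T)).toEquiv.subsingleton_congr,
      subsingleton_characterModule_iff]
  | succ k =>
    let P := projectiveResolution (ModuleCat.of R M)
    rw [subsingleton_torM_succ_iff P, extVanishes_succ_iff P,
      ← LinearMap.rTensor_exact_iff_lTensor_exact, ← CharacterModule.dual_exact_iff_exact]
    symm
    exact Function.Exact.iff_of_ladder_linearEquiv (e₁ := CharacterModule.homEquiv.symm)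
      (e₂ := CharacterModule.homEquiv.symm) (e₃ := CharacterModule.homEquiv.symm) rfl rfl

theorem subsingleton_torM_of_iSup (k : ℕ) (N : ℕ → Submodule R T) (hN : Monotone N)
    (hT : ∀ t, ∃ m, t ∈ N m) (h : ∀ m, Subsingleton (TorM R k (N m) M)) :
    Subsingleton (TorM R k T M) := by
  have key {P : Type u} [AddCommGroup P] [Module R P] (z : T ⊗[R] P) :
      ∃ m, ∃ y : N m ⊗[R] P, (N m).subtype.rTensor P y = z := by
    induction z with
    | zero => exact ⟨0, 0, map_zero _⟩
    | tmul t x =>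
      obtain ⟨m, hm⟩ := hT t
      exact ⟨m, ⟨t, hm⟩ ⊗ₜ x, rfl⟩
    | add z₁ z₂ h₁ h₂ =>
      obtain ⟨m₁, y₁, rfl⟩ := h₁
      obtain ⟨m₂, y₂, rfl⟩ := h₂
      refine ⟨max m₁ m₂, (Submodule.inclusion (hN (le_max_left m₁ m₂))).rTensor P y₁ +
        (Submodule.inclusion (hN (le_max_right m₁ m₂))).rTensor P y₂, ?_⟩
      rw [map_add, ← LinearMap.rTensor_comp_apply, ← LinearMap.rTensor_comp_apply]
      rfl
  cases k with
  | zero =>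
    simp only [subsingleton_torM_zero_iff] at *
    refine subsingleton_of_forall_eq 0 fun z ↦ ?_
    obtain ⟨m, y, rfl⟩ := key z
    rw [@Subsingleton.elim _ (h m) y 0, map_zero]
  | succ k =>
    let P := projectiveResolution (ModuleCat.of R M)
    simp only [subsingleton_torM_succ_iff P] at *
    have hflat : Module.Flat R (P.complex.X k) := by
      have : Module.Projective R (P.complex.X k) :=
        (IsProjective.iff_projective _).2 (inferInstanceAs (Projective (P.complex.X k)))
      infer_instance
    intro z
    constructor
    · intro hz
      obtain ⟨m, y, rfl⟩ := key z
      have hy : (P.complex.d (k + 1) k).hom.lTensor (N m) y = 0 := by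
        refine Module.Flat.rTensor_preserves_injective_linearMap (N m).subtype
          (N m).injective_subtype ?_
        rw [map_zero, ← hz, ← LinearMap.comp_apply, ← LinearMap.comp_apply,
          LinearMap.rTensor_comp_lTensor, LinearMap.lTensor_comp_rTensor]
      obtain ⟨w, rfl⟩ := (h m y).1 hy
      refine ⟨(N m).subtype.rTensor _ w, ?_⟩
      rw [← LinearMap.comp_apply, ← LinearMap.comp_apply,
          LinearMap.rTensor_comp_lTensor, LinearMap.lTensor_comp_rTensor]
    · rintro ⟨w, rfl⟩
      have h0 := congrArg ModuleCat.Hom.hom (P.complex.d_comp_d (k + 2) (k + 1) k)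
      rw [ModuleCat.hom_comp, ModuleCat.hom_zero] at h0
      rw [← LinearMap.comp_apply, ← LinearMap.lTensor_comp, h0, LinearMap.lTensor_zero,
        LinearMap.zero_apply]

end

section

variable {R : Type u} [CommRing R]

theorem Module.Injective.exists_comp_eq_of_ker_le {A B E : Type u} [AddCommGroup A] [Module R A]
    [AddCommGroup B] [Module R B] [AddCommGroup E] [Module R E] [Module.Injective R E]
    (f : A →ₗ[R] B) (φ : A →ₗ[R] E) (h : LinearMap.ker f ≤ LinearMap.ker φ) :
    ∃ g : B →ₗ[R] E, ∀ x, g (f x) = φ x := by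
  obtain ⟨g, hg⟩ := Module.Injective.out ((LinearMap.ker f).liftQ f le_rfl)
    (LinearMap.ker_eq_bot.1 (Submodule.ker_liftQ_eq_bot _ _ _ le_rfl))
    ((LinearMap.ker f).liftQ φ h)
  exact ⟨g, fun x ↦ hg (Submodule.Quotient.mk x)⟩

theorem Module.Flat.linearMap_of_injective [IsNoetherianRing R] (I E : Type u)
    [AddCommGroup I] [Module R I] [AddCommGroup E] [Module R E]
    [Module.Injective R I] [Module.Injective R E] : Module.Flat R (I →ₗ[R] E) := by
  refine Module.Flat.iff_forall_isTrivialRelation.2 fun {l a φ} hrel ↦ ?_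
  let α : (Fin l → R) →ₗ[R] R := Fintype.linearCombination R a
  obtain ⟨k, v, hv⟩ := Submodule.fg_iff_exists_fin_generating_family.1
    (IsNoetherian.noetherian (LinearMap.ker α))
  have hva (j : Fin k) : v j ∈ LinearMap.ker α := hv ▸ Submodule.subset_span ⟨j, rfl⟩
  let V : (Fin l → I) →ₗ[R] (Fin k → I) :=
    LinearMap.pi fun j ↦ ∑ i, v j i • LinearMap.proj i
  let Φ : (Fin l → I) →ₗ[R] E := ∑ i, φ i ∘ₗ LinearMap.proj i
  have hker : LinearMap.ker V ≤ LinearMap.ker Φ := by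
    intro y hy
    have hy' (j : Fin k) : ∑ i, v j i • y i = 0 := by
      simpa [V] using congrFun (LinearMap.mem_ker.1 hy) j
    let ψ : (Fin l → R) →ₗ[R] I := Fintype.linearCombination R y
    have hψ : LinearMap.ker α ≤ LinearMap.ker ψ := by
      rw [← hv, Submodule.span_le]
      rintro _ ⟨j, rfl⟩
      simpa [ψ, Fintype.linearCombination_apply] using hy' j
    obtain ⟨w, hw⟩ := Module.Injective.exists_comp_eq_of_ker_le α ψ hψ
    have hyw (i : Fin l) : y i = a i • w 1 := by
      have := hw (Pi.single i 1)
      simp only [α, ψ, Fintype.linearCombination_apply_single, one_smul] at this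
      rw [← this, ← map_smul, smul_eq_mul, mul_one]
    have := LinearMap.congr_fun hrel (w 1)
    simp only [LinearMap.sum_apply, LinearMap.smul_apply, LinearMap.zero_apply] at this
    simpa [Φ, hyw] using this
  obtain ⟨g, hg⟩ := Module.Injective.exists_comp_eq_of_ker_le V Φ hker
  refine ⟨k, fun i j ↦ v j i, fun j ↦ g ∘ₗ LinearMap.single R (fun _ ↦ I) j, fun i ↦ ?_, fun j ↦ ?_⟩
  · ext y
    have h1 : Φ (Pi.single i y) = φ i y := by
      simp only [Φ, LinearMap.sum_apply, LinearMap.comp_apply, LinearMap.proj_apply]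
      rw [Finset.sum_eq_single i (fun j _ hj ↦ by simp [hj]) (by simp)]
      simp
    have h2 : V (Pi.single i y) = ∑ j, Pi.single j (v j i • y) := by
      ext j
      simp only [V, LinearMap.pi_apply, LinearMap.sum_apply, LinearMap.smul_apply,
        LinearMap.proj_apply, Finset.sum_apply]
      rw [Finset.sum_eq_single i (fun j _ hj ↦ by simp [hj]) (by simp), Finset.sum_pi_single]
      simp
    rw [← h1, ← hg, h2, map_sum]
    simp [Pi.single_smul]
  · have := hva j
    simpa [α, Fintype.linearCombination_apply, mul_comm] using this

theorem InjDimLE.extVanishes [IsNoetherianRing R] {E : Type u} [AddCommGroup E] [Module R E]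
    [Module.Injective R E] {n : ℕ} {D : ModuleCat.{u} R} (h : InjDimLE R n D) {r : ℕ} (hr : n ≤ r)
    (M : Type u) [AddCommGroup M] [Module R M] :
    ExtVanishes R (r + 1) M (CharacterModule (D →ₗ[R] E)) := by
  induction n generalizing D r with
  | zero =>
    have : Module.Injective R D := h
    have := Module.Flat.iff_characterModule_injective.1
      (Module.Flat.linearMap_of_injective (R := R) D E)
    exact ExtVanishes.of_injective
  | succ n ih =>
    obtain ⟨I, _, ι, hι, hI⟩ := h
    obtain ⟨r, rfl⟩ := Nat.exists_eq_add_of_le' (Nat.one_le_of_lt hr)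
    have := Module.Flat.iff_characterModule_injective.1
      (Module.Flat.linearMap_of_injective (R := R) I E)
    have hsurj : Function.Surjective (ι.lcomp R E) := fun φ ↦ by
      obtain ⟨ψ, hψ⟩ := Module.Injective.out ι hι φ
      exact ⟨ψ, LinearMap.ext hψ⟩
    refine (ExtVanishes.cosyzygy (f := CharacterModule.dual (ι.lcomp R E))
      (g := CharacterModule.dual ((LinearMap.range ι).mkQ.lcomp R E))
      (CharacterModule.dual_injective_of_surjective _ hsurj)
      (CharacterModule.dual_surjective_of_injective _
        (LinearMap.lcomp_injective_of_surjective _ (Submodule.mkQ_surjective _)))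
      (CharacterModule.dual_exact_iff_exact.2
        (LinearMap.exact_lcomp_of_exact_of_surjective _ ι.exact_map_mkQ_range
          (Submodule.mkQ_surjective _)))).2 ?_
    exact ih hI (by omega)

end

section

variable {R : Type u} [CommRing R]

namespace IsInjectiveHull

variable {p : Ideal R} {E : Type u} [AddCommGroup E] [Module R E]

theorem exists_smul_mem_range {N : Type u} [AddCommGroup N] [Module R N]
    {ι : N →ₗ[R] E} (hι : ∀ K : Submodule R E, K ≠ ⊥ → K ⊓ LinearMap.range ι ≠ ⊥)
    {e : E} (he : e ≠ 0) : ∃ r : R, ∃ n : N, r • e = ι n ∧ r • e ≠ 0 := by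
  have h1 : Submodule.span R {e} ≠ ⊥ := by simpa using he
  obtain ⟨x, ⟨hx, n, rfl⟩, hne⟩ := Submodule.exists_mem_ne_zero_of_ne_bot (hι _ h1)
  obtain ⟨r, hr⟩ := Submodule.mem_span_singleton.1 hx
  exact ⟨r, n, hr, hr ▸ hne⟩

theorem smul_bijective [hp : p.IsPrime] (h : IsInjectiveHull R (R ⧸ p) E) {s : R} (hs : s ∉ p) :
    Function.Bijective fun e : E ↦ s • e := by
  obtain ⟨hinj, ι, hι, hess⟩ := h
  have hi : Function.Injective (LinearMap.lsmul R E s) := by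
    refine (injective_iff_map_eq_zero _).2 fun e (he : s • e = 0) ↦ ?_
    by_contra hne
    obtain ⟨r, n, hrn, hne'⟩ := exists_smul_mem_range hess hne
    obtain ⟨t, rfl⟩ := Ideal.Quotient.mk_surjective n
    have h0 : s • ι (Ideal.Quotient.mk p t) = 0 := by rw [← hrn, smul_comm, he, smul_zero]
    rw [← map_smul, map_eq_zero_iff ι hι] at h0
    have h1 : s * t ∈ p := Ideal.Quotient.eq_zero_iff_mem.1 (by simpa [Algebra.smul_def] using h0)
    refine hne' (hrn.trans ?_)
    rw [Ideal.Quotient.eq_zero_iff_mem.2 ((hp.mem_or_mem h1).resolve_left hs), map_zero]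
  refine ⟨hi, fun e ↦ ?_⟩
  obtain ⟨g, hg⟩ := Module.Injective.out (LinearMap.lsmul R E s) hi LinearMap.id
  exact ⟨g e, by simpa using hg e⟩

theorem exists_pow_smul_eq_zero [IsNoetherianRing R] (h : IsInjectiveHull R (R ⧸ p) E) {a : R}
    (ha : a ∈ p) (e : E) : ∃ n : ℕ, a ^ n • e = 0 := by
  obtain ⟨hinj, ι, hι, hess⟩ := h
  let K : ℕ →o Ideal R :=
    ⟨fun n ↦ LinearMap.ker (LinearMap.toSpanSingleton R E (a ^ n • e)), by
      refine monotone_nat_of_le_succ fun n r hr ↦ ?_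
      simp only [LinearMap.mem_ker, LinearMap.toSpanSingleton_apply] at hr ⊢
      rw [pow_succ', mul_smul, smul_comm, hr, smul_zero]⟩
  obtain ⟨n, hn⟩ := monotone_stabilizes_iff_noetherian.2 (inferInstanceAs (IsNoetherian R R)) K
  refine ⟨n, ?_⟩
  by_contra hne
  obtain ⟨r, x, hrx, hne'⟩ := exists_smul_mem_range hess hne
  obtain ⟨t, rfl⟩ := Ideal.Quotient.mk_surjective x
  have h1 : a • Ideal.Quotient.mk p t = 0 := by
    rw [Algebra.smul_def, Ideal.Quotient.algebraMap_eq, Ideal.Quotient.eq_zero_iff_mem.2 ha,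
      zero_mul]
  have h2 : r ∈ K (n + 1) := by
    change r • a ^ (n + 1) • e = 0
    rw [pow_succ', mul_smul, smul_comm, hrx, ← map_smul, h1, map_zero]
  rw [← hn (n + 1) n.le_succ] at h2
  exact hne' h2

end IsInjectiveHull

variable {D E : Type u} [AddCommGroup D] [Module R D] [AddCommGroup E] [Module R E]

theorem LinearMap.smul_bijective {s : R} (hs : Function.Bijective fun e : E ↦ s • e) :
    Function.Bijective fun f : D →ₗ[R] E ↦ s • f := by
  let σ : E ≃ₗ[R] E := LinearEquiv.ofBijective (LinearMap.lsmul R E s) hs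
  refine ⟨fun f g h ↦ LinearMap.ext fun x ↦ hs.1 (LinearMap.congr_fun h x),
    fun f ↦ ⟨σ.symm ∘ₗ f, LinearMap.ext fun x ↦ σ.apply_symm_apply (f x)⟩⟩

theorem LinearMap.exists_pow_smul_eq_zero [Module.Finite R D] {a : R}
    (ha : ∀ e : E, ∃ n : ℕ, a ^ n • e = 0) (f : D →ₗ[R] E) : ∃ n : ℕ, a ^ n • f = 0 := by
  obtain ⟨k, v, hv⟩ := Module.Finite.exists_fin (R := R) (M := D)
  choose n hn using fun i ↦ ha (f (v i))
  refine ⟨∑ i, n i, LinearMap.ext_on_range hv fun i ↦ ?_⟩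
  rw [LinearMap.smul_apply, LinearMap.zero_apply, ← Finset.sum_erase_add _ _ (Finset.mem_univ i),
    pow_add, mul_smul, hn, smul_zero]

theorem CharacterModule.smul_bijective {s : R} (hs : Function.Bijective fun e : E ↦ s • e) :
    Function.Bijective fun c : CharacterModule E ↦ s • c :=
  CharacterModule.dual_bijective_iff_bijective.2
    (show Function.Bijective (LinearMap.lsmul R E s) from hs)

end

section

theorem exists_isRegular_of_localRingDepth_eq {A : Type u} [CommRing A] [IsLocalRing A]
    [IsNoetherianRing A] {h : ℕ} (hA : localRingDepth A = h) :
    ∃ rs : List A, (∀ r ∈ rs, r ∈ IsLocalRing.maximalIdeal A) ∧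
      RingTheory.Sequence.IsRegular A rs ∧ rs.length = h ∧
      ∃ y : A, ∀ a, a * y ∈ Ideal.ofList rs ↔ a ∈ IsLocalRing.maximalIdeal A := by
  obtain ⟨rs, hmem, hreg, hlen⟩ : ∃ rs : List A, (∀ r ∈ rs, r ∈ IsLocalRing.maximalIdeal A) ∧
      RingTheory.Sequence.IsRegular A rs ∧ (rs.length : ℕ∞) = h := by
    rw [← hA]
    have hne : Nonempty {n : ℕ∞ | ∃ rs : List A, (∀ r ∈ rs, r ∈ IsLocalRing.maximalIdeal A) ∧
        RingTheory.Sequence.IsRegular A rs ∧ (rs.length : ℕ∞) = n} :=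
      ⟨0, [], by simp, .nil A A, by simp⟩
    exact ENat.sSup_mem_of_nonempty_of_lt_top (hA ▸ ENat.natCast_lt_top h)
  refine ⟨rs, hmem, hreg, by exact_mod_cast hlen, ?_⟩
  let M := A ⧸ (Ideal.ofList rs • ⊤ : Submodule A A)
  have hass : IsLocalRing.maximalIdeal A ∈ associatedPrimes A M := by
    by_contra hnot
    have hsub : ¬ (IsLocalRing.maximalIdeal A : Set A) ⊆
        ⋃ q ∈ associatedPrimes A M, (q : Set A) := by
      intro hsub
      obtain ⟨q, hq, hle⟩ := (Ideal.subset_union_prime_finite (associatedPrimes.finite A M)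
        (f := id) ⊥ ⊥ fun q hq _ _ ↦ hq.isPrime).1 hsub
      refine hnot ?_
      rw [(IsLocalRing.maximalIdeal.isMaximal A).eq_of_le hq.isPrime.ne_top hle]
      exact hq
    rw [biUnion_associatedPrimes_eq_compl_regular, Set.not_subset] at hsub
    obtain ⟨a, ha, hareg⟩ := hsub
    have hareg' : IsSMulRegular M a := not_not.1 hareg
    have hmem' : ∀ r ∈ rs ++ [a], r ∈ IsLocalRing.maximalIdeal A := by
      intro r hr
      rcases List.mem_append.1 hr with hr | hr
      · exact hmem r hr
      · rw [List.mem_singleton.1 hr]; exact ha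
    have hreg' : RingTheory.Sequence.IsRegular A (rs ++ [a]) :=
      .of_isWeaklyRegular_of_mem_maximalIdeal A hmem'
        ((RingTheory.Sequence.isWeaklyRegular_append_iff A rs [a]).2
          ⟨hreg.toIsWeaklyRegular,
            (RingTheory.Sequence.isWeaklyRegular_singleton_iff M a).2 hareg'⟩)
    have hle : ((rs ++ [a]).length : ℕ∞) ≤ localRingDepth A :=
      le_sSup ⟨rs ++ [a], hmem', hreg', rfl⟩
    rw [hA, ← hlen, List.length_append, List.length_singleton] at hle
    exact absurd (by exact_mod_cast hle : rs.length + 1 ≤ rs.length) (by omega)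
  obtain ⟨-, y, hy⟩ := isAssociatedPrime_iff.1 hass
  obtain ⟨y, rfl⟩ := Submodule.Quotient.mk_surjective _ y
  refine ⟨y, fun a ↦ ?_⟩
  rw [hy, Submodule.mem_colon_singleton, Submodule.mem_bot, ← Submodule.Quotient.mk_smul,
    Submodule.Quotient.mk_eq_zero, smul_eq_mul, smul_eq_mul, Ideal.mul_top]

/-- The contractions to `R` of the ideals generated by the initial segments of a regular sequence
of length `h` in `R_p`, such that the maximal ideal of `R_p` is associated to the last quotient. -/
structure LocalRegularChain {R : Type u} [CommRing R] (p : Ideal R) (h : ℕ) where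
  ideal : ℕ → Ideal R
  elt : ℕ → R
  elt_mem : ∀ i < h, elt i ∈ p
  zero : ∃ s ∉ p, ∀ r ∈ ideal 0, s * r = 0
  regular : ∀ i < h, ∀ r, elt i * r ∈ ideal i → r ∈ ideal i
  le_succ : ∀ i < h, ideal i ≤ ideal (i + 1)
  elt_mem_succ : ∀ i < h, elt i ∈ ideal (i + 1)
  succ : ∀ i < h, ∃ s ∉ p, ∀ r ∈ ideal (i + 1), ∃ t, s * r - t * elt i ∈ ideal i
  top : ∃ a, ∀ t, t * a ∈ ideal h ↔ t ∈ p

variable {R : Type u} [CommRing R]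

theorem Ideal.FG.exists_notMem_forall_mul_mem {p : Ideal R} [hp : p.IsPrime] {I : Ideal R}
    (hI : I.FG) {K : Ideal R} (h : ∀ r ∈ I, ∃ s ∉ p, s * r ∈ K) :
    ∃ s ∉ p, ∀ r ∈ I, s * r ∈ K := by
  obtain ⟨S, rfl⟩ := hI
  choose! s hs hsK using h
  refine ⟨∏ r ∈ S, s r, fun hmem ↦ ?_, fun r hr ↦ ?_⟩
  · obtain ⟨r, hr, hrp⟩ := hp.prod_mem_iff.1 hmem
    exact hs r (Ideal.subset_span hr) hrp
  · refine Submodule.span_induction (fun x hx ↦ ?_) (by simp) (fun x y _ _ hx hy ↦ ?_)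
      (fun a x _ hx ↦ ?_) hr
    · obtain ⟨t, ht⟩ := Finset.dvd_prod_of_mem s hx
      rw [ht, mul_right_comm, mul_comm]
      exact K.mul_mem_left t (hsK x (Ideal.subset_span hx))
    · rw [mul_add]; exact K.add_mem hx hy
    · rw [smul_eq_mul, mul_left_comm]; exact K.mul_mem_left a hx

theorem LocalRegularChain.nonempty_of_localRingDepth_eq [IsNoetherianRing R] (p : Ideal R)
    [hp : p.IsPrime] {h : ℕ} (hA : localRingDepth (Localization.AtPrime p) = h) :
    Nonempty (LocalRegularChain p h) := by
  let A := Localization.AtPrime p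
  have : IsNoetherianRing A := IsLocalization.isNoetherianRing p.primeCompl A inferInstance
  obtain ⟨rs, hmem, hreg, rfl, y, hy⟩ := exists_isRegular_of_localRingDepth_eq hA
  let φ := algebraMap R A
  have hφ (s : R) (hs : s ∉ p) : IsUnit (φ s) := IsLocalization.map_units A (⟨s, hs⟩ : p.primeCompl)
  have hmk (a : A) : ∃ r, ∃ s ∉ p, φ r = a * φ s := by
    obtain ⟨⟨r, s⟩, hrs⟩ := IsLocalization.surj p.primeCompl a
    exact ⟨r, s, s.2, hrs.symm⟩
  have hφm (r : R) : φ r ∈ IsLocalRing.maximalIdeal A ↔ r ∈ p :=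
    IsLocalization.AtPrime.to_map_mem_maximal_iff A p r
  have hx (i : ℕ) : ∃ r, ∃ s ∉ p, φ r = rs.getD i 0 * φ s := hmk _
  choose x s hs hxs using hx
  have hget (i : ℕ) (hi : i < rs.length) : φ (x i) = rs[i] * φ (s i) := by
    rw [hxs, List.getD_eq_getElem _ _ hi]
  let J (i : ℕ) : Ideal A := Ideal.ofList (rs.take i)
  have hJ (i : ℕ) (hi : i < rs.length) : J (i + 1) = J i ⊔ Ideal.span {rs[i]} := by
    simp only [J]
    rw [← List.take_concat_get' rs i hi, Ideal.ofList_append, Ideal.ofList_singleton]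
  have hJh : J rs.length = Ideal.ofList rs := congrArg Ideal.ofList List.take_length
  refine ⟨⟨fun i ↦ (J i).comap φ, x, fun i hi ↦ ?_, ?_, fun i hi r hr ↦ ?_, fun i hi ↦ ?_,
    fun i hi ↦ ?_, fun i hi ↦ ?_, ?_⟩⟩
  · rw [← hφm, hget i hi]
    exact Ideal.mul_mem_right _ _ (hmem _ (List.getElem_mem hi))
  · obtain ⟨t, ht, h⟩ := Ideal.FG.exists_notMem_forall_mul_mem (p := p) (K := ⊥)
      (IsNoetherian.noetherian ((J 0).comap φ)) (fun r hr ↦ by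
        have hr0 : φ r = 0 := by simpa [J] using hr
        obtain ⟨t, ht⟩ := (IsLocalization.map_eq_zero_iff p.primeCompl A r).1 hr0
        exact ⟨t, t.2, ht⟩)
    exact ⟨t, ht, h⟩
  · have hwr := hreg.regular_mod_prev i hi
    rw [Ideal.smul_eq_mul, Ideal.mul_top] at hwr
    have h1 : rs[i] * φ (s i) * φ r ∈ J i := by
      rw [← hget i hi, ← map_mul]; exact hr
    have h2 : rs[i] • (Submodule.Quotient.mk (φ r) : A ⧸ J i) = 0 := by
      rw [← Submodule.Quotient.mk_smul, Submodule.Quotient.mk_eq_zero, smul_eq_mul]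
      rwa [mul_right_comm, Ideal.mul_unit_mem_iff_mem _ (hφ _ (hs i))] at h1
    change φ r ∈ J i
    exact (Submodule.Quotient.mk_eq_zero (J i)).1 (hwr (h2.trans (smul_zero _).symm))
  · exact Ideal.comap_mono (hJ i hi ▸ le_sup_left)
  · change φ (x i) ∈ J (i + 1)
    rw [hJ i hi, hget i hi]
    exact Ideal.mul_mem_right _ _ (Ideal.mem_sup_right (Ideal.mem_span_singleton_self _))
  · obtain ⟨t, ht, h⟩ := Ideal.FG.exists_notMem_forall_mul_mem (p := p)
      (K := (J i).comap φ ⊔ Ideal.span {x i})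
      (IsNoetherian.noetherian ((J (i + 1)).comap φ)) (fun r hr ↦ by
        have hr' : φ r ∈ J i ⊔ Ideal.span {rs[i]} := hJ i hi ▸ hr
        obtain ⟨j, hj, _, hb, hjb⟩ := Submodule.mem_sup.1 hr'
        obtain ⟨b, rfl⟩ := Ideal.mem_span_singleton'.1 hb
        obtain ⟨c, u, hu, hc⟩ := hmk b
        refine ⟨s i * u, fun hmem ↦ (hp.mem_or_mem hmem).elim (hs i) hu, ?_⟩
        rw [← sub_add_cancel (s i * u * r) (c * x i)]
        refine Ideal.add_mem _ (Ideal.mem_sup_left ?_) (Ideal.mem_sup_right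
          (Ideal.mul_mem_left _ _ (Ideal.mem_span_singleton_self _)))
        have : φ (s i * u * r - c * x i) = φ (s i) * φ u * j := by
          rw [map_sub, map_mul, map_mul, map_mul, hget i hi, hc, ← hjb]
          ring
        rw [Ideal.mem_comap, this]
        exact Ideal.mul_mem_left _ _ hj)
    refine ⟨t, ht, fun r hr ↦ ?_⟩
    obtain ⟨j, hj, _, hb, hjb⟩ := Submodule.mem_sup.1 (h r hr)
    obtain ⟨b, rfl⟩ := Ideal.mem_span_singleton'.1 hb
    exact ⟨b, by rwa [← hjb, add_sub_cancel_right]⟩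
  · obtain ⟨a, u, hu, ha⟩ := hmk y
    refine ⟨a, fun t ↦ ?_⟩
    rw [Ideal.mem_comap, map_mul, ha, hJh, ← mul_assoc, Ideal.mul_unit_mem_iff_mem _ (hφ u hu), hy,
      hφm]

theorem IsCohenMacaulayRing.exists_localRegularChain [IsNoetherianRing R]
    (hR : IsCohenMacaulayRing R) (p : Ideal R) [hp : p.IsPrime] :
    ∃ h : ℕ, Order.height (⟨p, hp⟩ : PrimeSpectrum R) = h ∧ Nonempty (LocalRegularChain p h) := by
  have h1 : localRingDepth (Localization.AtPrime p) = p.height := by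
    have := hR p hp
    rw [IsLocalization.AtPrime.ringKrullDim_eq_height p] at this
    exact_mod_cast this
  obtain ⟨h, hh⟩ := ENat.ne_top_iff_exists.1 (Ideal.height_ne_top_of_isPrime (I := p))
  refine ⟨h, ?_, LocalRegularChain.nonempty_of_localRingDepth_eq p (h1.trans hh.symm)⟩
  rw [hh]
  exact (PrimeSpectrum.height_eq_orderHeight _).symm

end

section

variable {R : Type u} [CommRing R] {M Y T : Type u} [AddCommGroup M] [Module R M]
  [AddCommGroup Y] [Module R Y] [AddCommGroup T] [Module R T]

namespace ExtVanishes

theorem zero_of_smul_surjective {x : R} (hM : Function.Surjective fun y : M ↦ x • y) {m : ℕ}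
    (hY : ∀ y : Y, x ^ m • y = 0) : ExtVanishes R 0 M Y := by
  refine zero_iff.2 (subsingleton_of_forall_eq 0 fun f ↦ LinearMap.ext fun y ↦ ?_)
  have hM' : Function.Surjective fun y : M ↦ x ^ m • y := by
    simpa only [smul_iterate] using hM.iterate m
  obtain ⟨z, rfl⟩ := hM' y
  rw [map_smul, hY, LinearMap.zero_apply]

theorem succ_of_smul_surjective {x : R} (hM : Function.Surjective fun y : M ↦ x • y) {n m : ℕ}
    (hY : ∀ y : Y, x ^ m • y = 0) (h : ExtVanishes R n (Submodule.torsionBy R M x) Y) :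
    ExtVanishes R (n + 1) M Y := by
  obtain ⟨w, S⟩ := exists_shortExact (Submodule.torsionBy R M x).injective_subtype
    (g := LinearMap.lsmul R M x) hM (LinearMap.exact_subtype_ker_map _)
  rw [iff_forall_eq_zero] at *
  have hinj (e : Abelian.Ext (ModuleCat.of R M) (ModuleCat.of R Y) (n + 1)) (he : x • e = 0) :
      e = 0 := by
    obtain ⟨e', rfl⟩ := Abelian.Ext.contravariant_sequence_exact₃ S _ e
      ((mk₀_lsmul_comp x e).trans he) (add_comm 1 n)
    simp [h e']
  have hpow (k : ℕ) (e : Abelian.Ext (ModuleCat.of R M) (ModuleCat.of R Y) (n + 1))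
      (he : x ^ k • e = 0) : e = 0 := by
    induction k with
    | zero => simpa using he
    | succ k ih => exact ih (hinj _ (by rwa [smul_smul, ← pow_succ']))
  refine fun e ↦ hpow m e ?_
  have h0 : x ^ m • 𝟙 (ModuleCat.of R Y) = 0 := by
    ext y
    exact hY y
  rw [Abelian.Ext.smul_eq_comp_mk₀, h0]
  simp

theorem of_smul_bijective {x : R} (hM : Function.Bijective fun y : M ↦ x • y)
    (hT : ∀ t : T, ∃ m : ℕ, x ^ m • t = 0) (n : ℕ) : ExtVanishes R n M (CharacterModule T) := by
  rw [← subsingleton_torM_iff_extVanishes]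
  refine subsingleton_torM_of_iSup n (fun m ↦ Submodule.torsionBy R T (x ^ m))
    (fun a b hab ↦ Submodule.torsionBy_le_torsionBy_of_dvd _ _ (pow_dvd_pow x hab)) hT fun m ↦ ?_
  rw [subsingleton_torM_iff_extVanishes]
  have hY (y : CharacterModule (Submodule.torsionBy R T (x ^ m))) : x ^ m • y = 0 := by
    ext t
    rw [CharacterModule.smul_apply, Submodule.smul_torsionBy, map_zero]
    rfl
  cases n with
  | zero => exact zero_of_smul_surjective hM.2 hY
  | succ n =>
    have : Subsingleton (Submodule.torsionBy R M x) := subsingleton_of_forall_eq 0 fun t ↦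
      Subtype.ext (hM.1 (t.2.trans (smul_zero x).symm))
    exact succ_of_smul_surjective hM.2 hY of_subsingleton

end ExtVanishes

namespace LocalRegularChain

variable {p : Ideal R} {h : ℕ}

theorem extVanishes_quotient (C : LocalRegularChain p h)
    (hY : ∀ s ∉ p, Function.Bijective fun y : Y ↦ s • y) {i r : ℕ}
    (hi : i ≤ h) (hr : i ≤ r) : ExtVanishes R (r + 1) (R ⧸ C.ideal i) Y := by
  induction i generalizing r with
  | zero =>
    obtain ⟨s, hs, h0⟩ := C.zero
    refine .of_comp_eq_smul (hY s hs) ((C.ideal 0).liftQ (LinearMap.lsmul R R s) h0)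
      (C.ideal 0).mkQ (fun y ↦ ?_) .of_projective
    obtain ⟨y, rfl⟩ := Submodule.Quotient.mk_surjective _ y
    rfl
  | succ i ih =>
    obtain ⟨r, rfl⟩ : ∃ r', r = r' + 1 := ⟨r - 1, by omega⟩
    let f := LinearMap.lsmul R (R ⧸ C.ideal i) (C.elt i)
    have hf : Function.Injective f := by
      refine (injective_iff_map_eq_zero _).2 fun y hy ↦ ?_
      obtain ⟨y, rfl⟩ := Submodule.Quotient.mk_surjective _ y
      exact (Submodule.Quotient.mk_eq_zero _).2
        (C.regular i hi y ((Submodule.Quotient.mk_eq_zero _).1 hy))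
    have hquot : ExtVanishes R (r + 1 + 1) ((R ⧸ C.ideal i) ⧸ LinearMap.range f) Y :=
      .right hf (Submodule.mkQ_surjective _) (LinearMap.exact_map_mkQ_range f)
        (ih (by omega) (by omega)) (ih (by omega) (by omega))
    obtain ⟨s, hs, hsucc⟩ := C.succ i hi
    refine .of_comp_eq_smul (hY s hs)
      ((C.ideal (i + 1)).liftQ (s • (LinearMap.range f).mkQ ∘ₗ (C.ideal i).mkQ) fun y hy ↦ ?_)
      ((LinearMap.range f).liftQ (Submodule.factor (C.le_succ i hi)) ?_) (fun y ↦ ?_) hquot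
    · obtain ⟨t, ht⟩ := hsucc y hy
      refine (Submodule.Quotient.mk_eq_zero _).2 ⟨Submodule.Quotient.mk t, ?_⟩
      refine ((Submodule.Quotient.eq (C.ideal i)).2 ?_).symm
      change s * y - C.elt i * t ∈ C.ideal i
      rwa [mul_comm (C.elt i)]
    · rintro _ ⟨y, rfl⟩
      obtain ⟨y, rfl⟩ := Submodule.Quotient.mk_surjective _ y
      exact (Submodule.Quotient.mk_eq_zero _).2
        (Ideal.mul_mem_right y _ (C.elt_mem_succ i hi))
    · obtain ⟨y, rfl⟩ := Submodule.Quotient.mk_surjective _ y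
      rfl

theorem extVanishes_quotient_prime (C : LocalRegularChain p h)
    (hY : ∀ s ∉ p, Function.Bijective fun y : Y ↦ s • y) {r : ℕ}
    (hr : h ≤ r) (hsucc : ∀ (M : Type u) [AddCommGroup M] [Module R M],
      ExtVanishes R (r + 2) M Y) : ExtVanishes R (r + 1) (R ⧸ p) Y := by
  obtain ⟨a, ha⟩ := C.top
  let f : R ⧸ p →ₗ[R] R ⧸ C.ideal h :=
    Submodule.liftQ p ((C.ideal h).mkQ ∘ₗ LinearMap.mulRight R a)
      fun t ht ↦ (Submodule.Quotient.mk_eq_zero _).2 ((ha t).2 ht)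
  have hf : Function.Injective f := by
    refine (injective_iff_map_eq_zero _).2 fun y hy ↦ ?_
    obtain ⟨y, rfl⟩ := Submodule.Quotient.mk_surjective _ y
    exact (Submodule.Quotient.mk_eq_zero _).2 ((ha y).1 ((Submodule.Quotient.mk_eq_zero _).1 hy))
  exact .left hf (Submodule.mkQ_surjective _) (LinearMap.exact_map_mkQ_range f)
    (C.extVanishes_quotient hY le_rfl hr) (hsucc _)

theorem extVanishes_quotient_of_lt {q : Ideal R} [hq : q.IsPrime] (hqp : q < p)
    (hT : ∀ a ∈ p, ∀ t : T, ∃ m : ℕ, a ^ m • t = 0) {r : ℕ}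
    (hsucc : ∀ (M : Type u) [AddCommGroup M] [Module R M],
      ExtVanishes R (r + 1) M (CharacterModule T)) :
    ExtVanishes R r (R ⧸ q) (CharacterModule T) := by
  obtain ⟨x, hxp, hxq⟩ := SetLike.exists_of_lt hqp
  let f : R ⧸ q →ₗ[R] FractionRing (R ⧸ q) :=
    (Algebra.linearMap (R ⧸ q) (FractionRing (R ⧸ q))).restrictScalars R
  refine .left (f := f) (IsFractionRing.injective (R ⧸ q) (FractionRing (R ⧸ q)))
    (Submodule.mkQ_surjective _) (LinearMap.exact_map_mkQ_range f)
    (.of_smul_bijective ?_ (hT x hxp) r) (hsucc _)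
  have hx : algebraMap R (FractionRing (R ⧸ q)) x ≠ 0 := by
    rw [IsScalarTower.algebraMap_apply R (R ⧸ q), Ne, IsFractionRing.to_map_eq_zero_iff]
    exact fun h ↦ hxq (Ideal.Quotient.eq_zero_iff_mem.1 h)
  simp only [Algebra.smul_def]
  exact mulLeft_bijective₀ _ hx

/-- If `Ext` into `T⋆` vanishes in all large degrees, it already vanishes above `h`. -/
theorem extVanishes_of_le [IsNoetherianRing R] (C : LocalRegularChain p h)
    (hT : ∀ s ∉ p, Function.Bijective fun t : T ↦ s • t)
    (hT' : ∀ a ∈ p, ∀ t : T, ∃ m : ℕ, a ^ m • t = 0) {n : ℕ}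
    (hn : ∀ r, n ≤ r → ∀ (M : Type u) [AddCommGroup M] [Module R M],
      ExtVanishes R (r + 1) M (CharacterModule T)) {r : ℕ} (hr : h ≤ r) :
    ExtVanishes R (r + 1) M (CharacterModule T) := by
  obtain ⟨d, hd⟩ : ∃ d, n ≤ r + d := ⟨n, by omega⟩
  induction d generalizing r M with
  | zero => exact hn r hd M
  | succ d ih =>
    have hsucc (M : Type u) [AddCommGroup M] [Module R M] :
        ExtVanishes R (r + 1 + 1) M (CharacterModule T) := ih (by omega) (by omega)
    have hY (s : R) (hs : s ∉ p) := CharacterModule.smul_bijective (hT s hs)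
    refine .of_prime fun q hq ↦ ?_
    by_cases hqp : q ≤ p
    · rcases hqp.eq_or_lt with rfl | hlt
      · exact C.extVanishes_quotient_prime hY hr hsucc
      · exact extVanishes_quotient_of_lt hlt hT' hsucc
    · obtain ⟨s, hsq, hsp⟩ := SetLike.not_le_iff_exists.1 hqp
      refine .of_smul_eq_zero (hY s hsp) fun y ↦ ?_
      obtain ⟨y, rfl⟩ := Submodule.Quotient.mk_surjective _ y
      exact (Submodule.Quotient.mk_eq_zero _).2 (Ideal.mul_mem_right y q hsq)

end LocalRegularChain

end

section

variable {R : Type u} [CommRing R] {p : Ideal R} {h : ℕ} {I Y T : Type u}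
  [AddCommGroup I] [Module R I] [AddCommGroup Y] [Module R Y] [AddCommGroup T] [Module R T]

namespace LocalRegularChain

theorem smul_surjective_torsionBySet (C : LocalRegularChain p h) [Module.Injective R I] {i : ℕ}
    (hi : i < h) :
    Function.Surjective
      fun y : Submodule.torsionBySet R I (C.ideal i : Set R) ↦ C.elt i • y := by
  intro y
  let φ : R ⧸ C.ideal i →ₗ[R] I :=
    (C.ideal i).liftQ (LinearMap.toSpanSingleton R I y) fun r hr ↦
      (Submodule.mem_torsionBySet_iff _ _).1 y.2 ⟨r, hr⟩
  obtain ⟨g, hg⟩ := Module.Injective.exists_comp_eq_of_ker_le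
    (LinearMap.lsmul R (R ⧸ C.ideal i) (C.elt i)) φ (by
      intro z hz
      obtain ⟨z, rfl⟩ := Submodule.Quotient.mk_surjective _ z
      have hz' : (Submodule.Quotient.mk z : R ⧸ C.ideal i) = 0 :=
        (Submodule.Quotient.mk_eq_zero _).2
          (C.regular i hi z ((Submodule.Quotient.mk_eq_zero _).1 hz))
      rw [hz']
      exact zero_mem _)
  refine ⟨⟨g (Submodule.Quotient.mk 1), (Submodule.mem_torsionBySet_iff _ _).2 fun r ↦ ?_⟩,
    Subtype.ext ?_⟩
  · have hr : (r : R) • (Submodule.Quotient.mk 1 : R ⧸ C.ideal i) = 0 :=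
      (Submodule.Quotient.mk_eq_zero _).2 (Ideal.mul_mem_right 1 _ r.2)
    change (r : R) • g _ = 0
    rw [← map_smul, hr, map_zero]
  · change C.elt i • g _ = y
    rw [← map_smul]
    refine (hg _).trans ?_
    exact one_smul R (y : I)

theorem extVanishes_torsionBySet (C : LocalRegularChain p h) [Module.Injective R I]
    (hY : ∀ s ∉ p, Function.Bijective fun y : Y ↦ s • y) {m : ℕ}
    (hY' : ∀ i < h, ∀ y : Y, C.elt i ^ m • y = 0) {i k : ℕ} (hik : i + k < h) :
    ExtVanishes R k (Submodule.torsionBySet R I (C.ideal i : Set R)) Y := by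
  induction k generalizing i with
  | zero => exact .zero_of_smul_surjective (C.smul_surjective_torsionBySet hik) (hY' i hik)
  | succ k ih =>
    have hi : i < h := by omega
    refine .succ_of_smul_surjective (C.smul_surjective_torsionBySet hi) (hY' i hi) ?_
    obtain ⟨s, hs, hsucc⟩ := C.succ i hi
    let J := Submodule.torsionBySet R I (C.ideal i : Set R)
    let f : Submodule.torsionBy R J (C.elt i) →ₗ[R]
        Submodule.torsionBySet R I (C.ideal (i + 1) : Set R) :=
      (s • J.subtype ∘ₗ Submodule.subtype _).codRestrict _ (by
        rintro ⟨⟨y, hy⟩, hxy⟩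
        refine (Submodule.mem_torsionBySet_iff _ _).2 fun ⟨r, hr⟩ ↦ ?_
        obtain ⟨t, ht⟩ := hsucc r hr
        have h1 : (s * r - t * C.elt i) • y = 0 :=
          (Submodule.mem_torsionBySet_iff _ _).1 hy ⟨_, ht⟩
        have h2 : C.elt i • y = 0 := congrArg Subtype.val hxy
        change r • s • y = 0
        rwa [sub_smul, mul_smul, mul_smul, h2, smul_zero, sub_zero, smul_comm] at h1)
    let g : Submodule.torsionBySet R I (C.ideal (i + 1) : Set R) →ₗ[R]
        Submodule.torsionBy R J (C.elt i) :=
      (Submodule.inclusion (Submodule.torsionBySet_le_torsionBySet_of_subset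
        (C.le_succ i hi))).codRestrict _
        fun y ↦ Subtype.ext ((Submodule.mem_torsionBySet_iff _ _).1 y.2
          ⟨_, C.elt_mem_succ i hi⟩)
    exact .of_comp_eq_smul (hY s hs) f g (fun y ↦ rfl) (ih (by omega))

theorem extVanishes_of_lt_of_pow_smul_eq_zero (C : LocalRegularChain p h) [Module.Injective R I]
    (hY : ∀ s ∉ p, Function.Bijective fun y : Y ↦ s • y) {m : ℕ}
    (hY' : ∀ i < h, ∀ y : Y, C.elt i ^ m • y = 0) {k : ℕ} (hk : k < h) :
    ExtVanishes R k I Y := by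
  obtain ⟨s, hs, h0⟩ := C.zero
  refine .of_comp_eq_smul (hY s hs)
    ((LinearMap.lsmul R I s).codRestrict (Submodule.torsionBySet R I (C.ideal 0 : Set R)) ?_)
    (Submodule.subtype _) (fun y ↦ rfl)
    (C.extVanishes_torsionBySet hY hY' (i := 0) (by omega))
  refine fun y ↦ (Submodule.mem_torsionBySet_iff _ _).2 fun ⟨r, hr⟩ ↦ ?_
  change r • s • y = 0
  rw [smul_smul, mul_comm, h0 r hr, zero_smul]

theorem extVanishes_of_lt (C : LocalRegularChain p h) [Module.Injective R I]
    (hT : ∀ s ∉ p, Function.Bijective fun t : T ↦ s • t)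
    (hT' : ∀ a ∈ p, ∀ t : T, ∃ m : ℕ, a ^ m • t = 0) {k : ℕ} (hk : k < h) :
    ExtVanishes R k I (CharacterModule T) := by
  rw [← subsingleton_torM_iff_extVanishes]
  let N (m : ℕ) : Submodule R T :=
    ⨅ i ∈ Finset.range h, Submodule.torsionBy R T (C.elt i ^ m)
  have hN {m : ℕ} {t : T} : t ∈ N m ↔ ∀ i < h, C.elt i ^ m • t = 0 := by
    simp [N, Submodule.mem_iInf]
  have hle {a b i : ℕ} {t : T} (hab : a ≤ b) (ha : C.elt i ^ a • t = 0) :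
      C.elt i ^ b • t = 0 := by
    rw [← Nat.sub_add_cancel hab, pow_add, mul_smul, ha, smul_zero]
  refine subsingleton_torM_of_iSup k N
    (fun a b hab t ht ↦ hN.2 fun i hi ↦ hle hab (hN.1 ht i hi)) (fun t ↦ ?_) fun m ↦ ?_
  · choose! n hn using fun i (hi : i < h) ↦ hT' _ (C.elt_mem i hi) t
    exact ⟨(Finset.range h).sup n, hN.2 fun i hi ↦
      hle (Finset.le_sup (Finset.mem_range.2 hi)) (hn i hi)⟩
  · rw [subsingleton_torM_iff_extVanishes]
    refine C.extVanishes_of_lt_of_pow_smul_eq_zero (m := m)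
      (fun s hs ↦ CharacterModule.smul_bijective ⟨fun a b hab ↦ ?_, fun t ↦ ?_⟩)
      (fun i hi c ↦ ?_) hk
    · exact Subtype.ext ((hT s hs).1 (congrArg Subtype.val hab))
    · obtain ⟨t', ht'⟩ := (hT s hs).2 t
      refine ⟨⟨t', hN.2 fun i hi ↦ (hT s hs).1 ?_⟩, Subtype.ext ht'⟩
      have := hN.1 t.2 i hi
      rw [← ht'] at this
      simpa only [smul_zero, smul_comm s] using this
    · ext t
      have ht : C.elt i ^ m • t = 0 := Subtype.ext (hN.1 t.2 i hi)
      rw [CharacterModule.smul_apply, ht, map_zero]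
      rfl

end LocalRegularChain

/-- Vanishing of `Ext` in all degrees below `h` passes from the terms of a complete injective
resolution to its images. -/
theorem CompleteInjRes.extVanishes_range (X : CompleteInjRes R) {h : ℕ}
    (hX : ∀ k < h, ∀ i, ExtVanishes R k (X.E i) Y) {k : ℕ} (hk : k < h) (i : ℤ) :
    ExtVanishes R k (LinearMap.range (X.d i)) Y := by
  induction k generalizing i with
  | zero => exact .zero_of_surjective (X.d i).surjective_rangeRestrict (hX 0 hk i)
  | succ k ih =>
    obtain ⟨j, rfl⟩ : ∃ j, i = j + 1 := ⟨i - 1, by ring⟩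
    refine .right (LinearMap.range (X.d j)).injective_subtype
      (X.d (j + 1)).surjective_rangeRestrict ?_ (ih (by omega) j) (hX _ hk _)
    rw [LinearMap.exact_iff, LinearMap.ker_rangeRestrict, Submodule.range_subtype, X.exct]

end

/-- Over a Cohen-Macaulay noetherian ring with dualizing module `D`, for any
Gorenstein injective module `G` one has `Tor_k^R(Hom_R(D, E_R(R/p)), G) = 0` for all
`k ≠ ht p`. -/
theorem statement11 (R : Type u) [CommRing R] [IsNoetherianRing R]
    (hCM : IsCohenMacaulayRing R)
    (D : Type u) [AddCommGroup D] [Module R D] (hD : IsDualizing R D)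
    (p : Ideal R) (hp : p.IsPrime)
    (Ep : Type u) [AddCommGroup Ep] [Module R Ep] (hEp : IsInjectiveHull R (R ⧸ p) Ep)
    (G : Type u) [AddCommGroup G] [Module R G] (hG : GorensteinInjective R G) :
    ∀ k : ℕ, (k : ℕ∞) ≠ Order.height (⟨p, hp⟩ : PrimeSpectrum R) →
      Subsingleton (TorM R k (D →ₗ[R] Ep) G) := by
  intro k hk
  rw [subsingleton_torM_iff_extVanishes]
  obtain ⟨h, hh, ⟨C⟩⟩ := hCM.exists_localRegularChain p
  have hne : k ≠ h := by rintro rfl; exact hk hh.symm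
  have : Module.Finite R D := hD.1.1
  have : Module.Injective R Ep := hEp.1
  have hT (s : R) (hs : s ∉ p) : Function.Bijective fun t : D →ₗ[R] Ep ↦ s • t :=
    LinearMap.smul_bijective (hEp.smul_bijective hs)
  have hT' (a : R) (ha : a ∈ p) (t : D →ₗ[R] Ep) : ∃ m : ℕ, a ^ m • t = 0 :=
    LinearMap.exists_pow_smul_eq_zero (hEp.exists_pow_smul_eq_zero ha) t
  rcases hne.lt_or_gt with hlt | hlt
  · obtain ⟨X, ⟨e⟩⟩ := hG
    refine .congr e (X.extVanishes_range (fun k hk i ↦ ?_) hlt 0)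
    have := X.inj i
    exact C.extVanishes_of_lt hT hT' hk
  · obtain ⟨n, hn⟩ := hD.2
    obtain ⟨r, rfl⟩ : ∃ r, k = r + 1 := ⟨k - 1, by omega⟩
    exact C.extVanishes_of_le hT hT' (fun r hr M _ _ ↦ hn.extVanishes hr M) (by omega)
end
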